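/- arXiv:2510.19163 — 5 statements merged into one kernel-verified Lean document; each statement's English description precedes it below -/
import Mathlib

section
/- There is an absolute constant c > 0 with the following property. Let d ≥ 1 be an integer, U ≥ 1, D > 1, and let f : ℝ^d → ℝ be four times continuously differentiable with sup_{z∈ℝ^d} max_i |∂_i f(z)| ≤ L₁ and sup_{z∈ℝ^d} max_{i,j} |∂²_{ij} f(z)| ≤ L₂. Define g(ω) = ∫ f dq(·;ω) for ω in the mean-field expectation-parameter domain. Then g is L-smooth relative to A* on Ω̃, i.e. −L·D_{A*}(v,u) ≤ g(v) − g(u) − ⟨∇g(u), v−u⟩ ≤ L·D_{A*}(v,u) for all u, v ∈ Ω̃, where L = c·(d·D²·U·(L₁+L₂·U) + d·D³·(L₁+L₂·U)). -/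
open MeasureTheory ProbabilityTheory
open scoped RealInnerProductSpace

noncomputable section

/-- The space of mean-field expectation parameters `ω = (ξ, Ξ) ∈ ℝ^d × ℝ^d`,
realized as a Euclidean space indexed by `Fin d ⊕ Fin d` (`Sum.inl i ↦ ξ_i`,
`Sum.inr i ↦ Ξ_ii`). -/
abbrev MFParam (d : ℕ) := EuclideanSpace ℝ (Fin d ⊕ Fin d)

/-- the mean `ξ_i` -/
def xiP {d : ℕ} (ω : MFParam d) (i : Fin d) : ℝ := ω (Sum.inl i)

/-- the second moment `Ξ_ii` -/
def XiP {d : ℕ} (ω : MFParam d) (i : Fin d) : ℝ := ω (Sum.inr i)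

/-- the variance `Ξ_ii - ξ_i ^ 2` -/
def varP {d : ℕ} (ω : MFParam d) (i : Fin d) : ℝ := XiP ω i - (xiP ω i) ^ 2

/-- The mirror map `A*(ξ, Ξ) = -(1/2) ∑ i, log (Ξ_ii - ξ_i²)`. -/
def Astar {d : ℕ} (ω : MFParam d) : ℝ := -(1 / 2) * ∑ i, Real.log (varP ω i)

/-- The Bregman divergence `D_{A*}(u, v)`. -/
def bregAstar {d : ℕ} (u v : MFParam d) : ℝ :=
  Astar u - Astar v - ⟪gradient Astar v, u - v⟫

/-- The bounded parameter domain `Ω̃`. -/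
def OmegaT (d : ℕ) (U D : ℝ) : Set (MFParam d) :=
  {ω | ∀ i, |xiP ω i| ≤ U ∧ D⁻¹ ≤ varP ω i ∧ varP ω i ≤ D}

/-- The mean-field Gaussian measure `q(·; ω) = ⨂_i N(ξ_i, Ξ_ii - ξ_i²)` on `ℝ^d`. -/
def mfGauss (d : ℕ) (ω : MFParam d) : Measure (Fin d → ℝ) :=
  Measure.pi fun i => gaussianReal (xiP ω i) (varP ω i).toNNReal

lemma mvt_aux {d : ℕ} {F : (Fin d → ℝ) → ℝ} (hF : Differentiable ℝ F) (x y : Fin d → ℝ) :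
    ∃ t ∈ Set.Ioo (0 : ℝ) 1, F (x + y) - F x = fderiv ℝ F (x + t • y) y := by
  have hd : ∀ t : ℝ, HasDerivAt (fun t : ℝ => F (x + t • y)) (fderiv ℝ F (x + t • y) y) t := by
    intro t
    have h1 : HasDerivAt (fun t : ℝ => x + t • y) y t := by
      simpa using ((hasDerivAt_id t).smul_const y).const_add x
    exact (hF (x + t • y)).hasFDerivAt.comp_hasDerivAt t h1
  obtain ⟨t, ht, h⟩ := exists_hasDerivAt_eq_slope (fun t : ℝ => F (x + t • y)) _ (zero_lt_one)
    (fun t _ => (hd t).continuousAt.continuousWithinAt) (fun t _ => hd t)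
  refine ⟨t, ht, ?_⟩
  rw [h]; simp

lemma clm_sum {d : ℕ} (l : (Fin d → ℝ) →L[ℝ] ℝ) (y : Fin d → ℝ) :
    l y = ∑ i, y i * l (Pi.single i 1) := by
  conv_lhs => rw [pi_eq_sum_univ' y]
  rw [map_sum]
  refine Finset.sum_congr rfl fun i _ => ?_
  rw [map_smul, smul_eq_mul]

lemma lip_aux {d : ℕ} {F : (Fin d → ℝ) → ℝ} (hF : Differentiable ℝ F) {L : ℝ}
    (hL : ∀ z i, |fderiv ℝ F z (Pi.single i 1)| ≤ L) (x y : Fin d → ℝ) :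
    |F (x + y) - F x| ≤ L * ∑ i, |y i| := by
  obtain ⟨t, -, h⟩ := mvt_aux hF x y
  rw [h, clm_sum, Finset.mul_sum]
  refine (Finset.abs_sum_le_sum_abs _ _).trans (Finset.sum_le_sum fun i _ => ?_)
  rw [abs_mul, mul_comm]
  exact mul_le_mul_of_nonneg_right (hL _ _) (abs_nonneg _)

lemma taylor_aux {d : ℕ} {f : (Fin d → ℝ) → ℝ} (hf : ContDiff ℝ 2 f) {L : ℝ} (hL0 : 0 ≤ L)
    (hL : ∀ (z : Fin d → ℝ) (i j : Fin d),
      |fderiv ℝ (fun w => fderiv ℝ f w (Pi.single j 1)) z (Pi.single i 1)| ≤ L)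
    (x y : Fin d → ℝ) :
    |f (x + y) - f x - ∑ i, y i * fderiv ℝ f x (Pi.single i 1)| ≤ L * d * ∑ i, y i ^ 2 := by
  obtain ⟨t, ht, h⟩ := mvt_aux (hf.differentiable (by norm_num)) x y
  have hd : ∀ j, Differentiable ℝ (fun w => fderiv ℝ f w (Pi.single j 1)) := fun j =>
    ((hf.fderiv_right (m := 1) (by norm_num)).clm_apply contDiff_const).differentiable (by norm_num)
  rw [h, clm_sum, ← Finset.sum_sub_distrib]
  have h1 : ∀ j, |fderiv ℝ f (x + t • y) (Pi.single j 1) - fderiv ℝ f x (Pi.single j 1)|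
      ≤ L * ∑ i, |y i| := by
    intro j
    refine (lip_aux (hd j) (fun z i => hL z i j) x (t • y)).trans ?_
    refine mul_le_mul_of_nonneg_left (Finset.sum_le_sum fun i _ => ?_) hL0
    simp only [Pi.smul_apply, smul_eq_mul, abs_mul, abs_of_pos ht.1]
    nlinarith [abs_nonneg (y i), ht.2]
  have h2 : (∑ i, |y i|) ^ 2 ≤ d * ∑ i, y i ^ 2 := by
    simpa using sq_sum_le_card_mul_sum_sq (s := (Finset.univ : Finset (Fin d))) (f := fun i => |y i|)
  calc _ ≤ ∑ j, |y j| * (L * ∑ i, |y i|) := by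
        refine (Finset.abs_sum_le_sum_abs _ _).trans (Finset.sum_le_sum fun j _ => ?_)
        rw [← mul_sub, abs_mul]
        exact mul_le_mul_of_nonneg_left (h1 j) (abs_nonneg _)
    _ = L * (∑ i, |y i|) ^ 2 := by rw [← Finset.sum_mul]; ring
    _ ≤ _ := by rw [mul_assoc]; exact mul_le_mul_of_nonneg_left h2 hL0

/-- standard Gaussian on `ℝ^d` -/
def gam (d : ℕ) : Measure (Fin d → ℝ) := Measure.pi fun _ => gaussianReal 0 1

instance (d : ℕ) : IsProbabilityMeasure (gam d) := by unfold gam; infer_instance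

/-- affine push-forward map -/
def TT {d : ℕ} (m a z : Fin d → ℝ) : Fin d → ℝ := fun i => m i + a i * z i

lemma cont_TT {d : ℕ} (m a : Fin d → ℝ) : Continuous (TT m a) := by
  unfold TT; fun_prop

lemma int_sq {d : ℕ} (i : Fin d) : Integrable (fun z : Fin d → ℝ => z i ^ 2) (gam d) := by
  refine integrable_comp_eval (μ := fun _ : Fin d => gaussianReal 0 1) (i := i)
    (f := fun x : ℝ => x ^ 2) ?_
  exact (memLp_id_gaussianReal 2).integrable_sq

lemma int_id {d : ℕ} (i : Fin d) : Integrable (fun z : Fin d → ℝ => z i) (gam d) := by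
  refine integrable_comp_eval (μ := fun _ : Fin d => gaussianReal 0 1) (i := i)
    (f := fun x : ℝ => x) ?_
  exact (memLp_id_gaussianReal 1).integrable (by simp)

lemma integral_sq {d : ℕ} (i : Fin d) : ∫ z, z i ^ 2 ∂(gam d) = 1 := by
  have h := integral_comp_eval (μ := fun _ : Fin d => gaussianReal 0 1) (i := i)
    (f := fun x : ℝ => x ^ 2) (by fun_prop)
  have h2 := variance_eq_integral (X := fun x : ℝ => x) (μ := gaussianReal 0 1) (by fun_prop)
  rw [variance_fun_id_gaussianReal] at h2
  simp at h2
  unfold gam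
  rw [h, ← h2]

lemma mfGauss_eq {d : ℕ} (ω : MFParam d) :
    mfGauss d ω = (gam d).map (TT (xiP ω) (fun i => √(varP ω i))) := by
  have h : ∀ i, Measure.map (fun x => xiP ω i + √(varP ω i) * x) (gaussianReal 0 1)
      = gaussianReal (xiP ω i) (varP ω i).toNNReal := by
    intro i
    have : (fun x => xiP ω i + √(varP ω i) * x) = (fun x => xiP ω i + x) ∘
      (fun x => √(varP ω i) * x) := rfl
    rw [this, ← Measure.map_map (by fun_prop) (by fun_prop), gaussianReal_map_const_mul,
      gaussianReal_map_const_add]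
    congr 1
    · simp
    · ext
      simp only [NNReal.coe_mul, NNReal.coe_one, mul_one, Real.coe_toNNReal']
      change (√(varP ω i)) ^ 2 = _
      rcases le_total 0 (varP ω i) with h | h
      · rw [Real.sq_sqrt h, max_eq_left h]
      · rw [Real.sqrt_eq_zero_of_nonpos h, max_eq_right h]; simp
  unfold mfGauss gam TT
  have : ∀ i, SigmaFinite (Measure.map (fun x => xiP ω i + √(varP ω i) * x) (gaussianReal 0 1)) := by
    intro i; rw [h]; infer_instance
  rw [Measure.pi_map_pi (f := fun i x => xiP ω i + √(varP ω i) * x) (fun i => by fun_prop)]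
  congr 1; ext1 i; exact (h i).symm

lemma integral_mfGauss {d : ℕ} {f : (Fin d → ℝ) → ℝ} (hf : Continuous f) (ω : MFParam d) :
    ∫ z, f z ∂(mfGauss d ω) = ∫ z, f (TT (xiP ω) (fun i => √(varP ω i)) z) ∂(gam d) := by
  rw [mfGauss_eq, integral_map (cont_TT _ _).aemeasurable hf.aestronglyMeasurable]

lemma int_f {d : ℕ} {f : (Fin d → ℝ) → ℝ} (hf : Differentiable ℝ f) {L : ℝ}
    (hL : ∀ z i, |fderiv ℝ f z (Pi.single i 1)| ≤ L) (m a : Fin d → ℝ) :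
    Integrable (fun z => f (TT m a z)) (gam d) := by
  have hi : Integrable (fun z : Fin d → ℝ => |f m| + L * ∑ i, |a i * z i|) (gam d) :=
    (integrable_const _).add ((integrable_finsetSum _ fun i _ =>
      ((int_id i).const_mul (a i)).abs).const_mul L)
  refine hi.mono' (hf.continuous.comp (cont_TT m a)).aestronglyMeasurable
    (Filter.Eventually.of_forall fun z => ?_)
  have h := lip_aux hf hL m (fun i => a i * z i)
  have h2 : TT m a z = m + (fun i => a i * z i) := rfl
  rw [h2, Real.norm_eq_abs]
  have := abs_sub_abs_le_abs_sub (f (m + fun i => a i * z i)) (f m)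
  linarith

section core
variable {d : ℕ} {f : (Fin d → ℝ) → ℝ} {L₁ L₂ : ℝ}

lemma int_P (hf : ContDiff ℝ 2 f)
    (hL1 : ∀ z i, |fderiv ℝ f z (Pi.single i 1)| ≤ L₁) (m a : Fin d → ℝ) (i : Fin d) :
    Integrable (fun z => fderiv ℝ f (TT m a z) (Pi.single i 1)) (gam d) := by
  have hc : Continuous (fun w => fderiv ℝ f w (Pi.single i 1)) :=
    (hf.continuous_fderiv (by norm_num)).clm_apply continuous_const
  refine Integrable.mono' (integrable_const L₁) (hc.comp (cont_TT m a)).aestronglyMeasurable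
    (Filter.Eventually.of_forall fun z => hL1 _ _)

lemma int_Q (hf : ContDiff ℝ 2 f)
    (hL1 : ∀ z i, |fderiv ℝ f z (Pi.single i 1)| ≤ L₁) (m a : Fin d → ℝ) (i : Fin d) :
    Integrable (fun z => fderiv ℝ f (TT m a z) (Pi.single i 1) * z i) (gam d) := by
  have hc : Continuous (fun w => fderiv ℝ f w (Pi.single i 1)) :=
    (hf.continuous_fderiv (by norm_num)).clm_apply continuous_const
  refine Integrable.bdd_mul (c := L₁) (int_id i) (hc.comp (cont_TT m a)).aestronglyMeasurable
    (Filter.Eventually.of_forall fun z => hL1 _ _)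

lemma core_bound (hf : ContDiff ℝ 2 f) (hL0 : 0 ≤ L₂)
    (hL1 : ∀ z i, |fderiv ℝ f z (Pi.single i 1)| ≤ L₁)
    (hL2 : ∀ (z : Fin d → ℝ) (i j : Fin d),
      |fderiv ℝ (fun w => fderiv ℝ f w (Pi.single j 1)) z (Pi.single i 1)| ≤ L₂)
    (m a m' a' : Fin d → ℝ) :
    |(∫ z, f (TT m' a' z) ∂(gam d)) - (∫ z, f (TT m a z) ∂(gam d))
      - ∑ i, ((m' i - m i) * (∫ z, fderiv ℝ f (TT m a z) (Pi.single i 1) ∂(gam d))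
        + (a' i - a i) * (∫ z, fderiv ℝ f (TT m a z) (Pi.single i 1) * z i ∂(gam d)))|
      ≤ L₂ * d * ∑ i, (2 * (m' i - m i) ^ 2 + 2 * (a' i - a i) ^ 2) := by
  have hfd := hf.differentiable (by norm_num)
  have e1 : ∀ i ∈ (Finset.univ : Finset (Fin d)), Integrable (fun z : Fin d → ℝ =>
      (m' i - m i) * fderiv ℝ f (TT m a z) (Pi.single i 1)
      + (a' i - a i) * (fderiv ℝ f (TT m a z) (Pi.single i 1) * z i)) (gam d) := fun i _ =>
    ((int_P hf hL1 m a i).const_mul _).add ((int_Q hf hL1 m a i).const_mul _)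
  have e2 : ∑ i, ((m' i - m i) * (∫ z, fderiv ℝ f (TT m a z) (Pi.single i 1) ∂(gam d))
        + (a' i - a i) * (∫ z, fderiv ℝ f (TT m a z) (Pi.single i 1) * z i ∂(gam d)))
      = ∫ z, ∑ i, ((m' i - m i) * fderiv ℝ f (TT m a z) (Pi.single i 1)
      + (a' i - a i) * (fderiv ℝ f (TT m a z) (Pi.single i 1) * z i)) ∂(gam d) := by
    rw [integral_finsetSum _ e1]
    refine Finset.sum_congr rfl fun i _ => ?_
    rw [integral_add ((int_P hf hL1 m a i).const_mul _) ((int_Q hf hL1 m a i).const_mul _),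
      integral_const_mul, integral_const_mul]
  rw [e2, ← integral_sub (int_f hfd hL1 m' a') (int_f hfd hL1 m a),
    ← integral_sub (f := fun z => f (TT m' a' z) - f (TT m a z))
      ((int_f hfd hL1 m' a').sub (int_f hfd hL1 m a)) (integrable_finsetSum _ e1)]
  have e3 : ∀ i ∈ (Finset.univ : Finset (Fin d)), Integrable (fun z : Fin d → ℝ =>
      2 * (m' i - m i) ^ 2 + 2 * (a' i - a i) ^ 2 * z i ^ 2) (gam d) := fun i _ =>
    (integrable_const _).add ((int_sq i).const_mul _)
  have e4 : ∫ z, L₂ * d * ∑ i, (2 * (m' i - m i) ^ 2 + 2 * (a' i - a i) ^ 2 * z i ^ 2) ∂(gam d)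
      = L₂ * d * ∑ i, (2 * (m' i - m i) ^ 2 + 2 * (a' i - a i) ^ 2) := by
    rw [integral_const_mul, integral_finsetSum _ e3]
    congr 1
    refine Finset.sum_congr rfl fun i _ => ?_
    rw [integral_add (integrable_const _) ((int_sq i).const_mul _), integral_const_mul (2 * (a' i - a i) ^ 2), integral_sq]
    simp
  rw [← e4, ← Real.norm_eq_abs]
  refine norm_integral_le_of_norm_le ((integrable_finsetSum _ e3).const_mul _)
    (Filter.Eventually.of_forall fun z => ?_)
  have ht := taylor_aux hf hL0 hL2 (TT m a z) (fun i => (m' i - m i) + (a' i - a i) * z i)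
  have h1 : TT m a z + (fun i => (m' i - m i) + (a' i - a i) * z i) = TT m' a' z := by
    ext i; simp [TT]; ring
  rw [h1] at ht
  rw [Real.norm_eq_abs]
  refine le_trans (le_of_eq ?_) (ht.trans ?_)
  · congr 2
    refine Finset.sum_congr rfl fun i _ => ?_
    ring
  · refine mul_le_mul_of_nonneg_left (Finset.sum_le_sum fun i _ => ?_) (by positivity)
    nlinarith [sq_nonneg ((m' i - m i) - (a' i - a i) * z i)]

lemma Q_bound (hf : ContDiff ℝ 2 f) 
    (hL1 : ∀ z i, |fderiv ℝ f z (Pi.single i 1)| ≤ L₁)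
    (hL2 : ∀ (z : Fin d → ℝ) (i j : Fin d),
      |fderiv ℝ (fun w => fderiv ℝ f w (Pi.single j 1)) z (Pi.single i 1)| ≤ L₂)
    (m a : Fin d → ℝ) (i : Fin d) (ha : 0 ≤ a i) :
    |∫ z, fderiv ℝ f (TT m a z) (Pi.single i 1) * z i ∂(gam d)| ≤ L₂ * a i := by
  set F : (Fin d → ℝ) → ℝ := fun w => fderiv ℝ f w (Pi.single i 1) with hF
  have hFd : Differentiable ℝ F :=
    ((hf.fderiv_right (m := 1) (by norm_num)).clm_apply contDiff_const).differentiable (by norm_num)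
  let φ : (Fin d → ℝ) → (Fin d → ℝ) := fun z j => if j = i then - z j else z j
  have hφ : MeasurePreserving φ (gam d) (gam d) := by
    refine measurePreserving_pi (fun _ : Fin d => gaussianReal 0 1) (fun _ => gaussianReal 0 1)
      (f := fun j x => if j = i then -x else x) (fun j => ?_)
    by_cases h : j = i
    · simp only [h, if_true]
      exact ⟨by fun_prop, by rw [gaussianReal_map_neg]; simp⟩
    · simp only [h, if_false]; exact MeasurePreserving.id _
  have hQ : Integrable (fun z => F (TT m a z) * z i) (gam d) := int_Q hf hL1 m a i
  have hc : Continuous (fun z => F (TT m a z) * z i) :=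
    (hFd.continuous.comp (cont_TT m a)).mul (continuous_apply i)
  have h1 : ∫ z, F (TT m a (φ z)) * (φ z) i ∂(gam d) = ∫ z, F (TT m a z) * z i ∂(gam d) := by
    conv_rhs => rw [← hφ.map_eq]
    rw [integral_map hφ.measurable.aemeasurable hc.aestronglyMeasurable]
  have hQ' : Integrable (fun z => F (TT m a (φ z)) * (φ z) i) (gam d) :=
    hφ.integrable_comp_of_integrable hQ
  have h2 : ∫ z, F (TT m a z) * z i ∂(gam d) =
      (1/2) * ∫ z, (F (TT m a z) * z i + F (TT m a (φ z)) * (φ z) i) ∂(gam d) := by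
    rw [integral_add hQ hQ', h1]; ring
  have h3 : ‖∫ z, (F (TT m a z) * z i + F (TT m a (φ z)) * (φ z) i) ∂(gam d)‖ ≤
      ∫ z, (2 * L₂ * a i) * z i ^ 2 ∂(gam d) := by
    refine norm_integral_le_of_norm_le ((int_sq i).const_mul _)
      (Filter.Eventually.of_forall fun z => ?_)
    have h4 := lip_aux hFd (fun z j => hL2 z j i) (TT m a (φ z)) (Pi.single i (2 * a i * z i))
    have h5 : TT m a (φ z) + Pi.single i (2 * a i * z i) = TT m a z := by
      ext j
      by_cases h : j = i
      · subst h; simp [TT, φ]; ring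
      · simp [TT, φ, h]
    have h6 : ∑ j, |(Pi.single i (2 * a i * z i) : Fin d → ℝ) j| = 2 * a i * |z i| := by
      rw [Finset.sum_eq_single i]
      · simp [abs_mul, abs_of_nonneg ha]
      · intro j _ h; simp [h]
      · simp
    rw [h5, h6] at h4
    have h7 : F (TT m a z) * z i + F (TT m a (φ z)) * (φ z) i
        = (F (TT m a z) - F (TT m a (φ z))) * z i := by simp [φ]; ring
    rw [h7, Real.norm_eq_abs, abs_mul]
    calc _ ≤ L₂ * (2 * a i * |z i|) * |z i| := mul_le_mul_of_nonneg_right h4 (abs_nonneg _)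
      _ = 2 * L₂ * a i * |z i| ^ 2 := by ring
      _ = _ := by rw [sq_abs]
  rw [integral_const_mul, integral_sq, Real.norm_eq_abs] at h3
  rw [h2, abs_mul, abs_of_pos (by norm_num : (0:ℝ) < 1/2)]
  linarith

end core

/-- derivative of `varP` -/
def dvar {d : ℕ} (u : MFParam d) (i : Fin d) : MFParam d →L[ℝ] ℝ :=
  EuclideanSpace.proj (Sum.inr i) - (2 * xiP u i) • EuclideanSpace.proj (Sum.inl i)

lemma dvar_apply {d : ℕ} (u v : MFParam d) (i : Fin d) :
    dvar u i (v - u) = varP v i - varP u i + (xiP v i - xiP u i) ^ 2 := by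
  simp [dvar, varP, xiP, XiP]; ring

lemma hasFDerivAt_xiP {d : ℕ} (u : MFParam d) (i : Fin d) :
    HasFDerivAt (fun ω : MFParam d => xiP ω i)
      (EuclideanSpace.proj (Sum.inl i) : MFParam d →L[ℝ] ℝ) u :=
  (EuclideanSpace.proj (𝕜 := ℝ) (Sum.inl i : Fin d ⊕ Fin d)).hasFDerivAt

lemma hasFDerivAt_varP {d : ℕ} (u : MFParam d) (i : Fin d) :
    HasFDerivAt (fun ω : MFParam d => varP ω i) (dvar u i) u := by
  have h2 : HasFDerivAt (fun ω : MFParam d => XiP ω i)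
      (EuclideanSpace.proj (Sum.inr i) : MFParam d →L[ℝ] ℝ) u :=
    (EuclideanSpace.proj (𝕜 := ℝ) (Sum.inr i : Fin d ⊕ Fin d)).hasFDerivAt
  have h := h2.sub ((hasFDerivAt_xiP u i).pow 2)
  refine h.congr_fderiv ?_
  ext w
  simp [dvar]

lemma inner_gradient {d : ℕ} {g : MFParam d → ℝ} {l : MFParam d →L[ℝ] ℝ} {u : MFParam d}
    (h : HasFDerivAt g l u) (w : MFParam d) : ⟪gradient g u, w⟫ = l w := by
  unfold gradient
  rw [InnerProductSpace.toDual_symm_apply, h.fderiv]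

lemma breg_eq {d : ℕ} (u v : MFParam d) (hu : ∀ i, 0 < varP u i) :
    bregAstar v u = ∑ i, (1/2) * (Real.log (varP u i) - Real.log (varP v i)
      + (varP v i - varP u i + (xiP v i - xiP u i) ^ 2) / varP u i) := by
  have h : HasFDerivAt (Astar (d := d))
      ((-(1/2) : ℝ) • ∑ i, (varP u i)⁻¹ • dvar u i) u :=
    (HasFDerivAt.fun_sum fun i _ => (hasFDerivAt_varP u i).log (hu i).ne').const_mul _
  unfold bregAstar
  rw [inner_gradient h]
  simp only [Astar, ContinuousLinearMap.smul_apply, ContinuousLinearMap.sum_apply, dvar_apply,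
    smul_eq_mul]
  rw [← mul_sub, ← mul_sub, ← Finset.sum_sub_distrib, ← Finset.sum_sub_distrib, Finset.mul_sum]
  refine Finset.sum_congr rfl fun i _ => ?_
  ring

lemma breg_lower {d : ℕ} (u v : MFParam d) (D : ℝ) (hu : ∀ i, 0 < varP u i)
    (hv : ∀ i, 0 < varP v i) (hD : ∀ i, varP u i ≤ D) :
    ∑ i, ((xiP v i - xiP u i) ^ 2 + (√(varP v i) - √(varP u i)) ^ 2) ≤
      2 * D * bregAstar v u := by
  rw [breg_eq u v hu, Finset.mul_sum]
  refine Finset.sum_le_sum fun i _ => ?_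
  have hs := hu i
  have ht := hv i
  have ha : 0 < √(varP u i) := Real.sqrt_pos.2 hs
  have hb : 0 < √(varP v i) := Real.sqrt_pos.2 ht
  have ea : √(varP u i) ^ 2 = varP u i := Real.sq_sqrt hs.le
  have eb : √(varP v i) ^ 2 = varP v i := Real.sq_sqrt ht.le
  set a := √(varP u i)
  set b := √(varP v i)
  rw [← ea, ← eb, Real.log_pow, Real.log_pow]
  have hl := Real.log_le_sub_one_of_pos (div_pos hb ha)
  rw [Real.log_div hb.ne' ha.ne'] at hl
  have hDa : a ^ 2 ≤ D := ea ▸ hD i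
  set x := xiP v i - xiP u i
  have key : (x ^ 2 + (b - a) ^ 2) / a ^ 2 ≤
      (((2:ℕ):ℝ) * Real.log a - ((2:ℕ):ℝ) * Real.log b + (b ^ 2 - a ^ 2 + x ^ 2) / a ^ 2) := by
    have : (x ^ 2 + (b - a) ^ 2) / a ^ 2 = (b ^ 2 - a ^ 2 + x ^ 2) / a ^ 2 - 2 * (b / a - 1) := by
      field_simp; ring
    rw [this]; push_cast; linarith
  have h0 : 0 ≤ (x ^ 2 + (b - a) ^ 2) / a ^ 2 := by positivity
  calc x ^ 2 + (b - a) ^ 2 = a ^ 2 * ((x ^ 2 + (b - a) ^ 2) / a ^ 2) := by field_simp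
    _ ≤ D * ((x ^ 2 + (b - a) ^ 2) / a ^ 2) := mul_le_mul_of_nonneg_right hDa h0
    _ ≤ D * _ := mul_le_mul_of_nonneg_left key (le_trans (by positivity) hDa)
    _ = _ := by ring

lemma remainder_bound {d : ℕ} {f : (Fin d → ℝ) → ℝ} {L₁ L₂ : ℝ} (hd : 1 ≤ d)
    (hf : ContDiff ℝ 2 f) (hL0 : 0 ≤ L₂)
    (hL1 : ∀ z i, |fderiv ℝ f z (Pi.single i 1)| ≤ L₁)
    (hL2 : ∀ (z : Fin d → ℝ) (i j : Fin d),
      |fderiv ℝ (fun w => fderiv ℝ f w (Pi.single j 1)) z (Pi.single i 1)| ≤ L₂)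
    (u : MFParam d) (hu : ∀ i, 0 < varP u i) :
    ∃ l : MFParam d →L[ℝ] ℝ, ∀ v : MFParam d, (∀ i, 0 < varP v i) →
      |(∫ z, f z ∂(mfGauss d v)) - (∫ z, f z ∂(mfGauss d u)) - l (v - u)| ≤
        3 * L₂ * d * ∑ i, ((xiP v i - xiP u i) ^ 2 + (√(varP v i) - √(varP u i)) ^ 2) := by
  set a : Fin d → ℝ := fun i => √(varP u i) with ha
  set P : Fin d → ℝ := fun i => ∫ z, fderiv ℝ f (TT (xiP u) a z) (Pi.single i 1) ∂(gam d) with hP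
  set Q : Fin d → ℝ := fun i =>
    ∫ z, fderiv ℝ f (TT (xiP u) a z) (Pi.single i 1) * z i ∂(gam d) with hQ
  have hapos : ∀ i, 0 < a i := fun i => Real.sqrt_pos.2 (hu i)
  have hQb : ∀ i, |Q i / a i| ≤ L₂ := fun i => by
    rw [abs_div, abs_of_pos (hapos i), div_le_iff₀ (hapos i)]
    exact Q_bound hf hL1 hL2 (xiP u) a i (hapos i).le
  refine ⟨∑ i, (P i • EuclideanSpace.proj (Sum.inl i) + ((1/2) * (Q i / a i)) • dvar u i), ?_⟩
  intro v hv
  set b : Fin d → ℝ := fun i => √(varP v i) with hb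
  have hc := core_bound hf hL0 hL1 hL2 (xiP u) a (xiP v) b
  rw [integral_mfGauss hf.continuous, integral_mfGauss hf.continuous]
  have hl : (∑ i, (P i • EuclideanSpace.proj (Sum.inl i) + ((1/2) * (Q i / a i)) • dvar u i) :
      MFParam d →L[ℝ] ℝ) (v - u) = ∑ i, ((xiP v i - xiP u i) * P i + (b i - a i) * Q i)
      + ∑ i, (1/2) * (Q i / a i) * ((b i - a i) ^ 2 + (xiP v i - xiP u i) ^ 2) := by
    rw [ContinuousLinearMap.sum_apply, ← Finset.sum_add_distrib]
    refine Finset.sum_congr rfl fun i _ => ?_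
    rw [ContinuousLinearMap.add_apply, ContinuousLinearMap.smul_apply,
      ContinuousLinearMap.smul_apply, dvar_apply]
    have e1 : varP u i = a i ^ 2 := (Real.sq_sqrt (hu i).le).symm
    have e2 : varP v i = b i ^ 2 := (Real.sq_sqrt (hv i).le).symm
    rw [e1, e2]
    have e3 : Q i = Q i / a i * a i := by field_simp [(hapos i).ne']
    have e4 : (EuclideanSpace.proj (Sum.inl i) : MFParam d →L[ℝ] ℝ) (v - u)
      = xiP v i - xiP u i := rfl
    rw [e4, smul_eq_mul, smul_eq_mul]
    generalize Q i / a i = q at *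
    rw [e3]; ring
  have h2 : |∑ i, (1/2) * (Q i / a i) * ((b i - a i) ^ 2 + (xiP v i - xiP u i) ^ 2)| ≤
      L₂ * ∑ i, ((xiP v i - xiP u i) ^ 2 + (b i - a i) ^ 2) := by
    rw [Finset.mul_sum]
    refine (Finset.abs_sum_le_sum_abs _ _).trans (Finset.sum_le_sum fun i _ => ?_)
    have hn : 0 ≤ (b i - a i) ^ 2 + (xiP v i - xiP u i) ^ 2 := by positivity
    rw [abs_mul, abs_mul, abs_of_nonneg hn, abs_of_pos (by norm_num : (0:ℝ) < 1/2), add_comm]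
    rw [add_comm] at hn
    exact mul_le_mul_of_nonneg_right (by linarith [hQb i]) hn
  set S := ∑ i, ((xiP v i - xiP u i) ^ 2 + (b i - a i) ^ 2) with hS
  have hS0 : 0 ≤ S := Finset.sum_nonneg fun i _ => by positivity
  have h3 : ∑ i, (2 * (xiP v i - xiP u i) ^ 2 + 2 * (b i - a i) ^ 2) = 2 * S := by
    rw [hS, Finset.mul_sum]; exact Finset.sum_congr rfl fun i _ => by ring
  rw [h3] at hc
  rw [hl, ← sub_sub]
  refine (abs_sub _ _).trans ?_
  have hd' : (1 : ℝ) ≤ d := by exact_mod_cast hd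
  have h4 : L₂ * S ≤ L₂ * d * S := by
    have := mul_nonneg hL0 hS0
    nlinarith
  calc _ ≤ L₂ * d * (2 * S) + L₂ * S := add_le_add hc h2
    _ ≤ _ := by linarith

lemma sqrt_sub_sq_le {s t : ℝ} (hs : 0 < s) (ht : 0 ≤ t) : (√t - √s) ^ 2 ≤ (t - s) ^ 2 / s := by
  rw [le_div_iff₀ hs]
  have ea : √s ^ 2 = s := Real.sq_sqrt hs.le
  have eb : √t ^ 2 = t := Real.sq_sqrt ht
  have ha := Real.sqrt_nonneg s
  have hb := Real.sqrt_nonneg t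
  have : (t - s) ^ 2 = (√t - √s) ^ 2 * (√t + √s) ^ 2 := by
    rw [← mul_pow, ← ea, ← eb]; simp only [Real.sqrt_sq ha, Real.sqrt_sq hb]; ring
  rw [this]
  refine mul_le_mul_of_nonneg_left ?_ (sq_nonneg _)
  nlinarith

lemma hasFDerivAt_of_bound {d : ℕ} {g : MFParam d → ℝ} {l : MFParam d →L[ℝ] ℝ} {u : MFParam d}
    {K : ℝ} (hK : 0 ≤ K) (hu : ∀ i, 0 < varP u i)
    (h : ∀ v : MFParam d, (∀ i, 0 < varP v i) → |g v - g u - l (v - u)| ≤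
      K * ∑ i, ((xiP v i - xiP u i) ^ 2 + (√(varP v i) - √(varP u i)) ^ 2)) :
    HasFDerivAt g l u := by
  set ψ : MFParam d → ℝ := fun v =>
    K * ∑ i, ((xiP v i - xiP u i) ^ 2 + (varP v i - varP u i) ^ 2 / varP u i) with hψ
  have hψ0 : ψ u = 0 := by simp [hψ]
  have hψn : ∀ v, 0 ≤ ψ v := fun v => mul_nonneg hK (Finset.sum_nonneg fun i _ => by
    have := hu i; positivity)
  have hψd : DifferentiableAt ℝ ψ u := by
    refine DifferentiableAt.const_mul (DifferentiableAt.fun_sum fun i _ => ?_) _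
    simp only [div_eq_mul_inv]
    exact (((hasFDerivAt_xiP u i).differentiableAt.sub_const _).pow 2).add
      ((((hasFDerivAt_varP u i).differentiableAt.sub_const _).pow 2).mul_const _)
  have hψf : HasFDerivAt ψ (0 : MFParam d →L[ℝ] ℝ) u := by
    have hm : IsLocalMin ψ u := Filter.Eventually.of_forall fun v => by rw [hψ0]; exact hψn v
    rw [← hm.fderiv_eq_zero]; exact hψd.hasFDerivAt
  rw [hasFDerivAt_iff_isLittleO] at hψf ⊢
  refine Asymptotics.IsBigO.trans_isLittleO (Asymptotics.IsBigO.of_bound' ?_) hψf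
  have hev : ∀ᶠ v in nhds u, ∀ i, 0 < varP v i := by
    rw [Filter.eventually_all]
    intro i
    exact (hasFDerivAt_varP u i).continuousAt.eventually (lt_mem_nhds (hu i))
  filter_upwards [hev] with v hv
  rw [hψ0]
  simp only [sub_zero, ContinuousLinearMap.zero_apply]
  rw [Real.norm_eq_abs, Real.norm_eq_abs, abs_of_nonneg (hψn v)]
  refine (h v hv).trans (mul_le_mul_of_nonneg_left (Finset.sum_le_sum fun i _ => ?_) hK)
  have := sqrt_sub_sq_le (hu i) (hv i).le
  linarith

/-- Sufficient conditions for relative smoothness, Theorem 3.1: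
there is an absolute constant `c > 0` such that for any `d ≥ 1`, `U ≥ 1`, `D > 1`
and any four times continuously differentiable `f : ℝ^d → ℝ` with all first partial
derivatives bounded by `L₁` and all second partial derivatives bounded by `L₂`,
the function `g(ω) = ∫ f dq(·;ω)` is `L`-smooth relative to `A*` on `Ω̃`, where
`L = c (d D² U (L₁ + L₂ U) + d D³ (L₁ + L₂ U))`. -/
theorem relative_smoothness_sufficient_conditions :
    ∃ c : ℝ, 0 < c ∧
      ∀ (d : ℕ) (U D L₁ L₂ : ℝ) (f : (Fin d → ℝ) → ℝ),
        1 ≤ d → 1 ≤ U → 1 < D →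
        ContDiff ℝ 4 f →
        (∀ (z : Fin d → ℝ) (i : Fin d), |fderiv ℝ f z (Pi.single i 1)| ≤ L₁) →
        (∀ (z : Fin d → ℝ) (i j : Fin d),
          |fderiv ℝ (fun w => fderiv ℝ f w (Pi.single j 1)) z (Pi.single i 1)| ≤ L₂) →
        ∀ u ∈ OmegaT d U D, ∀ v ∈ OmegaT d U D,
          (-(c * (d * D ^ 2 * U * (L₁ + L₂ * U) + d * D ^ 3 * (L₁ + L₂ * U))) * bregAstar v u
              ≤ (∫ z, f z ∂(mfGauss d v)) - (∫ z, f z ∂(mfGauss d u))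
                - ⟪gradient (fun ω => ∫ z, f z ∂(mfGauss d ω)) u, v - u⟫) ∧
          ((∫ z, f z ∂(mfGauss d v)) - (∫ z, f z ∂(mfGauss d u))
                - ⟪gradient (fun ω => ∫ z, f z ∂(mfGauss d ω)) u, v - u⟫
              ≤ (c * (d * D ^ 2 * U * (L₁ + L₂ * U) + d * D ^ 3 * (L₁ + L₂ * U))) * bregAstar v u) := by
  refine ⟨6, by norm_num, ?_⟩
  intro d U D L₁ L₂ f hd hU hD hf hL1 hL2 u hu v hv
  have hf2 : ContDiff ℝ 2 f := hf.of_le (by norm_num)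
  have hL10 : 0 ≤ L₁ := (abs_nonneg _).trans (hL1 0 ⟨0, hd⟩)
  have hL20 : 0 ≤ L₂ := (abs_nonneg _).trans (hL2 0 ⟨0, hd⟩ ⟨0, hd⟩)
  have hDi : 0 < D⁻¹ := inv_pos.2 (by linarith)
  have hu0 : ∀ i, 0 < varP u i := fun i => hDi.trans_le (hu i).2.1
  have hv0 : ∀ i, 0 < varP v i := fun i => hDi.trans_le (hv i).2.1
  obtain ⟨l, hl⟩ := remainder_bound hd hf2 hL20 hL1 hL2 u hu0
  have hg : HasFDerivAt (fun ω => ∫ z, f z ∂(mfGauss d ω)) l u :=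
    hasFDerivAt_of_bound (K := 3 * L₂ * d) (by positivity) hu0 hl
  rw [inner_gradient hg]
  have hB := breg_lower u v D hu0 hv0 (fun i => (hu i).2.2)
  have hS : 0 ≤ ∑ i, ((xiP v i - xiP u i) ^ 2 + (√(varP v i) - √(varP u i)) ^ 2) :=
    Finset.sum_nonneg fun i _ => by positivity
  have hB0 : 0 ≤ bregAstar v u := by
    have : 0 ≤ 2 * D * bregAstar v u := hS.trans hB
    exact nonneg_of_mul_nonneg_right this (by linarith)
  have hmain := hl v hv0
  have h1 : 3 * L₂ * d * ∑ i, ((xiP v i - xiP u i) ^ 2 + (√(varP v i) - √(varP u i)) ^ 2)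
      ≤ 6 * (d * D * L₂) * bregAstar v u := by
    calc _ ≤ 3 * L₂ * d * (2 * D * bregAstar v u) :=
          mul_le_mul_of_nonneg_left hB (by positivity)
      _ = _ := by ring
  have hD0 : 0 ≤ D := by linarith
  have hU0 : 0 ≤ U := by linarith
  have h2 : d * D * L₂ ≤ d * D ^ 2 * U * (L₁ + L₂ * U) + d * D ^ 3 * (L₁ + L₂ * U) := by
    have a1 : D ≤ D ^ 3 := le_self_pow₀ hD.le (by norm_num)
    have a2 : L₂ ≤ L₁ + L₂ * U := by nlinarith
    have a3 : d * D * L₂ ≤ d * D ^ 3 * (L₁ + L₂ * U) := by gcongr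
    have a4 : 0 ≤ d * D ^ 2 * U * (L₁ + L₂ * U) := by positivity
    linarith
  have h3 : 6 * (d * D * L₂) * bregAstar v u ≤
      6 * (d * D ^ 2 * U * (L₁ + L₂ * U) + d * D ^ 3 * (L₁ + L₂ * U)) * bregAstar v u :=
    mul_le_mul_of_nonneg_right (by linarith) hB0
  have h4 := abs_le.1 ((hmain.trans h1).trans h3)
  refine ⟨?_, h4.2⟩
  rw [neg_mul]; exact h4.1

end
end

section
/- Let f : ℝ → ℝ be four times continuously differentiable such that f and all its derivatives up to order four have at most polynomial growth. For (ξ,Ξ) ∈ ℝ² with Ξ − ξ² > 0, write μ = ξ, σ² = Ξ − ξ², and define F(ξ,Ξ) = ∫ f dN(μ,σ²). Then F is twice continuously differentiable on {(ξ,Ξ) : Ξ − ξ² > 0} and its Hessian matrix with respect to (ξ,Ξ) equals [[E[−2 f'''(z)·μ + f''''(z)·μ²], (1/2)·E[f'''(z) − f''''(z)·μ]], [(1/2)·E[f'''(z) − f''''(z)·μ], (1/4)·E[f''''(z)]]], where all expectations are with respect to z ∼ N(μ,σ²). -/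
open MeasureTheory ProbabilityTheory

noncomputable section

/-- Gaussian measure on `ℝ` with mean `m` and variance `s` (a real number). -/
def gaussR (m s : ℝ) : Measure ℝ := gaussianReal m s.toNNReal

/-- Polynomial growth. -/
def PolyG (g : ℝ → ℝ) : Prop := ∃ (C : ℝ) (N : ℕ), 0 ≤ C ∧ ∀ z, |g z| ≤ C * (1 + |z|) ^ N

/-- Expectation of `g (m + σ x)` under a standard Gaussian. -/
def HH (g : ℝ → ℝ) (q : ℝ × ℝ) : ℝ := ∫ x, g (q.1 + q.2 * x) ∂(gaussianReal 0 1)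

lemma integrable_pow_gauss (N : ℕ) :
    Integrable (fun x : ℝ => (1 + |x|) ^ N) (gaussianReal 0 1) := by
  have h1 : MemLp (fun x : ℝ => 1 + |x|) (N : ENNReal) (gaussianReal 0 1) := by
    have h2 := memLp_id_gaussianReal' (μ := 0) (v := 1) (N : ENNReal) (by simp)
    exact (memLp_const (1 : ℝ)).add h2.norm
  have h3 := h1.integrable_norm_pow'
  refine h3.congr (Filter.Eventually.of_forall fun x => ?_)
  simp only [Real.norm_eq_abs]
  rw [abs_of_nonneg (by positivity)]

lemma PolyG.bound {g : ℝ → ℝ} (hg : PolyG g) (q₀ : ℝ × ℝ) :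
    ∃ (K : ℝ) (N : ℕ), 0 ≤ K ∧ ∀ q ∈ Metric.ball q₀ 1, ∀ x : ℝ,
      |g (q.1 + q.2 * x)| ≤ K * (1 + |x|) ^ N := by
  obtain ⟨C, N, hC, h⟩ := hg
  refine ⟨C * (|q₀.1| + |q₀.2| + 3) ^ N, N, by positivity, fun q hq x => (h _).trans ?_⟩
  rw [mul_assoc, ← mul_pow]
  have hd : dist q q₀ < 1 := hq
  rw [Prod.dist_eq, max_lt_iff, Real.dist_eq, Real.dist_eq] at hd
  have a1 : |q.1| ≤ |q₀.1| + 1 := by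
    have := abs_sub_abs_le_abs_sub q.1 q₀.1; linarith [hd.1]
  have a2 : |q.2| ≤ |q₀.2| + 1 := by
    have := abs_sub_abs_le_abs_sub q.2 q₀.2; linarith [hd.2]
  have a3 : |q.1 + q.2 * x| ≤ |q.1| + |q.2| * |x| := by
    rw [← abs_mul]; exact abs_add_le _ _
  have a4 : |q.2| * |x| ≤ (|q₀.2| + 1) * |x| := by gcongr
  gcongr
  nlinarith [abs_nonneg x, abs_nonneg q₀.1, abs_nonneg q₀.2, mul_nonneg (abs_nonneg q₀.1) (abs_nonneg x)]

lemma PolyG.integrable {g : ℝ → ℝ} (hg : PolyG g) (hc : Continuous g) (q : ℝ × ℝ) (j : ℕ) :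
    Integrable (fun x => x ^ j * g (q.1 + q.2 * x)) (gaussianReal 0 1) := by
  obtain ⟨K, N, hK, h⟩ := hg.bound q
  refine Integrable.mono' ((integrable_pow_gauss (j + N)).const_mul K)
    (by fun_prop) (Filter.Eventually.of_forall fun x => ?_)
  rw [Real.norm_eq_abs, abs_mul, abs_pow, pow_add]
  have h1 := h q (Metric.mem_ball_self one_pos) x
  have h2 : |x| ^ j ≤ (1 + |x|) ^ j := by gcongr; linarith
  calc |x| ^ j * |g (q.1 + q.2 * x)| ≤ (1 + |x|) ^ j * (K * (1 + |x|) ^ N) := by gcongr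
    _ = _ := by ring

lemma HH_continuous {g : ℝ → ℝ} (hg : PolyG g) (hc : Continuous g) : Continuous (HH g) := by
  rw [continuous_iff_continuousAt]
  intro q
  obtain ⟨K, N, hK, h⟩ := hg.bound q
  refine continuousAt_of_dominated (bound := fun x => K * (1 + |x|) ^ N) ?_ ?_
    ((integrable_pow_gauss N).const_mul K) ?_
  · exact Filter.Eventually.of_forall fun q => by fun_prop
  · filter_upwards [Metric.ball_mem_nhds q one_pos] with r hr
    exact Filter.Eventually.of_forall fun x => h r hr x
  · exact Filter.Eventually.of_forall fun x => by fun_prop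

lemma integral_std (h : ℝ → ℝ) :
    ∫ x, h x ∂(gaussianReal 0 1) = ∫ x, gaussianPDFReal 0 1 x * h x := by
  rw [integral_gaussianReal_eq_integral_smul (by simp)]; rfl

lemma integrable_std {h : ℝ → ℝ} (hi : Integrable h (gaussianReal 0 1)) :
    Integrable (fun x => gaussianPDFReal 0 1 x * h x) := by
  rw [gaussianReal_of_var_ne_zero _ (by simp)] at hi
  rw [integrable_withDensity_iff_integrable_smul' (measurable_gaussianPDF _ _)
    (Filter.Eventually.of_forall fun _ => gaussianPDF_lt_top)] at hi
  simpa [toReal_gaussianPDF] using hi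

lemma pdf_deriv (x : ℝ) :
    HasDerivAt (gaussianPDFReal 0 1) (-x * gaussianPDFReal 0 1 x) x := by
  rw [gaussianPDFReal_def]
  have h : HasDerivAt (fun x : ℝ => -(x - 0) ^ 2 / (2 * ((1 : NNReal) : ℝ))) (-x) x := by
    have := ((((hasDerivAt_id x).sub_const 0).pow 2).neg).div_const (2 * ((1 : NNReal) : ℝ))
    refine this.congr_deriv ?_
    simp
    ring
  have h2 := (h.exp).const_mul ((√(2 * Real.pi * ((1 : NNReal) : ℝ)))⁻¹)
  refine h2.congr_deriv ?_
  ring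

lemma stein {g g' : ℝ → ℝ} (hd : ∀ z, HasDerivAt g (g' z) z) (hg : PolyG g) (hg' : PolyG g')
    (hc' : Continuous g') (q : ℝ × ℝ) :
    ∫ x, x * g (q.1 + q.2 * x) ∂(gaussianReal 0 1) = q.2 * HH g' q := by
  have hc : Continuous g := continuous_iff_continuousAt.2 fun z => (hd z).continuousAt
  have i0 := integrable_std (hg.integrable hc q 0)
  have i1 := integrable_std (hg.integrable hc q 1)
  have i2 := (integrable_std (hg'.integrable hc' q 0)).const_mul q.2
  simp only [pow_zero, one_mul, pow_one] at i0 i1 i2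
  have key : ∀ x, HasDerivAt (fun x => gaussianPDFReal 0 1 x * g (q.1 + q.2 * x))
      (q.2 * (gaussianPDFReal 0 1 x * g' (q.1 + q.2 * x))
        - gaussianPDFReal 0 1 x * (x * g (q.1 + q.2 * x))) x := by
    intro x
    have h1 : HasDerivAt (fun x => q.1 + q.2 * x) q.2 x := by
      simpa using ((hasDerivAt_id x).const_mul q.2).const_add q.1
    have h2 := (pdf_deriv x).mul ((hd (q.1 + q.2 * x)).comp x h1)
    refine h2.congr_deriv ?_
    simp only [Function.comp]
    ring
  have := integral_eq_zero_of_hasDerivAt_of_integrable key (i2.sub i1) i0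
  rw [integral_sub i2 i1, integral_const_mul] at this
  rw [HH, integral_std, integral_std]
  linarith

lemma HH_hasFDerivAt {g g' g'' : ℝ → ℝ} (hd : ∀ z, HasDerivAt g (g' z) z)
    (hd' : ∀ z, HasDerivAt g' (g'' z) z) (hg : PolyG g) (hg' : PolyG g') (hg'' : PolyG g'')
    (hc'' : Continuous g'') (q : ℝ × ℝ) :
    HasFDerivAt (HH g) (HH g' q • ContinuousLinearMap.fst ℝ ℝ ℝ
      + (q.2 * HH g'' q) • ContinuousLinearMap.snd ℝ ℝ ℝ) q := by
  have hc : Continuous g := continuous_iff_continuousAt.2 fun z => (hd z).continuousAt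
  have hc' : Continuous g' := continuous_iff_continuousAt.2 fun z => (hd' z).continuousAt
  obtain ⟨K, N, hK, h⟩ := hg'.bound q
  have i0 := hg'.integrable hc' q 0
  have i1 := hg'.integrable hc' q 1
  simp only [pow_zero, one_mul, pow_one] at i0 i1
  have hmain := hasFDerivAt_integral_of_dominated_of_fderiv_le (𝕜 := ℝ) (μ := gaussianReal 0 1)
    (F := fun (q : ℝ × ℝ) x => g (q.1 + q.2 * x))
    (F' := fun (q : ℝ × ℝ) x => g' (q.1 + q.2 * x) • ContinuousLinearMap.fst ℝ ℝ ℝ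
      + (x * g' (q.1 + q.2 * x)) • ContinuousLinearMap.snd ℝ ℝ ℝ)
    (x₀ := q) (s := Metric.ball q 1) (bound := fun x => K * (1 + |x|) ^ (N + 1))
    (Metric.ball_mem_nhds q one_pos)
    (Filter.Eventually.of_forall fun q => by fun_prop)
    (by simpa using hg.integrable hc q 0)
    (by fun_prop)
    (Filter.Eventually.of_forall fun x r hr => by
      have h1 := h r hr x
      calc _ ≤ ‖g' (r.1 + r.2 * x) • ContinuousLinearMap.fst ℝ ℝ ℝ‖
            + ‖(x * g' (r.1 + r.2 * x)) • ContinuousLinearMap.snd ℝ ℝ ℝ‖ := norm_add_le _ _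
        _ ≤ |g' (r.1 + r.2 * x)| * 1 + (|x| * |g' (r.1 + r.2 * x)|) * 1 := by
            rw [norm_smul, norm_smul, Real.norm_eq_abs, Real.norm_eq_abs, abs_mul]
            gcongr
            · exact ContinuousLinearMap.norm_fst_le ℝ ℝ ℝ
            · exact ContinuousLinearMap.norm_snd_le ℝ ℝ ℝ
        _ = |g' (r.1 + r.2 * x)| * (1 + |x|) := by ring
        _ ≤ (K * (1 + |x|) ^ N) * (1 + |x|) := by gcongr
        _ = _ := by ring)
    ((integrable_pow_gauss (N + 1)).const_mul K)
    (Filter.Eventually.of_forall fun x r hr => by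
      have h1 : HasFDerivAt (fun q : ℝ × ℝ => q.1 + q.2 * x)
          (ContinuousLinearMap.fst ℝ ℝ ℝ + x • ContinuousLinearMap.snd ℝ ℝ ℝ) r :=
        hasFDerivAt_fst.add (hasFDerivAt_snd.mul_const x)
      have h2 := (hd (r.1 + r.2 * x)).comp_hasFDerivAt r h1
      refine h2.congr_fderiv ?_
      rw [smul_add, smul_smul, mul_comm x])
  rw [integral_add (i0.smul_const _) (i1.smul_const _), integral_smul_const,
    integral_smul_const, stein hd' hg' hg'' hc''] at hmain
  exact hmain

/-- The expectation as a function of `(ξ, Ξ)`. -/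
def Phi (g : ℝ → ℝ) (p : ℝ × ℝ) : ℝ := ∫ z, g z ∂(gaussR p.1 (p.2 - p.1 ^ 2))

lemma Phi_eq (g : ℝ → ℝ) (hc : Continuous g) (p : ℝ × ℝ) :
    Phi g p = HH g (p.1, √(p.2 - p.1 ^ 2)) := by
  have h : gaussR p.1 (p.2 - p.1 ^ 2)
      = (gaussianReal 0 1).map (fun x => p.1 + √(p.2 - p.1 ^ 2) * x) := by
    have e : (fun x => p.1 + √(p.2 - p.1 ^ 2) * x)
      = (fun x => p.1 + x) ∘ (fun x => √(p.2 - p.1 ^ 2) * x) := rfl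
    rw [e, ← Measure.map_map (by fun_prop) (by fun_prop), gaussianReal_map_const_mul,
      gaussianReal_map_const_add, gaussR]
    congr 1
    · simp
    · ext
      simp only [Real.coe_toNNReal', NNReal.coe_mul, NNReal.coe_mk, NNReal.coe_one, mul_one]
      rcases le_total 0 (p.2 - p.1 ^ 2) with h | h
      · rw [Real.sq_sqrt h, max_eq_left h]
      · rw [Real.sqrt_eq_zero_of_nonpos h, max_eq_right h]; simp
  rw [Phi, h, integral_map (by fun_prop) (by fun_prop), HH]

lemma Phi_continuous {g : ℝ → ℝ} (hg : PolyG g) (hc : Continuous g) : Continuous (Phi g) := by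
  rw [show Phi g = fun p => HH g (p.1, √(p.2 - p.1 ^ 2)) from funext (Phi_eq g hc)]
  exact (HH_continuous hg hc).comp (by fun_prop)

/-- The derivative expression. -/
def DPhi (g' g'' : ℝ → ℝ) (p : ℝ × ℝ) : ℝ × ℝ →L[ℝ] ℝ :=
  (Phi g' p - p.1 * Phi g'' p) • ContinuousLinearMap.fst ℝ ℝ ℝ
      + (1 / 2 * Phi g'' p) • ContinuousLinearMap.snd ℝ ℝ ℝ

lemma Phi_hasFDerivAt {g g' g'' : ℝ → ℝ} (hd : ∀ z, HasDerivAt g (g' z) z)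
    (hd' : ∀ z, HasDerivAt g' (g'' z) z) (hg : PolyG g) (hg' : PolyG g') (hg'' : PolyG g'')
    (hc'' : Continuous g'') (p : ℝ × ℝ) (hp : 0 < p.2 - p.1 ^ 2) :
    HasFDerivAt (Phi g) (DPhi g' g'' p) p := by
  have hc : Continuous g := continuous_iff_continuousAt.2 fun z => (hd z).continuousAt
  have hc' : Continuous g' := continuous_iff_continuousAt.2 fun z => (hd' z).continuousAt
  rw [show Phi g = fun p => HH g (p.1, √(p.2 - p.1 ^ 2)) from funext (Phi_eq g hc)]
  have h1 : HasFDerivAt (fun p : ℝ × ℝ => p.2 - p.1 ^ 2) (ContinuousLinearMap.snd ℝ ℝ ℝ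
      - (2 * p.1) • ContinuousLinearMap.fst ℝ ℝ ℝ) p := by
    have := (hasFDerivAt_snd (𝕜 := ℝ) (p := p)).sub ((hasFDerivAt_fst (𝕜 := ℝ) (p := p)).pow 2)
    refine this.congr_fderiv ?_
    ext <;> simp
  have h2 := h1.sqrt hp.ne'
  have h3 := (hasFDerivAt_fst (𝕜 := ℝ) (p := p)).prodMk h2
  have h4 := (HH_hasFDerivAt hd hd' hg hg' hg'' hc'' (p.1, √(p.2 - p.1 ^ 2))).comp p h3
  refine h4.congr_fderiv ?_
  have hs : √(p.2 - p.1 ^ 2) ≠ 0 := (Real.sqrt_pos.2 hp).ne'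
  rw [DPhi, Phi_eq g' hc', Phi_eq g'' hc'']
  ext <;> simp <;> field_simp <;> ring

lemma isOpen_U : IsOpen {p : ℝ × ℝ | 0 < p.2 - p.1 ^ 2} :=
  isOpen_lt (by fun_prop) (by fun_prop)

lemma Phi_contDiff_succ {g g' g'' : ℝ → ℝ} (hd : ∀ z, HasDerivAt g (g' z) z)
    (hd' : ∀ z, HasDerivAt g' (g'' z) z) (hg : PolyG g) (hg' : PolyG g') (hg'' : PolyG g'')
    (hc'' : Continuous g'') (n : ℕ)
    (h' : ContDiffOn ℝ n (Phi g') {p : ℝ × ℝ | 0 < p.2 - p.1 ^ 2})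
    (h'' : ContDiffOn ℝ n (Phi g'') {p : ℝ × ℝ | 0 < p.2 - p.1 ^ 2}) :
    ContDiffOn ℝ (n + 1) (Phi g) {p : ℝ × ℝ | 0 < p.2 - p.1 ^ 2} := by
  have key := Phi_hasFDerivAt hd hd' hg hg' hg'' hc''
  rw [contDiffOn_succ_iff_fderiv_of_isOpen isOpen_U]
  refine ⟨fun p hp => (key p hp).differentiableAt.differentiableWithinAt, by simp, ?_⟩
  have : ContDiffOn ℝ n (DPhi g' g'') {p : ℝ × ℝ | 0 < p.2 - p.1 ^ 2} := by
    unfold DPhi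
    exact ((h'.sub (contDiffOn_fst.mul h'')).smul contDiffOn_const).add
      ((contDiffOn_const.mul h'').smul contDiffOn_const)
  exact this.congr fun p hp => (key p hp).fderiv

lemma Phi_integrable {g : ℝ → ℝ} (hg : PolyG g) (hc : Continuous g) (m s : ℝ) :
    Integrable g (gaussR m s) := by
  obtain ⟨C, N, hC, h⟩ := hg
  have h1 : MemLp (fun x : ℝ => 1 + |x|) (N : ENNReal) (gaussR m s) := by
    have h2 := memLp_id_gaussianReal' (μ := m) (v := s.toNNReal) (N : ENNReal) (by simp)
    unfold gaussR
    exact (memLp_const (1 : ℝ)).add h2.norm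
  have h3 := haveI : IsFiniteMeasure (gaussR m s) := by unfold gaussR; infer_instance
    h1.integrable_norm_pow'
  refine Integrable.mono' (h3.const_mul C) (by fun_prop) (Filter.Eventually.of_forall fun x => ?_)
  simp only [Real.norm_eq_abs]
  rw [abs_of_nonneg (a := 1 + |x|) (by positivity)]
  exact h x

/-- Proposition 3.1, Hessian of the expected value in the univariate
expectation parameterization: if `f : ℝ → ℝ` is `C⁴` with polynomial growth of `f` and
its derivatives up to order four, then `F(ξ,Ξ) = ∫ f dN(μ, σ²)` with `μ = ξ`,
`σ² = Ξ − ξ²` is `C²` on `{(ξ,Ξ) : Ξ − ξ² > 0}` and its Hessian is the claimed 2×2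
matrix of Gaussian expectations of `f'''` and `f''''`. -/
theorem hessian_of_expected_value_univariate
    (f : ℝ → ℝ) (hf : ContDiff ℝ 4 f)
    (hgrowth : ∃ C n : ℝ, ∀ k : ℕ, k ≤ 4 → ∀ z : ℝ,
      |iteratedDeriv k f z| ≤ C * (1 + |z|) ^ n) :
    ContDiffOn ℝ 2 (fun p : ℝ × ℝ => ∫ z, f z ∂(gaussR p.1 (p.2 - p.1 ^ 2)))
      {p : ℝ × ℝ | 0 < p.2 - p.1 ^ 2} ∧
    ∀ p : ℝ × ℝ, 0 < p.2 - p.1 ^ 2 →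
      (fderiv ℝ (fun w : ℝ × ℝ =>
            fderiv ℝ (fun q : ℝ × ℝ => ∫ z, f z ∂(gaussR q.1 (q.2 - q.1 ^ 2))) w ((1, 0) : ℝ × ℝ))
          p ((1, 0) : ℝ × ℝ)
        = ∫ z, (-2 * iteratedDeriv 3 f z * p.1 + iteratedDeriv 4 f z * p.1 ^ 2)
            ∂(gaussR p.1 (p.2 - p.1 ^ 2))) ∧
      (fderiv ℝ (fun w : ℝ × ℝ =>
            fderiv ℝ (fun q : ℝ × ℝ => ∫ z, f z ∂(gaussR q.1 (q.2 - q.1 ^ 2))) w ((0, 1) : ℝ × ℝ))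
          p ((1, 0) : ℝ × ℝ)
        = (1 / 2) * ∫ z, (iteratedDeriv 3 f z - iteratedDeriv 4 f z * p.1)
            ∂(gaussR p.1 (p.2 - p.1 ^ 2))) ∧
      (fderiv ℝ (fun w : ℝ × ℝ =>
            fderiv ℝ (fun q : ℝ × ℝ => ∫ z, f z ∂(gaussR q.1 (q.2 - q.1 ^ 2))) w ((1, 0) : ℝ × ℝ))
          p ((0, 1) : ℝ × ℝ)
        = (1 / 2) * ∫ z, (iteratedDeriv 3 f z - iteratedDeriv 4 f z * p.1)
            ∂(gaussR p.1 (p.2 - p.1 ^ 2))) ∧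
      (fderiv ℝ (fun w : ℝ × ℝ =>
            fderiv ℝ (fun q : ℝ × ℝ => ∫ z, f z ∂(gaussR q.1 (q.2 - q.1 ^ 2))) w ((0, 1) : ℝ × ℝ))
          p ((0, 1) : ℝ × ℝ)
        = (1 / 4) * ∫ z, iteratedDeriv 4 f z ∂(gaussR p.1 (p.2 - p.1 ^ 2))) := by
  obtain ⟨C, n, hC⟩ := hgrowth
  set D : ℕ → ℝ → ℝ := fun k => iteratedDeriv k f with hD
  have hc : ∀ k ≤ 4, Continuous (D k) := fun k hk =>
    hf.continuous_iteratedDeriv k (by exact_mod_cast hk)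
  have hd : ∀ k < 4, ∀ z, HasDerivAt (D k) (D (k + 1) z) z := by
    intro k hk z
    have := (hf.differentiable_iteratedDeriv k (by exact_mod_cast hk)) z
    simp only [hD, iteratedDeriv_succ]
    exact this.hasDerivAt
  have hg : ∀ k ≤ 4, PolyG (D k) := by
    intro k hk
    have hC0 : 0 ≤ C := by
      have := (abs_nonneg _).trans (hC 0 (by norm_num) 0)
      simpa using this
    refine ⟨C, ⌈n⌉₊, hC0, fun z => (hC k hk z).trans ?_⟩
    gcongr
    rw [← Real.rpow_natCast]
    exact Real.rpow_le_rpow_of_exponent_le (by linarith [abs_nonneg z]) (Nat.le_ceil n)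
  have hfd : ∀ k ≤ 2, ∀ p : ℝ × ℝ, 0 < p.2 - p.1 ^ 2 →
      HasFDerivAt (Phi (D k)) (DPhi (D (k + 1)) (D (k + 2)) p) p := fun k hk p hp =>
    Phi_hasFDerivAt (hd k (by omega)) (hd (k + 1) (by omega)) (hg k (by omega))
      (hg (k + 1) (by omega)) (hg (k + 2) (by omega)) (hc (k + 2) (by omega)) p hp
  have hcd : ∀ k ≤ 2, ∀ n : ℕ,
      ContDiffOn ℝ n (Phi (D (k + 1))) {p : ℝ × ℝ | 0 < p.2 - p.1 ^ 2} →
      ContDiffOn ℝ n (Phi (D (k + 2))) {p : ℝ × ℝ | 0 < p.2 - p.1 ^ 2} →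
      ContDiffOn ℝ (n + 1) (Phi (D k)) {p : ℝ × ℝ | 0 < p.2 - p.1 ^ 2} := fun k hk n h1 h2 =>
    Phi_contDiff_succ (hd k (by omega)) (hd (k + 1) (by omega)) (hg k (by omega))
      (hg (k + 1) (by omega)) (hg (k + 2) (by omega)) (hc (k + 2) (by omega)) n h1 h2
  have hc0 : ∀ k ≤ 4, ContDiffOn ℝ (0 : ℕ) (Phi (D k)) {p : ℝ × ℝ | 0 < p.2 - p.1 ^ 2} := by
    intro k hk
    simpa using (Phi_continuous (hg k hk) (hc k hk)).continuousOn
  have hF : (fun p : ℝ × ℝ => ∫ z, f z ∂(gaussR p.1 (p.2 - p.1 ^ 2))) = Phi (D 0) := by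
    funext p
    simp [Phi, hD]
  rw [hF]
  have hc1 : ∀ k ≤ 2, ContDiffOn ℝ (1 : ℕ) (Phi (D k)) {p : ℝ × ℝ | 0 < p.2 - p.1 ^ 2} := by
    intro k hk
    simpa using hcd k hk 0 (hc0 _ (by omega)) (hc0 _ (by omega))
  refine ⟨?_, fun p hp => ?_⟩
  · have := hcd 0 (by norm_num) 1 (hc1 1 (by norm_num)) (hc1 2 (by norm_num))
    rwa [show ((1 : ℕ) : WithTop ℕ∞) + 1 = 2 by norm_num] at this
  have hU : ∀ᶠ w in nhds p, 0 < w.2 - w.1 ^ 2 := isOpen_U.mem_nhds hp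
  have e1 : (fun w : ℝ × ℝ => fderiv ℝ (Phi (D 0)) w ((1, 0) : ℝ × ℝ)) =ᶠ[nhds p]
      fun w => Phi (D 1) w - w.1 * Phi (D 2) w := by
    filter_upwards [hU] with w hw
    rw [(hfd 0 (by norm_num) w hw).fderiv]
    simp [DPhi]
  have e2 : (fun w : ℝ × ℝ => fderiv ℝ (Phi (D 0)) w ((0, 1) : ℝ × ℝ)) =ᶠ[nhds p]
      fun w => 1 / 2 * Phi (D 2) w := by
    filter_upwards [hU] with w hw
    rw [(hfd 0 (by norm_num) w hw).fderiv]
    simp [DPhi]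
  have d1 := (hfd 1 (by norm_num) p hp).sub
    ((hasFDerivAt_fst (𝕜 := ℝ) (p := p)).mul (hfd 2 le_rfl p hp))
  have d2 := (hfd 2 le_rfl p hp).const_mul (1 / 2)
  have f1 := (d1.congr_of_eventuallyEq e1).fderiv
  have f2 := (d2.congr_of_eventuallyEq e2).fderiv
  have i3 := Phi_integrable (hg 3 (by norm_num)) (hc 3 (by norm_num)) p.1 (p.2 - p.1 ^ 2)
  have i4 := Phi_integrable (hg 4 (by norm_num)) (hc 4 (by norm_num)) p.1 (p.2 - p.1 ^ 2)
  have j1 : ∫ z, (-2 * iteratedDeriv 3 f z * p.1 + iteratedDeriv 4 f z * p.1 ^ 2)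
            ∂(gaussR p.1 (p.2 - p.1 ^ 2)) = -2 * Phi (D 3) p * p.1 + Phi (D 4) p * p.1 ^ 2 := by
    rw [integral_add ((i3.const_mul (-2)).mul_const _) (i4.mul_const _), integral_mul_const,
      integral_mul_const, integral_const_mul]
    rfl
  have j2 : ∫ z, (iteratedDeriv 3 f z - iteratedDeriv 4 f z * p.1)
            ∂(gaussR p.1 (p.2 - p.1 ^ 2)) = Phi (D 3) p - Phi (D 4) p * p.1 := by
    rw [integral_sub i3 (i4.mul_const _), integral_mul_const]
    rfl
  have j3 : ∫ z, iteratedDeriv 4 f z ∂(gaussR p.1 (p.2 - p.1 ^ 2)) = Phi (D 4) p := rfl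
  rw [f1, f2, j1, j2, j3]
  refine ⟨?_, ?_, ?_, ?_⟩ <;> simp [DPhi] <;> ring
end
end

section
/- Let d ≥ 1, U ≥ 1, D > 1, and let f : ℝ^d → ℝ be convex and continuously differentiable, with f and ∇f integrable against every nondegenerate product Gaussian measure on ℝ^d. Define the negative ELBO ℓ(ξ,Ξ) = ∫ f dq(·;ω) + (1/2)·Σ_i (Ξ_ii − 1 − log(Ξ_ii − ξ_i²)) on Ω. If ω* ∈ Ω̃ satisfies ∇ℓ(ω*) = 0, then ℓ(ω*) = min_{ω ∈ Ω̃} ℓ(ω), and for every ω in the interior of Ω̃ it holds that ‖∇ℓ(ω)‖² ≥ 2·μ_C²·(ℓ(ω) − ℓ(ω*)), where μ_C = (4U² + 4D + 1)^{−1/2}. -/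
open MeasureTheory ProbabilityTheory
open scoped RealInnerProductSpace

noncomputable section

/-- The negative ELBO
`ℓ(ξ,Ξ) = ∫ f dq(·;ω) + (1/2)∑_i (Ξ_ii − 1 − log(Ξ_ii − ξ_i²))`. -/
def negELBO (d : ℕ) (f : (Fin d → ℝ) → ℝ) (ω : MFParam d) : ℝ :=
  (∫ z, f z ∂(mfGauss d ω)) + (1 / 2) * ∑ i, (XiP ω i - 1 - Real.log (varP ω i))

/-- The map `(m, σ) ↦ m + σ ∘ z`, linear in the parameters. -/
def affL {d : ℕ} (z : Fin d → ℝ) : MFParam d →L[ℝ] (Fin d → ℝ) :=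
  LinearMap.toContinuousLinearMap
    { toFun := fun p i => p (Sum.inl i) + p (Sum.inr i) * z i
      map_add' := by intro p q; ext i; simp; ring
      map_smul' := by intro c p; ext i; simp; ring }

theorem affL_apply {d : ℕ} (z : Fin d → ℝ) (p : MFParam d) (i : Fin d) :
    affL z p i = xiP p i + XiP p i * z i := rfl

theorem continuous_affL {d : ℕ} : Continuous (affL : (Fin d → ℝ) → _) := by
  rw [continuous_clm_apply]
  intro p
  refine continuous_pi fun i => ?_
  simp only [affL_apply]
  fun_prop

def stdG (d : ℕ) : Measure (Fin d → ℝ) := Measure.pi fun _ => gaussianReal 0 1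

def posS (d : ℕ) : Set (MFParam d) := {p | ∀ i, 0 < XiP p i}

theorem map_affL {d : ℕ} (p : MFParam d) :
    (stdG d).map (fun z => affL z p) =
      Measure.pi fun i => gaussianReal (xiP p i) ((XiP p i) ^ 2).toNNReal := by
  have key : ∀ i, (gaussianReal 0 1).map (fun x : ℝ => xiP p i + XiP p i * x) =
      gaussianReal (xiP p i) ((XiP p i) ^ 2).toNNReal := by
    intro i
    have : (fun x : ℝ => xiP p i + XiP p i * x) = (xiP p i + ·) ∘ (XiP p i * ·) := rfl
    rw [this, ← Measure.map_map (by fun_prop) (by fun_prop), gaussianReal_map_const_mul,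
      gaussianReal_map_const_add]
    congr 1
    · simp
    · ext
      simp [sq_nonneg]
  have hs : ∀ i, SigmaFinite ((gaussianReal 0 1).map (fun x : ℝ => xiP p i + XiP p i * x)) := by
    intro i; rw [key]; infer_instance
  have := Measure.pi_map_pi (μ := fun _ : Fin d => gaussianReal 0 1)
    (f := fun i x => xiP p i + XiP p i * x) (fun i => by fun_prop)
  simp only [key] at this
  exact this

theorem measurable_affL {d : ℕ} (p : MFParam d) : Measurable (fun z => affL z p) :=
  (continuous_affL.clm_apply continuous_const).measurable

theorem integrable_affL {d : ℕ} {f : (Fin d → ℝ) → ℝ}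
    (hintf : ∀ (m s : Fin d → ℝ), (∀ i, 0 < s i) →
      Integrable f (Measure.pi fun i => gaussianReal (m i) (s i).toNNReal))
    {p : MFParam d} (hp : p ∈ posS d) : Integrable (fun z => f (affL z p)) (stdG d) := by
  have h := hintf (fun i => xiP p i) (fun i => XiP p i ^ 2) (fun i => pow_pos (hp i) 2)
  simp only [← map_affL] at h
  exact h.comp_measurable (measurable_affL p)

theorem convexOn_affL {d : ℕ} {f : (Fin d → ℝ) → ℝ} (hconv : ConvexOn ℝ Set.univ f)
    (z : Fin d → ℝ) : ConvexOn ℝ Set.univ (fun p => f (affL z p)) :=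
  hconv.comp_linearMap (affL z).toLinearMap

theorem convex_posS (d : ℕ) : Convex ℝ (posS d) := by
  have : posS d = ⋂ i, {p : MFParam d | 0 < p (Sum.inr i)} := by
    ext p; simp [posS, XiP]
  rw [this]
  refine convex_iInter fun i => ?_
  exact convex_halfSpace_gt (f := fun p : MFParam d => p (Sum.inr i))
    ⟨fun x y => by simp, fun c x => by simp⟩ 0

theorem isOpen_posS (d : ℕ) : IsOpen (posS d) := by
  have : posS d = ⋂ i, {p : MFParam d | 0 < p (Sum.inr i)} := by
    ext p; simp [posS, XiP]
  rw [this]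
  refine isOpen_iInter_of_finite fun i => ?_
  exact isOpen_lt continuous_const (by fun_prop)

def FF {d : ℕ} (f : (Fin d → ℝ) → ℝ) (p : MFParam d) : ℝ := ∫ z, f (affL z p) ∂(stdG d)

theorem convexOn_FF {d : ℕ} {f : (Fin d → ℝ) → ℝ} (hconv : ConvexOn ℝ Set.univ f)
    (hintf : ∀ (m s : Fin d → ℝ), (∀ i, 0 < s i) →
      Integrable f (Measure.pi fun i => gaussianReal (m i) (s i).toNNReal)) :
    ConvexOn ℝ (posS d) (FF f) := by
  refine ⟨convex_posS d, ?_⟩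
  intro p hp q hq a b ha hb hab
  have h1 := integrable_affL hintf hp
  have h2 := integrable_affL hintf hq
  have h3 := integrable_affL hintf (convex_posS d hp hq ha hb hab)
  simp only [FF, smul_eq_mul]
  rw [← integral_const_mul, ← integral_const_mul, ← integral_add (h1.const_mul a) (h2.const_mul b)]
  refine integral_mono h3 ((h1.const_mul a).add (h2.const_mul b)) fun z => ?_
  exact (convexOn_affL hconv z).2 (Set.mem_univ p) (Set.mem_univ q) ha hb hab

theorem differentiableAt_FF {d : ℕ} {f : (Fin d → ℝ) → ℝ} (hconv : ConvexOn ℝ Set.univ f)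
    (hC1 : ContDiff ℝ 1 f)
    (hintf : ∀ (m s : Fin d → ℝ), (∀ i, 0 < s i) →
      Integrable f (Measure.pi fun i => gaussianReal (m i) (s i).toNNReal))
    {p : MFParam d} (hp : p ∈ posS d) : DifferentiableAt ℝ (FF f) p := by
  obtain ⟨b, hb, hbs⟩ := exists_mem_interior_convexHull_affineBasis
    ((isOpen_posS d).mem_nhds hp)
  obtain ⟨r, hr, hball⟩ := Metric.isOpen_iff.1 isOpen_interior p hb
  have hbp : ∀ i, b i ∈ posS d := fun i => hbs (subset_convexHull ℝ _ ⟨i, rfl⟩)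
  set B : (Fin d → ℝ) → ℝ := fun z => (∑ i, |f (affL z (b i))|) + 2 * |f (affL z p)| with hB
  have hBint : Integrable B (stdG d) :=
    (integrable_finsetSum _ fun i _ => (integrable_affL hintf (hbp i)).abs).add
      ((integrable_affL hintf hp).abs.const_mul 2)
  have hup : ∀ z, ∀ q ∈ Metric.ball p r, f (affL z q) ≤ ∑ i, |f (affL z (b i))| := by
    intro z q hq
    have hq' := interior_subset (hball hq)
    obtain ⟨y, ⟨i, rfl⟩, hy⟩ :=
      (convexOn_affL hconv z).exists_ge_of_mem_convexHull (Set.subset_univ _) hq'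
    refine hy.trans ((le_abs_self _).trans ?_)
    exact Finset.single_le_sum (f := fun i => |f (affL z (b i))|)
      (fun i _ => abs_nonneg _) (Finset.mem_univ i)
  have hbd : ∀ z, ∀ q, dist q p < r → |f (affL z q)| ≤ B z := by
    intro z q hq
    have h1 := hup z q hq
    have h2 := hup z ((2:ℝ) • p - q) (by
      rw [Metric.mem_ball, dist_eq_norm] at *
      have : (2:ℝ) • p - q - p = -(q - p) := by module
      rwa [this, norm_neg])
    have h3 := (convexOn_affL hconv z).2 (Set.mem_univ q) (Set.mem_univ ((2:ℝ) • p - q))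
      (show (0:ℝ) ≤ 1/2 by norm_num) (show (0:ℝ) ≤ 1/2 by norm_num) (by norm_num)
    have h4 : (1/2 : ℝ) • q + (1/2 : ℝ) • ((2:ℝ) • p - q) = p := by module
    simp only [h4, smul_eq_mul] at h3
    have h5 := neg_abs_le (f (affL z p))
    have h6 := abs_nonneg (f (affL z p))
    rw [abs_le]
    constructor <;> simp only [hB] <;> linarith
  have hlip : ∀ z, LipschitzOnWith (Real.nnabs (2 * B z / (r/2))) (fun q => f (affL z q))
      (Metric.ball p (r - r/2)) := by
    intro z
    have h := ((convexOn_affL hconv z).subset (Set.subset_univ _)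
      (convex_ball p r)).lipschitzOnWith_of_abs_le (half_pos hr) (hbd z)
    refine h.weaken ?_
    rw [← NNReal.coe_le_coe]
    simp only [Real.coe_nnabs]
    rw [Real.coe_toNNReal']
    exact max_le (le_abs_self _) (abs_nonneg _)
  have hd : Differentiable ℝ f := hC1.differentiable (by norm_num)
  have hcf : Continuous (fun z => fderiv ℝ f z) := hC1.continuous_fderiv (by norm_num)
  have haff : ∀ q : MFParam d, Continuous (fun z => affL z q) :=
    fun q => continuous_affL.clm_apply continuous_const
  have := hasFDerivAt_integral_of_dominated_loc_of_lip (μ := stdG d)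
    (F := fun q z => f (affL z q)) (x₀ := p)
    (F' := fun z => (fderiv ℝ f (affL z p)).comp (affL z))
    (bound := fun z => 2 * B z / (r/2))
    (Metric.ball_mem_nhds p (show 0 < r - r/2 by linarith))
    (Filter.Eventually.of_forall fun q =>
      (hC1.continuous.comp (haff q)).aestronglyMeasurable)
    (integrable_affL hintf hp)
    ((hcf.comp (haff p)).clm_comp continuous_affL).aestronglyMeasurable
    (Filter.Eventually.of_forall hlip)
    ((hBint.const_mul 2).div_const _)
    (Filter.Eventually.of_forall fun z =>
      (hd (affL z p)).hasFDerivAt.comp p (affL z).hasFDerivAt)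
  exact this.2.differentiableAt

/-- `(m, σ) ↦ (m, m² + σ²)` -/
def phiM {d : ℕ} (p : MFParam d) : MFParam d :=
  WithLp.toLp 2 (Sum.elim (fun i => xiP p i) (fun i => xiP p i ^ 2 + XiP p i ^ 2))

/-- `(ξ, Ξ) ↦ (ξ, √(Ξ - ξ²))` -/
def psiM {d : ℕ} (p : MFParam d) : MFParam d :=
  WithLp.toLp 2 (Sum.elim (fun i => xiP p i) (fun i => Real.sqrt (varP p i)))

theorem xiP_phiM {d : ℕ} (p : MFParam d) (i : Fin d) : xiP (phiM p) i = xiP p i := rfl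
theorem XiP_phiM {d : ℕ} (p : MFParam d) (i : Fin d) :
    XiP (phiM p) i = xiP p i ^ 2 + XiP p i ^ 2 := rfl
theorem xiP_psiM {d : ℕ} (p : MFParam d) (i : Fin d) : xiP (psiM p) i = xiP p i := rfl
theorem XiP_psiM {d : ℕ} (p : MFParam d) (i : Fin d) :
    XiP (psiM p) i = Real.sqrt (varP p i) := rfl
theorem varP_phiM {d : ℕ} (p : MFParam d) (i : Fin d) :
    varP (phiM p) i = XiP p i ^ 2 := by simp [varP, xiP_phiM, XiP_phiM]

theorem param_ext {d : ℕ} {p q : MFParam d} (h1 : ∀ i, xiP p i = xiP q i)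
    (h2 : ∀ i, XiP p i = XiP q i) : p = q := by
  ext i
  rcases i with i | i
  · exact h1 i
  · exact h2 i

theorem phiM_psiM {d : ℕ} {p : MFParam d} (hp : ∀ i, 0 < varP p i) : phiM (psiM p) = p := by
  refine param_ext (fun i => rfl) fun i => ?_
  rw [XiP_phiM, xiP_psiM, XiP_psiM, Real.sq_sqrt (hp i).le, varP]
  ring

theorem psiM_pos {d : ℕ} {p : MFParam d} (hp : ∀ i, 0 < varP p i) : psiM p ∈ posS d :=
  fun i => Real.sqrt_pos.2 (hp i)

theorem negELBO_eq {d : ℕ} {f : (Fin d → ℝ) → ℝ} (hC1 : ContDiff ℝ 1 f) (p : MFParam d) :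
    negELBO d f (phiM p) = FF f p +
      (1 / 2) * ∑ i, (xiP p i ^ 2 + XiP p i ^ 2 - 1 - Real.log (XiP p i ^ 2)) := by
  simp only [negELBO, mfGauss, FF, varP_phiM, XiP_phiM, xiP_phiM]
  rw [← map_affL, integral_map (measurable_affL p).aemeasurable
    hC1.continuous.aestronglyMeasurable]

theorem norm_sq_param {d : ℕ} (p : MFParam d) :
    ‖p‖ ^ 2 = ∑ i, (xiP p i ^ 2 + XiP p i ^ 2) := by
  rw [EuclideanSpace.norm_sq_eq, Fintype.sum_sum_type, ← Finset.sum_add_distrib]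
  simp [xiP, XiP]

theorem diff_negELBO {d : ℕ} {f : (Fin d → ℝ) → ℝ} (hconv : ConvexOn ℝ Set.univ f)
    (hC1 : ContDiff ℝ 1 f)
    (hintf : ∀ (m s : Fin d → ℝ), (∀ i, 0 < s i) →
      Integrable f (Measure.pi fun i => gaussianReal (m i) (s i).toNNReal))
    {ω : MFParam d} (hω : ∀ i, 0 < varP ω i) : DifferentiableAt ℝ (negELBO d f) ω := by
  have hvd : ∀ i, DifferentiableAt ℝ (fun w : MFParam d => varP w i) ω := by
    intro i; simp only [varP, xiP, XiP]; fun_prop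
  have hev : ∀ᶠ w in nhds ω, ∀ i, 0 < varP w i :=
    Filter.eventually_all.2 fun i => (hvd i).continuousAt.eventually_const_lt (hω i)
  have hpsi : DifferentiableAt ℝ (psiM : MFParam d → MFParam d) ω := by
    rw [differentiableAt_euclidean]
    rintro (i | i)
    · change DifferentiableAt ℝ (fun w : MFParam d => w (Sum.inl i)) ω
      fun_prop
    · change DifferentiableAt ℝ (fun w : MFParam d => Real.sqrt (varP w i)) ω
      exact (hvd i).sqrt (hω i).ne'
  have hF : DifferentiableAt ℝ (fun w => FF f (psiM w)) ω :=
    (differentiableAt_FF hconv hC1 hintf (psiM_pos hω)).comp ω hpsi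
  have hR : DifferentiableAt ℝ
      (fun w : MFParam d => (1 / 2 : ℝ) * ∑ i, (XiP w i - 1 - Real.log (varP w i))) ω := by
    refine DifferentiableAt.const_mul (DifferentiableAt.fun_sum fun i _ => ?_) _
    refine DifferentiableAt.sub ?_ ((hvd i).log (hω i).ne')
    simp only [XiP]; fun_prop
  refine (hF.add hR).congr_of_eventuallyEq ?_
  filter_upwards [hev] with w hw
  simp only [negELBO, mfGauss, FF, Pi.add_apply]
  congr 1
  have h := map_affL (psiM w)
  simp only [xiP_psiM, XiP_psiM, Real.sq_sqrt (hw _).le] at h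
  rw [← h, integral_map (measurable_affL _).aemeasurable hC1.continuous.aestronglyMeasurable]

def jac {d : ℕ} (p v : MFParam d) : MFParam d :=
  WithLp.toLp 2 (Sum.elim (fun i => xiP v i)
    (fun i => 2 * xiP p i * xiP v i + 2 * XiP p i * XiP v i))

theorem hasDerivAt_phiM {d : ℕ} (p v : MFParam d) :
    HasDerivAt (fun t : ℝ => phiM (p + t • v)) (jac p v) 0 := by
  have h : HasDerivAt (fun t : ℝ => WithLp.ofLp (phiM (p + t • v))) (WithLp.ofLp (jac p v)) 0 := by
    rw [hasDerivAt_pi]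
    have hl : ∀ a b : ℝ, HasDerivAt (fun t : ℝ => a + t * b) b 0 := by
      intro a b
      simpa using ((hasDerivAt_id (0:ℝ)).mul_const b).const_add a
    rintro (i | i)
    · exact hl (p (Sum.inl i)) (v (Sum.inl i))
    · have h1 := (hl (xiP p i) (xiP v i)).pow 2
      have h2 := (hl (XiP p i) (XiP v i)).pow 2
      refine HasDerivAt.congr_deriv (f := fun t : ℝ => (xiP p i + t * xiP v i) ^ 2 +
        (XiP p i + t * XiP v i) ^ 2) (h1.add h2) ?_
      change _ = 2 * xiP p i * xiP v i + 2 * XiP p i * XiP v i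
      simp
  exact (PiLp.hasFDerivAt_toLp 2 _).comp_hasDerivAt 0 h

theorem gradient_ineq {d : ℕ} {f : (Fin d → ℝ) → ℝ} (hconv : ConvexOn ℝ Set.univ f)
    (hC1 : ContDiff ℝ 1 f)
    (hintf : ∀ (m s : Fin d → ℝ), (∀ i, 0 < s i) →
      Integrable f (Measure.pi fun i => gaussianReal (m i) (s i).toNNReal))
    {p q : MFParam d} (hp : p ∈ posS d) (hq : q ∈ posS d) :
    negELBO d f (phiM p) + ⟪gradient (negELBO d f) (phiM p), jac p (q - p)⟫ +
      1 / 2 * ‖q - p‖ ^ 2 ≤ negELBO d f (phiM q) := by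
  set G : MFParam d → ℝ := fun w => FF f w + ∑ i, (-Real.log (XiP w i)) with hG
  have hGconv : ConvexOn ℝ (posS d) G := by
    refine (convexOn_FF hconv hintf).add ⟨convex_posS d, ?_⟩
    intro x hx y hy a b ha hb hab
    simp only [smul_eq_mul, Finset.mul_sum, ← Finset.sum_add_distrib]
    refine Finset.sum_le_sum fun i _ => ?_
    have := strictConcaveOn_log_Ioi.concaveOn.2 (hx i) (hy i) ha hb hab
    simp only [smul_eq_mul] at this
    have e : XiP (a • x + b • y) i = a * XiP x i + b * XiP y i := by simp [XiP]
    rw [e]; linarith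
  have hGeq : ∀ w, negELBO d f (phiM w) = G w + 1 / 2 * ‖w‖ ^ 2 - d / 2 := by
    intro w
    rw [negELBO_eq hC1, norm_sq_param]
    simp only [hG, Real.log_pow, Finset.sum_sub_distrib, Finset.sum_neg_distrib,
      ← Finset.mul_sum]
    simp
    ring
  set v := q - p with hv
  set g : ℝ → ℝ := fun t => G (p + t • v) with hg
  have hgconv : ConvexOn ℝ (Set.Icc 0 1) g := by
    have h := hGconv.comp_affineMap (AffineMap.lineMap p q : ℝ →ᵃ[ℝ] MFParam d)
    have e : G ∘ (AffineMap.lineMap p q : ℝ →ᵃ[ℝ] MFParam d) = g := by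
      ext t
      simp [hg, AffineMap.lineMap_apply_module', hv, add_comm]
    rw [e] at h
    refine h.subset ?_ (convex_Icc 0 1)
    intro t ht
    exact (convex_posS d).lineMap_mem hp hq ht
  have hpv : ∀ i, 0 < varP (phiM p) i := fun i => by
    rw [varP_phiM]; exact pow_pos (hp i) 2
  have hdiff := diff_negELBO hconv hC1 hintf hpv
  have hder : HasDerivAt (fun t : ℝ => negELBO d f (phiM (p + t • v)))
      ⟪gradient (negELBO d f) (phiM p), jac p v⟫ 0 := by
    have h1 := hdiff.hasGradientAt.hasFDerivAt
    have e : phiM p = phiM (p + (0:ℝ) • v) := by simp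
    have h2 := HasFDerivAt.comp_hasDerivAt_of_eq (0:ℝ) h1 (hasDerivAt_phiM p v) e
    refine HasDerivAt.congr_deriv h2 ?_
    simp
  have hsq : HasDerivAt (fun t : ℝ => 1 / 2 * ‖p + t • v‖ ^ 2) (⟪p, v⟫) 0 := by
    have h0 : HasDerivAt (fun t : ℝ => p + t • v) v 0 := by
      simpa using ((hasDerivAt_id (0:ℝ)).smul_const v).const_add p
    have := h0.norm_sq.const_mul (1/2 : ℝ)
    refine HasDerivAt.congr_deriv this ?_
    simp
  have hgd : HasDerivAt g (⟪gradient (negELBO d f) (phiM p), jac p v⟫ - ⟪p, v⟫) 0 := by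
    have := (hder.sub hsq).add_const ((d:ℝ) / 2)
    refine this.congr_of_eventuallyEq (Filter.Eventually.of_forall fun t => ?_)
    change G (p + t • v) = negELBO d f (phiM (p + t • v)) - 1 / 2 * ‖p + t • v‖ ^ 2 + (d:ℝ) / 2
    rw [hGeq]
    ring
  have hs := hgconv.le_slope_of_hasDerivWithinAt (x := 0) (y := 1) (by simp) (by simp)
    one_pos hgd.hasDerivWithinAt
  have e1 : p + (1:ℝ) • v = q := by simp [hv]
  rw [slope_def_field] at hs
  simp only [hg, e1, zero_smul, add_zero, sub_zero, div_one] at hs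
  rw [hGeq p, hGeq q]
  have e2 : ‖q‖ ^ 2 = ‖p‖ ^ 2 + 2 * ⟪p, v⟫ + ‖v‖ ^ 2 := by
    rw [← norm_add_sq_real, hv, add_sub_cancel]
  rw [e2]
  linarith

theorem jac_bound {d : ℕ} {U D : ℝ} {p : MFParam d}
    (h1 : ∀ i, xiP p i ^ 2 ≤ U ^ 2) (h2 : ∀ i, XiP p i ^ 2 ≤ D) (v : MFParam d) :
    ‖jac p v‖ ^ 2 ≤ (4 * U ^ 2 + 4 * D + 1) * ‖v‖ ^ 2 := by
  rw [norm_sq_param, norm_sq_param, Finset.mul_sum]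
  refine Finset.sum_le_sum fun i _ => ?_
  change xiP v i ^ 2 + (2 * xiP p i * xiP v i + 2 * XiP p i * XiP v i) ^ 2 ≤ _
  generalize xiP v i = a
  generalize XiP v i = b
  have h1 := h1 i
  have h2 := h2 i
  generalize xiP p i = m at *
  generalize XiP p i = s at *
  have h3 : (m * a + s * b) ^ 2 ≤ (m ^ 2 + s ^ 2) * (a ^ 2 + b ^ 2) := by
    nlinarith [sq_nonneg (m * b - s * a)]
  have h4 : (m ^ 2 + s ^ 2) * (a ^ 2 + b ^ 2) ≤ (U ^ 2 + D) * (a ^ 2 + b ^ 2) := by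
    gcongr
  nlinarith [sq_nonneg b]

/-- Proposition 3.3, PL inequality from hidden convexity: for `f`
convex and `C¹`, with `f` and `∇f` integrable against every nondegenerate product
Gaussian, any stationary point `ω* ∈ Ω̃` of `ℓ` is a global minimizer over `Ω̃`, and on
the interior of `Ω̃` the PL inequality `‖∇ℓ(ω)‖² ≥ 2 μ_C² (ℓ(ω) − ℓ(ω*))` holds with
`μ_C = (4U² + 4D + 1)^{-1/2}`. -/
theorem pl_inequality_of_negELBO
    {d : ℕ} (hd : 1 ≤ d) {U D : ℝ} (hU : 1 ≤ U) (hD : 1 < D)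
    (f : (Fin d → ℝ) → ℝ) (hconv : ConvexOn ℝ Set.univ f) (hC1 : ContDiff ℝ 1 f)
    (hintf : ∀ (m s : Fin d → ℝ), (∀ i, 0 < s i) →
      Integrable f (Measure.pi fun i => gaussianReal (m i) (s i).toNNReal))
    (hintdf : ∀ (m s : Fin d → ℝ), (∀ i, 0 < s i) →
      Integrable (fun z => fderiv ℝ f z) (Measure.pi fun i => gaussianReal (m i) (s i).toNNReal))
    (ωstar : MFParam d) (hωstar : ωstar ∈ OmegaT d U D)
    (hstat : gradient (negELBO d f) ωstar = 0) :
    (∀ ω ∈ OmegaT d U D, negELBO d f ωstar ≤ negELBO d f ω) ∧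
    ∀ ω ∈ interior (OmegaT d U D),
      ‖gradient (negELBO d f) ω‖ ^ 2 ≥
        2 * ((Real.sqrt (4 * U ^ 2 + 4 * D + 1))⁻¹) ^ 2 *
          (negELBO d f ω - negELBO d f ωstar) := by
  have hDpos : 0 < D⁻¹ := inv_pos.2 (by linarith)
  have hvar : ∀ ω ∈ OmegaT d U D, ∀ i, 0 < varP ω i :=
    fun ω hω i => hDpos.trans_le (hω i).2.1
  constructor
  · intro ω hω
    have h := gradient_ineq hconv hC1 hintf (psiM_pos (hvar _ hωstar)) (psiM_pos (hvar _ hω))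
    rw [phiM_psiM (hvar _ hωstar), phiM_psiM (hvar _ hω), hstat, inner_zero_left] at h
    have := sq_nonneg ‖psiM ω - psiM ωstar‖
    linarith
  · intro ω hω'
    have hω := interior_subset hω'
    have h := gradient_ineq hconv hC1 hintf (psiM_pos (hvar _ hω)) (psiM_pos (hvar _ hωstar))
    rw [phiM_psiM (hvar _ hωstar), phiM_psiM (hvar _ hω)] at h
    set v := psiM ωstar - psiM ω
    set g := gradient (negELBO d f) ω
    have hj := jac_bound (U := U) (D := D) (p := psiM ω)
      (fun i => by rw [xiP_psiM]; exact sq_le_sq.2 ((hω i).1.trans (le_abs_self U)))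
      (fun i => by rw [XiP_psiM, Real.sq_sqrt (hvar _ hω i).le]; exact (hω i).2.2) v
    have hC : 0 < 4 * U ^ 2 + 4 * D + 1 := by positivity
    rw [inv_pow, Real.sq_sqrt hC.le]
    set C := 4 * U ^ 2 + 4 * D + 1
    have hsum := norm_add_sq_real (C • g) (jac (psiM ω) v)
    have hn := sq_nonneg ‖C • g + jac (psiM ω) v‖
    rw [norm_smul, Real.norm_of_nonneg hC.le, inner_smul_left, mul_pow] at hsum
    simp only [conj_trivial] at hsum
    rw [hsum] at hn
    have hk : 0 ≤ C * (C * ‖g‖ ^ 2 + 2 * ⟪g, jac (psiM ω) v⟫ + ‖v‖ ^ 2) := by nlinarith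
    have hk' := nonneg_of_mul_nonneg_right hk hC
    have : negELBO d f ω - negELBO d f ωstar ≤ C * ‖g‖ ^ 2 / 2 := by linarith
    have h2 : 2 * C⁻¹ * (negELBO d f ω - negELBO d f ωstar) ≤ 2 * C⁻¹ * (C * ‖g‖ ^ 2 / 2) := by
      gcongr
    refine h2.trans (le_of_eq ?_)
    field_simp

end
end

section
/- Let f : ℝ → ℝ be four times continuously differentiable with sup_z |f'(z)| ≤ L₁ and sup_z |f''(z)| ≤ L₂ for constants L₁, L₂ ≥ 0, and such that f''' and f'''' are integrable with respect to every Gaussian N(μ,σ²). Let D > 0 and set β = (D/2)·L₂ + (√(2D)/2)·L₁. Then for every μ ∈ ℝ and every σ² with 0 < σ² ≤ D, writing B = E_{z∼N(μ,σ²)}[f'''(z)] and C = E_{z∼N(μ,σ²)}[f''''(z)], both of the following 2×2 symmetric matrices are positive semidefinite: M(β) with entries M₁₁ = β/σ² + 2μ²β/σ⁴ + 2μB − μ²C, M₁₂ = −μβ/σ⁴ − (1/2)(B − μC), M₂₂ = β/(2σ⁴) − C/4; and N(−β) with entries N₁₁ = −2μB + μ²C + β/σ² + 2μ²β/σ⁴,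 N₁₂ = (1/2)(B − μC) − μβ/σ⁴, N₂₂ = C/4 + β/(2σ⁴). Consequently, the map ω ↦ E_{q(·;ω)}[f] is β-smooth relative to A* on the set {(μ,σ²) : 0 < σ² ≤ D}. -/
open MeasureTheory ProbabilityTheory
open scoped RealInnerProductSpace

noncomputable section

/-- `B(μ,σ²) = E_{z∼N(μ,σ²)}[f'''(z)]`. -/
def Bexp (f : ℝ → ℝ) (μ σ2 : ℝ) : ℝ := ∫ z, iteratedDeriv 3 f z ∂(gaussianReal μ σ2.toNNReal)

/-- `C(μ,σ²) = E_{z∼N(μ,σ²)}[f''''(z)]`. -/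
def Cexp (f : ℝ → ℝ) (μ σ2 : ℝ) : ℝ := ∫ z, iteratedDeriv 4 f z ∂(gaussianReal μ σ2.toNNReal)

/-- The matrix `M(β) = β∇²A*(ω) − ∇²E_{q(·;ω)}[f]`. -/
def Mmat (β μ σ2 B C : ℝ) : Matrix (Fin 2) (Fin 2) ℝ :=
  !![β / σ2 + 2 * μ ^ 2 * β / σ2 ^ 2 + 2 * μ * B - μ ^ 2 * C,
      -(μ * β) / σ2 ^ 2 - (1 / 2) * (B - μ * C);
    -(μ * β) / σ2 ^ 2 - (1 / 2) * (B - μ * C),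
      β / (2 * σ2 ^ 2) - C / 4]

/-- The matrix `N(α) = ∇²E_{q(·;ω)}[f] − α∇²A*(ω)`. -/
def Nmat (α μ σ2 B C : ℝ) : Matrix (Fin 2) (Fin 2) ℝ :=
  !![-2 * μ * B + μ ^ 2 * C - α / σ2 - 2 * μ ^ 2 * α / σ2 ^ 2,
      (1 / 2) * (B - μ * C) + μ * α / σ2 ^ 2;
    (1 / 2) * (B - μ * C) + μ * α / σ2 ^ 2,
      C / 4 - α / (2 * σ2 ^ 2)]

/-- The univariate Gaussian expectation parameter space `(ξ, Ξ) ∈ ℝ²`. -/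
abbrev UParam := EuclideanSpace ℝ (Fin 2)

/-- The univariate mirror map `A*(ξ, Ξ) = −(1/2) log(Ξ − ξ²)`. -/
def Astar1 (ω : UParam) : ℝ := -(1 / 2) * Real.log (ω 1 - (ω 0) ^ 2)

/-- Its Bregman divergence. -/
def bregAstar1 (u v : UParam) : ℝ := Astar1 u - Astar1 v - ⟪gradient Astar1 v, u - v⟫

/-- The expected value `F(ξ, Ξ) = E_{z ∼ N(ξ, Ξ − ξ²)}[f(z)]`. -/
def expVal (f : ℝ → ℝ) (ω : UParam) : ℝ :=
  ∫ z, f z ∂(gaussianReal (ω 0) ((ω 1 - (ω 0) ^ 2).toNNReal))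


open Real Set Filter Topology in
lemma ax_int_abs (b : ℝ) (hb : 0 < b) : ∫ z : ℝ, |z| * Real.exp (-b * z ^ 2) = 1 / b := by
  have h1 := integral_comp_abs (f := fun x : ℝ => x * Real.exp (-b * x ^ 2))
  simp only [sq_abs] at h1
  rw [h1]
  have h2 : ∫ x in Ioi (0:ℝ), x * Real.exp (-b * x ^ 2) = 0 - (-(1 / (2 * b)) * Real.exp (-b * 0 ^ 2)) := by
    apply integral_Ioi_of_hasDerivAt_of_tendsto' (f := fun x => -(1 / (2 * b)) * Real.exp (-b * x ^ 2))
    · intro x _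
      have : HasDerivAt (fun x : ℝ => -b * x ^ 2) (-b * (2 * x)) x := by
        simpa using (hasDerivAt_pow 2 x).const_mul (-b)
      refine ((this.exp).const_mul (-(1 / (2 * b)))).congr_deriv ?_
      field_simp
    · exact (integrable_mul_exp_neg_mul_sq hb).integrableOn
    · have : Tendsto (fun x : ℝ => Real.exp (-b * x ^ 2)) atTop (𝓝 0) := by
        apply Real.tendsto_exp_atBot.comp
        exact (tendsto_pow_atTop two_ne_zero).const_mul_atTop_of_neg (by linarith)
      simpa using this.const_mul (-(1 / (2 * b)))
  rw [h2]; simp; field_simp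

open Real Set Filter Topology in
lemma ax_int_sq : ∫ z : ℝ, |z ^ 2 - 1| * Real.exp (-(1/2) * z ^ 2) = 4 * Real.exp (-(1/2)) := by
  have h1 := integral_comp_abs (f := fun x : ℝ => |x ^ 2 - 1| * Real.exp (-(1/2) * x ^ 2))
  simp only [sq_abs] at h1
  rw [h1]
  have hi0 : Integrable (fun x : ℝ => Real.exp (-(1/2) * x ^ 2)) := integrable_exp_neg_mul_sq (by norm_num)
  have hi2 : Integrable (fun x : ℝ => x ^ 2 * Real.exp (-(1/2) * x ^ 2)) := by
    have := integrable_rpow_mul_exp_neg_mul_sq (b := 1/2) (by norm_num) (s := 2) (by norm_num)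
    simpa using this
  have hi : Integrable (fun x : ℝ => (x ^ 2 - 1) * Real.exp (-(1/2) * x ^ 2)) := by
    refine (hi2.sub hi0).congr (ae_of_all _ fun x => ?_)
    simp; ring
  have hi' : Integrable (fun x : ℝ => |x ^ 2 - 1| * Real.exp (-(1/2) * x ^ 2)) := by
    refine hi.norm.congr (ae_of_all _ fun x => ?_)
    simp [abs_mul]
  have hd : ∀ x : ℝ, HasDerivAt (fun x => -x * Real.exp (-(1/2) * x ^ 2)) ((x ^ 2 - 1) * Real.exp (-(1/2) * x ^ 2)) x := by
    intro x
    have : HasDerivAt (fun x : ℝ => -(1/2) * x ^ 2) (-(1/2) * (2 * x)) x := by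
      simpa using (hasDerivAt_pow 2 x).const_mul (-(1/2) : ℝ)
    refine (((hasDerivAt_id' x).neg).mul this.exp).congr_deriv ?_
    simp only [Pi.neg_apply]; ring
  have h2 : ∫ x in Ioi (1:ℝ), |x ^ 2 - 1| * Real.exp (-(1/2) * x ^ 2) = Real.exp (-(1/2)) := by
    have : ∫ x in Ioi (1:ℝ), |x ^ 2 - 1| * Real.exp (-(1/2) * x ^ 2) = ∫ x in Ioi (1:ℝ), (x ^ 2 - 1) * Real.exp (-(1/2) * x ^ 2) := by
      apply setIntegral_congr_fun measurableSet_Ioi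
      intro x hx
      simp only [mem_Ioi] at hx
      simp only
      rw [abs_of_nonneg (by nlinarith)]
    rw [this, integral_Ioi_of_hasDerivAt_of_tendsto' (m := 0) (fun x _ => hd x) hi.integrableOn]
    · norm_num
    · have := (rpow_mul_exp_neg_mul_sq_isLittleO_exp_neg (b := 1/2) (by norm_num) 1).isBigO.trans_tendsto
        (Real.tendsto_exp_atBot.comp (tendsto_id.const_mul_atTop_of_neg (by norm_num : -(1/2:ℝ) < 0)))
      simpa using this.neg
  have h3 : ∫ x in (0:ℝ)..1, |x ^ 2 - 1| * Real.exp (-(1/2) * x ^ 2) = Real.exp (-(1/2)) := by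
    have : ∫ x in (0:ℝ)..1, |x ^ 2 - 1| * Real.exp (-(1/2) * x ^ 2) = ∫ x in (0:ℝ)..1, -((x ^ 2 - 1) * Real.exp (-(1/2) * x ^ 2)) := by
      apply intervalIntegral.integral_congr
      intro x hx
      rw [uIcc_of_le zero_le_one] at hx
      simp only
      rw [abs_of_nonpos (by nlinarith [hx.1, hx.2])]; ring
    rw [this, intervalIntegral.integral_neg, intervalIntegral.integral_eq_sub_of_hasDerivAt (fun x _ => hd x) (hi.intervalIntegrable)]
    norm_num
  rw [← intervalIntegral.integral_interval_add_Ioi (b := 1) hi'.integrableOn hi'.integrableOn, h2, h3]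
  ring

abbrev axG : Measure ℝ := gaussianReal 0 1

def axC : ℝ := (√(2 * Real.pi))⁻¹

lemma axC_pos : 0 < axC := by unfold axC; positivity

lemma ax_pdf (z : ℝ) : gaussianPDFReal 0 1 z = axC * Real.exp (-(1/2) * z ^ 2) := by
  simp [gaussianPDFReal, axC]
  left; ring

lemma ax_gint (F : ℝ → ℝ) : ∫ z, F z ∂axG = axC * ∫ z, F z * Real.exp (-(1/2) * z ^ 2) := by
  rw [integral_gaussianReal_eq_integral_smul one_ne_zero, ← integral_const_mul]
  congr 1; ext z
  rw [ax_pdf]; simp; ring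

lemma ax_gintble (F : ℝ → ℝ) : Integrable F axG ↔ Integrable (fun z => F z * Real.exp (-(1/2) * z ^ 2)) := by
  unfold axG
  rw [gaussianReal_of_var_ne_zero _ one_ne_zero,
    integrable_withDensity_iff_integrable_smul' (measurable_gaussianPDF 0 1) (ae_of_all _ fun x => gaussianPDF_lt_top)]
  simp_rw [toReal_gaussianPDF, ax_pdf]
  rw [← integrable_const_mul_iff (c := axC) (f := fun z => F z * Real.exp (-(1/2) * z ^ 2)) (IsUnit.mk0 _ axC_pos.ne')]
  apply iff_of_eq; congr 1; ext z
  simp; ring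

lemma ax_poly (n : ℕ) : Integrable (fun z : ℝ => z ^ n) axG := by
  have := (memLp_id_gaussianReal (μ := 0) (v := 1) (n : NNReal)).integrable_norm_pow'
  have h2 : Integrable (fun z : ℝ => ‖z ^ n‖) axG := by
    refine this.congr (ae_of_all _ fun x => ?_)
    simp
  exact (integrable_norm_iff (by fun_prop)).1 h2

lemma ax_EZ : ∫ z, |z| ∂axG ≤ 4 / 5 := by
  rw [ax_gint, ax_int_abs _ (by norm_num)]
  have : axC ≤ 2 / 5 := by
    unfold axC
    rw [inv_le_comm₀ (by positivity) (by norm_num)]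
    apply Real.le_sqrt_of_sq_le
    nlinarith [Real.pi_gt_d2]
  linarith

lemma ax_EZ2 : ∫ z, |z ^ 2 - 1| ∂axG ≤ 1 := by
  rw [ax_gint, ax_int_sq]
  have h1 : axC * axC * (2 * Real.pi) = 1 := by
    unfold axC
    rw [← mul_inv, Real.mul_self_sqrt (by positivity)]
    exact inv_mul_cancel₀ (by positivity)
  have h2 : Real.exp (-(1/2)) * Real.exp (-(1/2)) * Real.exp 1 = 1 := by
    rw [← Real.exp_add, ← Real.exp_add]; norm_num
  have h3 := Real.exp_one_gt_d9
  have h4 := Real.pi_gt_d2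
  have h5 := axC_pos
  have h6 := Real.exp_pos (-(1/2))
  set a := axC
  set e := Real.exp (-(1/2))
  set E := Real.exp 1
  have h7 : (a * e) ^ 2 * (2 * Real.pi * E) = 1 := by linear_combination h1 + a * a * (2 * Real.pi) * h2
  have h8 : 16 ≤ 2 * Real.pi * E := by nlinarith
  have h9 : (a * e) ^ 2 * 16 ≤ 1 := by nlinarith [sq_nonneg (a * e)]
  nlinarith [mul_pos h5 h6]

lemma ax_stein (k k' : ℝ → ℝ) (hk : ∀ z, HasDerivAt k (k' z) z) (h0 : Integrable k axG)
    (h1 : Integrable k' axG) (h2 : Integrable (fun z => k z * z) axG) :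
    ∫ z, k' z ∂axG = ∫ z, k z * z ∂axG := by
  rw [ax_gint, ax_gint]
  congr 1
  rw [ax_gintble] at h0 h1 h2
  have hd : ∀ x : ℝ, HasDerivAt (fun x => Real.exp (-(1/2) * x ^ 2)) (-(x * Real.exp (-(1/2) * x ^ 2))) x := by
    intro x
    have : HasDerivAt (fun x : ℝ => -(1/2) * x ^ 2) (-(1/2) * (2 * x)) x := by
      simpa using (hasDerivAt_pow 2 x).const_mul (-(1/2) : ℝ)
    convert this.exp using 1
    ring
  have := integral_mul_deriv_eq_deriv_mul_of_integrable (u := k) (u' := k') (v := fun x => Real.exp (-(1/2) * x ^ 2))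
    (fun x _ => hk x) (fun x _ => hd x) (by
      refine h2.neg.congr (ae_of_all _ fun x => ?_)
      simp; ring) h1 h0
  rw [← neg_eq_iff_eq_neg] at this
  rw [← this, ← integral_neg]
  congr 1; ext x; ring

lemma ax_mix (k k' : ℝ → ℝ) (hk : ∀ z, HasDerivAt k (k' z) z) (hc : Continuous k') (A B : ℝ)
    (h0 : ∀ z, |k z| ≤ A) (h1 : ∀ z, |k' z| ≤ B) :
    |∫ z, k' z ∂axG| ≤ 193 / 1000 * B + 532 / 1000 * A := by
  have hA : 0 ≤ A := (abs_nonneg _).trans (h0 0)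
  have hB : 0 ≤ B := (abs_nonneg _).trans (h1 0)
  have hkc : Continuous k := continuous_iff_continuousAt.2 fun z => (hk z).continuousAt
  have hd : ∀ b x : ℝ, HasDerivAt (fun x => Real.exp (-b * x ^ 2)) (-(2 * b) * (x * Real.exp (-b * x ^ 2))) x := by
    intro b x
    have : HasDerivAt (fun x : ℝ => -b * x ^ 2) (-b * (2 * x)) x := by
      simpa using (hasDerivAt_pow 2 x).const_mul (-b : ℝ)
    convert this.exp using 1
    ring
  have i0 : ∀ b : ℝ, 0 < b → Integrable (fun x : ℝ => Real.exp (-b * x ^ 2)) := fun b hb => integrable_exp_neg_mul_sq hb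
  have i1 : ∀ b : ℝ, 0 < b → Integrable (fun x : ℝ => x * Real.exp (-b * x ^ 2)) := fun b hb => integrable_mul_exp_neg_mul_sq hb
  have bk : ∀ (F : ℝ → ℝ), Integrable F → Integrable (fun x => k x * F x) := fun F hF =>
    hF.bdd_mul (c := A) hkc.aestronglyMeasurable (ae_of_all _ h0)
  have bk' : ∀ (F : ℝ → ℝ), Integrable F → Integrable (fun x => k' x * F x) := fun F hF =>
    hF.bdd_mul (c := B) hc.aestronglyMeasurable (ae_of_all _ h1)
  have ibp : ∀ b : ℝ, 0 < b → ∫ x, k' x * Real.exp (-b * x ^ 2) = (2 * b) * ∫ x, k x * (x * Real.exp (-b * x ^ 2)) := by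
    intro b hb
    have := integral_mul_deriv_eq_deriv_mul_of_integrable (u := k) (u' := k') (v := fun x => Real.exp (-b * x ^ 2))
      (fun x _ => hk x) (fun x _ => hd b x) (bk _ ((i1 b hb).const_mul _)) (bk' _ (i0 b hb)) (bk _ (i0 b hb))
    rw [← neg_eq_iff_eq_neg] at this
    rw [← this, ← integral_const_mul, ← integral_neg]
    congr 1; ext x; ring
  have e1 : ∫ z, k' z * Real.exp (-(1/2) * z ^ 2) = (1/3) * (∫ z, k' z * Real.exp (-(3/2) * z ^ 2))
      + ∫ z, k z * (z * Real.exp (-(1/2) * z ^ 2) - z * Real.exp (-(3/2) * z ^ 2)) := by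
    have : ∫ z, k z * (z * Real.exp (-(1/2) * z ^ 2) - z * Real.exp (-(3/2) * z ^ 2))
        = (∫ z, k z * (z * Real.exp (-(1/2) * z ^ 2))) - ∫ z, k z * (z * Real.exp (-(3/2) * z ^ 2)) := by
      rw [← integral_sub (bk _ (i1 _ (by norm_num))) (bk _ (i1 _ (by norm_num)))]
      congr 1; ext x; ring
    rw [this, ibp _ (by norm_num), ibp _ (by norm_num)]; ring
  have b1 : |∫ z, k' z * Real.exp (-(3/2) * z ^ 2)| ≤ B * √(Real.pi / (3/2)) := by
    rw [← integral_gaussian, ← integral_const_mul, ← Real.norm_eq_abs]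
    apply norm_integral_le_of_norm_le ((i0 _ (by norm_num)).const_mul _)
    refine ae_of_all _ fun x => ?_
    rw [norm_mul, Real.norm_eq_abs, Real.norm_of_nonneg (Real.exp_pos _).le]
    exact mul_le_mul_of_nonneg_right (h1 x) (Real.exp_pos _).le
  have b2 : |∫ z, k z * (z * Real.exp (-(1/2) * z ^ 2) - z * Real.exp (-(3/2) * z ^ 2))| ≤ A * (4/3) := by
    have ia : ∀ b : ℝ, 0 < b → Integrable (fun x : ℝ => |x| * Real.exp (-b * x ^ 2)) := fun b hb => by
      refine (i1 b hb).norm.congr (ae_of_all _ fun x => ?_)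
      simp [abs_mul]
    have : A * (4/3) = ∫ z, A * (|z| * Real.exp (-(1/2) * z ^ 2) - |z| * Real.exp (-(3/2) * z ^ 2)) := by
      rw [integral_const_mul, integral_sub (ia _ (by norm_num)) (ia _ (by norm_num)), ax_int_abs _ (by norm_num), ax_int_abs _ (by norm_num)]
      norm_num
    rw [this, ← Real.norm_eq_abs]
    apply norm_integral_le_of_norm_le (((ia _ (by norm_num)).sub (ia _ (by norm_num))).const_mul _)
    refine ae_of_all _ fun x => ?_
    have hx : Real.exp (-(3/2) * x ^ 2) ≤ Real.exp (-(1/2) * x ^ 2) := by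
      apply Real.exp_le_exp.2; nlinarith [sq_nonneg x]
    simp only [Pi.sub_apply]
    rw [← mul_sub, norm_mul, norm_mul, Real.norm_eq_abs, Real.norm_eq_abs, Real.norm_of_nonneg (sub_nonneg.2 hx), ← mul_sub]
    exact mul_le_mul_of_nonneg_right (h0 x) (mul_nonneg (abs_nonneg _) (sub_nonneg.2 hx))
  rw [ax_gint, abs_mul, abs_of_pos axC_pos, e1]
  have c1 : axC * √(Real.pi / (3/2)) ≤ 579 / 1000 := by
    unfold axC
    rw [inv_mul_eq_div, ← Real.sqrt_div (by positivity)]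
    apply Real.sqrt_le_iff.2
    constructor
    · norm_num
    · have : Real.pi / (3/2) / (2 * Real.pi) = 1 / 3 := by field_simp
      rw [this]; norm_num
  have c2 : axC ≤ 399 / 1000 := by
    unfold axC
    rw [inv_le_comm₀ (by positivity) (by norm_num)]
    apply Real.le_sqrt_of_sq_le
    nlinarith [Real.pi_gt_d6]
  have c0 := axC_pos
  calc _ ≤ axC * ((1/3) * (B * √(Real.pi / (3/2))) + A * (4/3)) := by
        apply mul_le_mul_of_nonneg_left _ c0.le
        refine (abs_add_le _ _).trans ?_
        rw [abs_mul, abs_of_pos (by norm_num : (0:ℝ) < 1/3)]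
        linarith
    _ = (1/3) * B * (axC * √(Real.pi / (3/2))) + A * (4/3) * axC := by ring
    _ ≤ _ := by nlinarith

lemma ax_mapeq (m s : ℝ) (hs : 0 ≤ s) :
    gaussianReal m s.toNNReal = axG.map (fun z => m + √s * z) := by
  have h1 : axG.map (fun z => √s * z) = gaussianReal 0 s.toNNReal := by
    rw [gaussianReal_map_const_mul]
    congr 1
    · simp
    · ext; simp [Real.sq_sqrt hs, hs]
  have h2 : (fun z => m + √s * z) = (fun z => m + z) ∘ (fun z => √s * z) := rfl
  rw [h2, ← Measure.map_map (by fun_prop) (by fun_prop), h1, gaussianReal_map_const_add]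
  simp

lemma ax_mapint (F : ℝ → ℝ) (hF : Continuous F) (m s : ℝ) (hs : 0 ≤ s) :
    ∫ z, F z ∂(gaussianReal m s.toNNReal) = ∫ z, F (m + √s * z) ∂axG := by
  rw [ax_mapeq m s hs, integral_map (by fun_prop) hF.aestronglyMeasurable]

lemma ax_mapintble (F : ℝ → ℝ) (hF : Continuous F) (m s : ℝ) (hs : 0 ≤ s) :
    Integrable F (gaussianReal m s.toNNReal) ↔ Integrable (fun z => F (m + √s * z)) axG := by
  rw [ax_mapeq m s hs, integrable_map_measure hF.aestronglyMeasurable (by fun_prop)]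
  rfl

/-- bounded times integrable -/
lemma ax_bdd (k w : ℝ → ℝ) (hk : Continuous k) (L : ℝ) (hL : ∀ z, |k z| ≤ L)
    (hw : Integrable w axG) (m r : ℝ) : Integrable (fun z => k (m + r * z) * w z) axG :=
  hw.bdd_mul (c := L) (by fun_prop) (ae_of_all _ fun z => hL _)

lemma ax_bddle (k w : ℝ → ℝ) (L : ℝ) (hL : ∀ z, |k z| ≤ L)
    (hw : Integrable w axG) (m r : ℝ) : |∫ z, k (m + r * z) * w z ∂axG| ≤ L * ∫ z, |w z| ∂axG := by
  rw [← integral_const_mul, ← Real.norm_eq_abs]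
  apply norm_integral_le_of_norm_le (hw.abs.const_mul _)
  refine ae_of_all _ fun z => ?_
  rw [norm_mul]
  exact mul_le_mul_of_nonneg_right (hL _) (norm_nonneg _)

lemma ax_lip (k k' : ℝ → ℝ) (hk : ∀ z, HasDerivAt k (k' z) z) (L : ℝ) (hL : ∀ z, |k' z| ≤ L) (x : ℝ) :
    |k x| ≤ |k 0| + L * |x| := by
  have := convex_univ.norm_image_sub_le_of_norm_hasDerivWithin_le (f := k) (f' := k') (C := L)
    (fun z _ => (hk z).hasDerivWithinAt) (fun z _ => hL z) (Set.mem_univ 0) (Set.mem_univ x)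
  simp only [Real.norm_eq_abs, sub_zero] at this
  have h2 := abs_sub_abs_le_abs_sub (k x) (k 0)
  linarith

lemma ax_lipint (k k' w : ℝ → ℝ) (hk : ∀ z, HasDerivAt k (k' z) z) (L : ℝ) (hL : ∀ z, |k' z| ≤ L)
    (hwc : Continuous w) (hw : Integrable w axG) (hzw : Integrable (fun z => z * w z) axG) (m r : ℝ) :
    Integrable (fun z => k (m + r * z) * w z) axG := by
  have hkc : Continuous k := continuous_iff_continuousAt.2 fun z => (hk z).continuousAt
  have hL0 : 0 ≤ L := (abs_nonneg _).trans (hL 0)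
  refine Integrable.mono' ((hw.abs.const_mul (|k 0| + L * |m|)).add (hzw.abs.const_mul (L * |r|)))
    (by fun_prop) (ae_of_all _ fun z => ?_)
  simp only [Pi.add_apply, norm_mul, Real.norm_eq_abs, abs_mul]
  have h1 := ax_lip k k' hk L hL (m + r * z)
  have h2 : |m + r * z| ≤ |m| + |r| * |z| := (abs_add_le _ _).trans (by rw [abs_mul])
  have h3 : |k (m + r * z)| ≤ |k 0| + L * |m| + L * |r| * |z| := by nlinarith
  nlinarith [abs_nonneg (w z)]

lemma ax_fd (k k' w : ℝ → ℝ) (hk : ∀ z, HasDerivAt k (k' z) z) (hk' : Continuous k')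
    (L : ℝ) (hL : ∀ z, |k' z| ≤ L)
    (hwc : Continuous w) (hw : Integrable w axG) (hzw : Integrable (fun z => z * w z) axG) (m r : ℝ) :
    HasFDerivAt (fun p : ℝ × ℝ => ∫ z, k (p.1 + p.2 * z) * w z ∂axG)
      ((∫ z, k' (m + r * z) * w z ∂axG) • ContinuousLinearMap.fst ℝ ℝ ℝ
        + (∫ z, k' (m + r * z) * (z * w z) ∂axG) • ContinuousLinearMap.snd ℝ ℝ ℝ) (m, r) := by
  have hkc : Continuous k := continuous_iff_continuousAt.2 fun z => (hk z).continuousAt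
  have hL0 : 0 ≤ L := (abs_nonneg _).trans (hL 0)
  have i1 : ∀ m r, Integrable (fun z => k' (m + r * z) * w z) axG := ax_bdd k' w hk' L hL hw
  have i2 : ∀ m r, Integrable (fun z => k' (m + r * z) * (z * w z)) axG := ax_bdd k' _ hk' L hL hzw
  let F' : ℝ × ℝ → ℝ → (ℝ × ℝ →L[ℝ] ℝ) := fun p z =>
    (k' (p.1 + p.2 * z) * w z) • ContinuousLinearMap.fst ℝ ℝ ℝ + (k' (p.1 + p.2 * z) * (z * w z)) • ContinuousLinearMap.snd ℝ ℝ ℝ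
  have key := hasFDerivAt_integral_of_dominated_of_fderiv_le (μ := axG) (𝕜 := ℝ) (F := fun (p : ℝ × ℝ) z => k (p.1 + p.2 * z) * w z)
    (F' := F') (x₀ := (m, r)) (s := Set.univ) (bound := fun z => L * |w z| + L * |z * w z|) Filter.univ_mem
    (Filter.Eventually.of_forall fun p => by fun_prop)
    (ax_lipint k k' w hk L hL hwc hw hzw m r)
    (by simp only [F']; exact ((i1 m r).smul_const (ContinuousLinearMap.fst ℝ ℝ ℝ)).aestronglyMeasurable.add ((i2 m r).smul_const (ContinuousLinearMap.snd ℝ ℝ ℝ)).aestronglyMeasurable)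
    (ae_of_all _ fun z p _ => by
      simp only [F']
      refine (norm_add_le _ _).trans ?_
      rw [norm_smul, norm_smul, norm_mul, norm_mul]
      have a1 := ContinuousLinearMap.norm_fst_le ℝ ℝ ℝ
      have a2 := ContinuousLinearMap.norm_snd_le ℝ ℝ ℝ
      have b := hL (p.1 + p.2 * z)
      simp only [Real.norm_eq_abs]
      have c1 : |k' (p.1 + p.2 * z)| * |w z| ≤ L * |w z| := mul_le_mul_of_nonneg_right b (abs_nonneg _)
      have c2 : |k' (p.1 + p.2 * z)| * |z * w z| ≤ L * |z * w z| := mul_le_mul_of_nonneg_right b (abs_nonneg _)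
      have d1 := mul_le_of_le_one_right (by positivity : 0 ≤ |k' (p.1 + p.2 * z)| * |w z|) a1
      have d2 := mul_le_of_le_one_right (by positivity : 0 ≤ |k' (p.1 + p.2 * z)| * |z * w z|) a2
      linarith)
    ((hw.abs.const_mul L).add (hzw.abs.const_mul L))
    (ae_of_all _ fun z p _ => by
      have e1 : HasFDerivAt (fun p : ℝ × ℝ => p.1 + p.2 * z)
          (ContinuousLinearMap.fst ℝ ℝ ℝ + z • ContinuousLinearMap.snd ℝ ℝ ℝ) p :=
        hasFDerivAt_fst.add (hasFDerivAt_snd.mul_const z)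
      have e2 := ((hk (p.1 + p.2 * z)).comp_hasFDerivAt p e1).mul_const (w z)
      refine e2.congr_fderiv ?_
      ext <;> simp [F'] <;> ring)
  refine key.congr_fderiv ?_
  simp only [F']
  rw [integral_add ((i1 m r).smul_const _) ((i2 m r).smul_const _), integral_smul_const, integral_smul_const]

lemma ax_fdm (k k' w : ℝ → ℝ) (hk : ∀ z, HasDerivAt k (k' z) z) (hk' : Continuous k')
    (L : ℝ) (hL : ∀ z, |k' z| ≤ L)
    (hwc : Continuous w) (hw : Integrable w axG) (hzw : Integrable (fun z => z * w z) axG) (m r : ℝ) :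
    HasDerivAt (fun m => ∫ z, k (m + r * z) * w z ∂axG) (∫ z, k' (m + r * z) * w z ∂axG) m := by
  have h1 : HasDerivAt (fun x : ℝ => (x, r)) ((1 : ℝ), (0 : ℝ)) m := (hasDerivAt_id' m).prodMk (hasDerivAt_const _ _)
  have := (ax_fd k k' w hk hk' L hL hwc hw hzw m r).comp_hasDerivAt m h1
  refine this.congr_deriv ?_
  simp

lemma ax_fdr (k k' w : ℝ → ℝ) (hk : ∀ z, HasDerivAt k (k' z) z) (hk' : Continuous k')
    (L : ℝ) (hL : ∀ z, |k' z| ≤ L)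
    (hwc : Continuous w) (hw : Integrable w axG) (hzw : Integrable (fun z => z * w z) axG) (m r : ℝ) :
    HasDerivAt (fun r => ∫ z, k (m + r * z) * w z ∂axG) (∫ z, k' (m + r * z) * (z * w z) ∂axG) r := by
  have h1 : HasDerivAt (fun x : ℝ => (m, x)) ((0 : ℝ), (1 : ℝ)) r := (hasDerivAt_const _ _).prodMk (hasDerivAt_id' r)
  have := (ax_fd k k' w hk hk' L hL hwc hw hzw m r).comp_hasDerivAt r h1
  refine this.congr_deriv ?_
  simp

lemma ax_one : Integrable (fun _ : ℝ => (1:ℝ)) axG := integrable_const _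
lemma ax_z : Integrable (fun z : ℝ => z) axG := by simpa using ax_poly 1
lemma ax_z2 : Integrable (fun z : ℝ => z * z) axG := by simpa [sq] using ax_poly 2
lemma ax_z21 : Integrable (fun z : ℝ => z ^ 2 - 1) axG := (ax_poly 2).sub ax_one

lemma ax_inner (k k' : ℝ → ℝ) (hk : ∀ z, HasDerivAt k (k' z) z) (m r z : ℝ) :
    HasDerivAt (fun z => k (m + r * z)) (r * k' (m + r * z)) z := by
  have h1 : HasDerivAt (fun z => m + r * z) r z := by
    simpa using ((hasDerivAt_id' z).const_mul r).const_add m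
  refine ((hk (m + r * z)).comp z h1).congr_deriv ?_
  ring

/-- Stein, first order. -/
lemma ax_st1 (k k' : ℝ → ℝ) (hk : ∀ z, HasDerivAt k (k' z) z) (m r : ℝ)
    (h0 : Integrable (fun z => k (m + r * z)) axG) (h1 : Integrable (fun z => k' (m + r * z)) axG)
    (h2 : Integrable (fun z => k (m + r * z) * z) axG) :
    ∫ z, k (m + r * z) * z ∂axG = r * ∫ z, k' (m + r * z) ∂axG := by
  rw [← ax_stein _ _ (ax_inner k k' hk m r) h0 (h1.const_mul r) h2, integral_const_mul]

/-- Stein, second order. -/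
lemma ax_st2 (k k' : ℝ → ℝ) (hk : ∀ z, HasDerivAt k (k' z) z) (L : ℝ) (hL : ∀ z, |k z| ≤ L) (m r : ℝ)
    (h1 : Integrable (fun z => k' (m + r * z) * z) axG) :
    r * ∫ z, k' (m + r * z) * z ∂axG = ∫ z, k (m + r * z) * (z ^ 2 - 1) ∂axG := by
  have hkc : Continuous k := continuous_iff_continuousAt.2 fun z => (hk z).continuousAt
  have hb : ∀ w, Integrable w axG → Integrable (fun z => k (m + r * z) * w z) axG :=
    fun w hw => ax_bdd k w hkc L hL hw m r
  have j0 : Integrable (fun z => k (m + r * z)) axG := by simpa using hb _ ax_one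
  have hd : ∀ z, HasDerivAt (fun z => k (m + r * z) * z) (r * (k' (m + r * z) * z) + k (m + r * z)) z := by
    intro z
    refine ((ax_inner k k' hk m r z).mul (hasDerivAt_id' z)).congr_deriv ?_
    ring
  have j2 : Integrable (fun z => k (m + r * z) * z * z) axG := by
    simpa [mul_assoc] using hb _ ax_z2
  have := ax_stein _ _ hd (hb _ ax_z) ((h1.const_mul r).add j0) j2
  rw [integral_add (h1.const_mul r) j0, integral_const_mul] at this
  rw [eq_sub_of_add_eq this, ← integral_sub j2 j0]
  congr 1; ext z; ring

/-- Multiplying by `z` preserves integrability if integrable at larger variance. -/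
lemma ax_mulz (F : ℝ → ℝ) (hF : Continuous F) (m s : ℝ) (hs : 0 < s)
    (h : ∀ σ2 : ℝ, 0 < σ2 → Integrable F (gaussianReal m σ2.toNNReal)) :
    Integrable (fun z => F (m + √s * z) * z) axG := by
  have h2 := h (2 * s) (by positivity)
  rw [ax_mapintble F hF m _ (by positivity), ax_gintble] at h2
  have hr : √(2 * s) = √2 * √s := Real.sqrt_mul (by norm_num) s
  have h3 := h2.comp_mul_left' (R := (√2)⁻¹) (by positivity)
  rw [ax_gintble]
  refine Integrable.mono' (h3.norm.const_mul 2) (by fun_prop) (ae_of_all _ fun z => ?_)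
  have e1 : m + √(2 * s) * ((√2)⁻¹ * z) = m + √s * z := by
    rw [hr]; field_simp
  have e2 : ((√2)⁻¹ * z) ^ 2 = z ^ 2 / 2 := by
    rw [mul_pow, inv_pow, Real.sq_sqrt (by norm_num)]; ring
  simp only [e1, e2, norm_mul, Real.norm_eq_abs, Real.abs_exp]
  have e3 : Real.exp (-(1/2) * z ^ 2) = Real.exp (-(1/2) * (z ^ 2 / 2)) * Real.exp (-(z ^ 2 / 4)) := by
    rw [← Real.exp_add]; ring_nf
  have e4 : |z| * Real.exp (-(z ^ 2 / 4)) ≤ 2 := by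
    have := Real.add_one_le_exp (z ^ 2 / 4)
    rw [Real.exp_neg, ← div_eq_mul_inv, div_le_iff₀ (Real.exp_pos _)]
    nlinarith [sq_abs z, sq_nonneg (|z| - 2)]
  rw [e3]
  have := mul_le_mul_of_nonneg_left e4 (by positivity : 0 ≤ |F (m + √s * z)| * Real.exp (-(1/2) * (z ^ 2 / 2)))
  nlinarith

lemma ax_quad (D s L₁ L₂ B C a t : ℝ) (hs : 0 < s) (hsD : s ≤ D) (hL₁ : 0 ≤ L₁) (hL₂ : 0 ≤ L₂)
    (hB : |B| ≤ L₁ / s) (hC : |C| ≤ L₂ / s) :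
    |a * t * B + t ^ 2 * C / 4| ≤ (D / 2 * L₂ + √(2 * D) / 2 * L₁) * (a ^ 2 / s + t ^ 2 / (2 * s ^ 2)) := by
  have hq : 0 ≤ a ^ 2 / s + t ^ 2 / (2 * s ^ 2) := by positivity
  have h1 : (s / 2 * L₂ + √(2 * s) / 2 * L₁) * (a ^ 2 / s + t ^ 2 / (2 * s ^ 2)) ≤
      (D / 2 * L₂ + √(2 * D) / 2 * L₁) * (a ^ 2 / s + t ^ 2 / (2 * s ^ 2)) := by
    apply mul_le_mul_of_nonneg_right _ hq
    have := Real.sqrt_le_sqrt (by linarith : 2 * s ≤ 2 * D)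
    gcongr
  refine le_trans ?_ h1
  have h2 : |a * t * B| ≤ (√(2 * s) / 2 * L₁) * (a ^ 2 / s + t ^ 2 / (2 * s ^ 2)) := by
    have e : |a * t| / s ≤ √(2 * s) / 2 * (a ^ 2 / s + t ^ 2 / (2 * s ^ 2)) := by
      have hr : 0 < √(2 * s) := by positivity
      have hr2 : √(2 * s) ^ 2 = 2 * s := Real.sq_sqrt (by positivity)
      set r := √(2 * s)
      have hs' : s = r ^ 2 / 2 := by linarith
      rw [hs', ← sub_nonneg]
      have : r / 2 * (a ^ 2 / (r ^ 2 / 2) + t ^ 2 / (2 * (r ^ 2 / 2) ^ 2)) - |a * t| / (r ^ 2 / 2)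
        = (r * |a| - |t|) ^ 2 / r ^ 3 := by
        rw [abs_mul, ← sq_abs a, ← sq_abs t]
        field_simp; ring
      rw [this]; positivity
    rw [abs_mul]
    calc |a * t| * |B| ≤ |a * t| * (L₁ / s) := by gcongr
      _ = L₁ * (|a * t| / s) := by ring
      _ ≤ L₁ * _ := mul_le_mul_of_nonneg_left e hL₁
      _ = _ := by ring
  have h3 : |t ^ 2 * C / 4| ≤ (s / 2 * L₂) * (a ^ 2 / s + t ^ 2 / (2 * s ^ 2)) := by
    rw [abs_div, abs_mul, abs_of_nonneg (sq_nonneg t), abs_of_pos (by norm_num : (0:ℝ) < 4)]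
    calc t ^ 2 * |C| / 4 ≤ t ^ 2 * (L₂ / s) / 4 := by gcongr
      _ = (s / 2 * L₂) * (t ^ 2 / (2 * s ^ 2)) := by field_simp; ring
      _ ≤ _ := by
        apply mul_le_mul_of_nonneg_left _ (by positivity)
        have : 0 ≤ a ^ 2 / s := by positivity
        linarith
  have := abs_add_le (a * t * B) (t ^ 2 * C / 4)
  nlinarith

lemma ax_psd (M : Matrix (Fin 2) (Fin 2) ℝ) (hM : M 0 1 = M 1 0)
    (h : ∀ a b : ℝ, 0 ≤ M 0 0 * a ^ 2 + 2 * M 0 1 * a * b + M 1 1 * b ^ 2) : M.PosSemidef := by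
  refine Matrix.PosSemidef.of_dotProduct_mulVec_nonneg ?_ ?_
  · ext i j
    fin_cases i <;> fin_cases j <;> simp [hM]
  · intro x
    have := h (x 0) (x 1)
    simp [Matrix.mulVec, dotProduct, Fin.sum_univ_two]
    rw [← hM]
    refine this.trans_eq ?_
    ring

lemma ax_part1 (f : ℝ → ℝ) (hf : ContDiff ℝ 4 f)
    (L₁ L₂ : ℝ) (hL₁ : 0 ≤ L₁) (hL₂ : 0 ≤ L₂)
    (hd1 : ∀ z : ℝ, |deriv f z| ≤ L₁)
    (hd2 : ∀ z : ℝ, |iteratedDeriv 2 f z| ≤ L₂)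
    (hint3 : ∀ (μ σ2 : ℝ), 0 < σ2 →
      Integrable (iteratedDeriv 3 f) (gaussianReal μ σ2.toNNReal))
    (hint4 : ∀ (μ σ2 : ℝ), 0 < σ2 →
      Integrable (iteratedDeriv 4 f) (gaussianReal μ σ2.toNNReal))
    (D : ℝ) (μ σ2 : ℝ) (hs : 0 < σ2) (hsD : σ2 ≤ D) :
      (Mmat (D / 2 * L₂ + Real.sqrt (2 * D) / 2 * L₁) μ σ2
          (Bexp f μ σ2) (Cexp f μ σ2)).PosSemidef ∧
      (Nmat (-(D / 2 * L₂ + Real.sqrt (2 * D) / 2 * L₁)) μ σ2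
          (Bexp f μ σ2) (Cexp f μ σ2)).PosSemidef := by
  have hder : ∀ n : ℕ, n < 4 → ∀ z, HasDerivAt (iteratedDeriv n f) (iteratedDeriv (n+1) f z) z := by
    intro n hn z
    rw [iteratedDeriv_succ]
    exact ((hf.differentiable_iteratedDeriv n (by exact_mod_cast hn)) z).hasDerivAt
  have hcont : ∀ n : ℕ, n ≤ 4 → Continuous (iteratedDeriv n f) := by
    intro n hn
    exact hf.continuous_iteratedDeriv n (by exact_mod_cast hn)
  have hd1' : ∀ z, |iteratedDeriv 1 f z| ≤ L₁ := by simpa [iteratedDeriv_one] using hd1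
  have hr : 0 < √σ2 := Real.sqrt_pos.2 hs
  have hrr : √σ2 * √σ2 = σ2 := Real.mul_self_sqrt hs.le
  set r := √σ2 with hrdef
  have i2 : ∀ w, Integrable w axG → Integrable (fun z => iteratedDeriv 2 f (μ + r * z) * w z) axG :=
    fun w hw => ax_bdd _ w (hcont 2 (by norm_num)) L₂ hd2 hw μ r
  have i20 : Integrable (fun z => iteratedDeriv 2 f (μ + r * z)) axG := by simpa using i2 _ ax_one
  have i3 : Integrable (fun z => iteratedDeriv 3 f (μ + r * z)) axG :=
    (ax_mapintble _ (hcont 3 (by norm_num)) μ σ2 hs.le).1 (hint3 μ σ2 hs)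
  have i4 : Integrable (fun z => iteratedDeriv 4 f (μ + r * z)) axG :=
    (ax_mapintble _ (hcont 4 (by norm_num)) μ σ2 hs.le).1 (hint4 μ σ2 hs)
  have i3z : Integrable (fun z => iteratedDeriv 3 f (μ + r * z) * z) axG :=
    ax_mulz _ (hcont 3 (by norm_num)) μ σ2 hs (fun s hs => hint3 μ s hs)
  have b1 := ax_st1 _ _ (hder 2 (by norm_num)) μ r i20 i3 (i2 _ ax_z)
  have b2 := ax_st2 _ _ (hder 1 (by norm_num)) L₁ hd1' μ r (i2 _ ax_z)
  have c1 := ax_st1 _ _ (hder 3 (by norm_num)) μ r i3 i4 i3z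
  have c2 := ax_st2 _ _ (hder 2 (by norm_num)) L₂ hd2 μ r i3z
  have b3 := ax_bddle (iteratedDeriv 1 f) _ L₁ hd1' ax_z21 μ r
  have c3 := ax_bddle (iteratedDeriv 2 f) _ L₂ hd2 ax_z21 μ r
  have hBe : Bexp f μ σ2 = ∫ z, iteratedDeriv 3 f (μ + r * z) ∂axG :=
    ax_mapint _ (hcont 3 (by norm_num)) μ σ2 hs.le
  have hCe : Cexp f μ σ2 = ∫ z, iteratedDeriv 4 f (μ + r * z) ∂axG :=
    ax_mapint _ (hcont 4 (by norm_num)) μ σ2 hs.le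
  norm_num at b1 b2 c1 c2
  rw [iteratedDeriv_one] at b3
  have hB : |Bexp f μ σ2| ≤ L₁ / σ2 := by
    rw [hBe, le_div_iff₀ hs]
    have e : |∫ z, iteratedDeriv 3 f (μ + r * z) ∂axG| * σ2 = |r * (r * ∫ z, iteratedDeriv 3 f (μ + r * z) ∂axG)| := by
      rw [← mul_assoc, abs_mul, hrr, abs_of_pos hs, mul_comm]
    rw [e, ← b1, b2]
    exact b3.trans (mul_le_of_le_one_right hL₁ ax_EZ2)
  have hC : |Cexp f μ σ2| ≤ L₂ / σ2 := by
    rw [hCe, le_div_iff₀ hs]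
    have e : |∫ z, iteratedDeriv 4 f (μ + r * z) ∂axG| * σ2 = |r * (r * ∫ z, iteratedDeriv 4 f (μ + r * z) ∂axG)| := by
      rw [← mul_assoc, abs_mul, hrr, abs_of_pos hs, mul_comm]
    rw [e, ← c1, c2]
    exact c3.trans (mul_le_of_le_one_right hL₂ ax_EZ2)
  generalize Bexp f μ σ2 = B at *
  generalize Cexp f μ σ2 = C at *
  have q := fun a t => ax_quad D σ2 L₁ L₂ B C a t hs hsD hL₁ hL₂ hB hC
  generalize D / 2 * L₂ + √(2 * D) / 2 * L₁ = β at *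
  constructor
  · apply ax_psd
    · simp [Mmat]
    · intro a b
      have := (abs_le.1 (q a (b - 2 * μ * a))).2
      simp [Mmat]
      refine (sub_nonneg.2 this).trans_eq ?_
      field_simp; ring
  · apply ax_psd
    · simp [Nmat]
    · intro a b
      have := (abs_le.1 (q a (b - 2 * μ * a))).1
      simp [Nmat]
      refine (sub_nonneg.2 this).trans_eq ?_
      field_simp; ring

lemma ax_key (d l R X : ℝ) (hd : 15/8 ≤ d) (hl : 0 ≤ l)
    (ha : R ≤ 2/15 * d ^ 3)
    (hb1 : 5/2 ≤ d → R ≤ d ^ 2 - 5/2 * d + 25/12)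
    (hbp : 5/2 * (193/1000 + 532/1000 * l) ≤ d → R ≤ (193/1000 + 532/1000 * l) * d ^ 2 - 5/2 * (193/1000 + 532/1000 * l)^2 * d + 25/12 * (193/1000 + 532/1000 * l)^3)
    (hc1 : 2 * l ≤ d → R ≤ 2 * l * d - 2 * l ^ 2 + 1/2 * d ^ 2)
    (hcp : 2 * l ≤ d → R ≤ 2 * l * d - 2 * l ^ 2 + 1/2 * (193/1000 + 532/1000 * l) * d ^ 2)
    (hX1 : X ≤ l * (1/2 * d - 17675/100000))
    (hX2 : X ≤ 193/1000 + 35525/100000 * l)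
    (hX3 : X ≤ 1) : R + X ≤ 1/4 * d ^ 2 + 3535/10000 * l * d ^ 2 := by
  rcases le_total (22/10) l with h1 | h1
  · have hm : 1/4 * d ^ 2 + 3535/10000 * (22/10) * d ^ 2 ≤ 1/4 * d ^ 2 + 3535/10000 * l * d ^ 2 := by
      nlinarith [sq_nonneg d]
    refine le_trans ?_ hm
    rcases le_total d (5/2) with h2 | h2
    · nlinarith [mul_nonneg (sub_nonneg.2 hd) (sub_nonneg.2 h2), sq_nonneg d]
    · have := hb1 h2
      nlinarith [sq_nonneg (d - 5/2)]
  rcases le_total (16/10) l with h2 | h2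
  · have hm : 1/4 * d ^ 2 + 3535/10000 * (16/10) * d ^ 2 ≤ 1/4 * d ^ 2 + 3535/10000 * l * d ^ 2 := by
      nlinarith [sq_nonneg d]
    rcases le_total d (5/2) with h3 | h3
    · refine le_trans ?_ hm
      nlinarith [mul_nonneg (sub_nonneg.2 hd) (sub_nonneg.2 h3), sq_nonneg d]
    rcases le_total d 12 with h4 | h4
    · refine le_trans ?_ hm
      have := hb1 h3
      nlinarith [mul_nonneg (sub_nonneg.2 h3) (sub_nonneg.2 h4)]
    · have := hc1 (by linarith)
      nlinarith [mul_nonneg (sub_nonneg.2 h4) (sub_nonneg.2 h4), mul_nonneg (sub_nonneg.2 h4) (sub_nonneg.2 h2), mul_nonneg (mul_nonneg (sub_nonneg.2 h4) (sub_nonneg.2 h4)) (sub_nonneg.2 h2)]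
  rcases le_total d (5/2 * (193/1000 + 532/1000 * l)) with h3 | h3
  · have hl1 : 104/100 ≤ l := by linarith
    have hd2 : d ≤ 2.62 := by norm_num; linarith
    nlinarith [mul_nonneg (sub_nonneg.2 hd) (sub_nonneg.2 hd2), mul_nonneg (mul_nonneg (sub_nonneg.2 hd) (sub_nonneg.2 hd2)) (by linarith : 0 ≤ d), mul_nonneg (sub_nonneg.2 hd) (sub_nonneg.2 hl1), mul_nonneg (sub_nonneg.2 hd2) (sub_nonneg.2 hl1), mul_nonneg (mul_nonneg (sub_nonneg.2 hd) (sub_nonneg.2 hl1)) (by linarith : 0 ≤ d)]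
  rcases le_total d (55/10 + 3 * l) with h4 | h4
  · have hR := hbp h3
    have q1 : 0 ≤ (57/1000 - 1785/10000 * l) * (15/8) ^ 2 + 5/2 * (193/1000 + 532/1000 * l)^2 * (15/8) - 25/12 * (193/1000 + 532/1000 * l)^3 - 193/1000 - 35525/100000 * l := by
      nlinarith [mul_nonneg hl (sub_nonneg.2 h2), mul_nonneg (mul_nonneg hl (sub_nonneg.2 h2)) hl, sq_nonneg (l - 76/1000), mul_nonneg (sq_nonneg (l - 76/1000)) (sub_nonneg.2 h2)]
    suffices h : 0 ≤ (57/1000 - 1785/10000 * l) * d ^ 2 + 5/2 * (193/1000 + 532/1000 * l)^2 * d - 25/12 * (193/1000 + 532/1000 * l)^3 - 193/1000 - 35525/100000 * l by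
      linarith
    rcases le_total l (57/178.5) with h5 | h5
    · have ha0 : 0 ≤ 57/1000 - 1785/10000 * l := by norm_num at h5; linarith
      have : (57/1000 - 1785/10000 * l) * (15/8) ^ 2 ≤ (57/1000 - 1785/10000 * l) * d ^ 2 := by gcongr
      have : 5/2 * (193/1000 + 532/1000 * l)^2 * (15/8) ≤ 5/2 * (193/1000 + 532/1000 * l)^2 * d := by gcongr
      linarith
    · have ha0 : 0 ≤ -(57/1000 - 1785/10000 * l) := by norm_num at h5; linarith
      have q2 : 0 ≤ (57/1000 - 1785/10000 * l) * (55/10 + 3 * l) ^ 2 + 5/2 * (193/1000 + 532/1000 * l)^2 * (55/10 + 3 * l) - 25/12 * (193/1000 + 532/1000 * l)^3 - 193/1000 - 35525/100000 * l := by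
        nlinarith [mul_nonneg hl (sub_nonneg.2 h2), mul_nonneg (mul_nonneg hl (sub_nonneg.2 h2)) hl, sq_nonneg (l - 1), mul_nonneg (sq_nonneg (l - 1)) (sub_nonneg.2 h2)]
      generalize 57/1000 - 1785/10000 * l = a at *
      generalize 5/2 * (193/1000 + 532/1000 * l)^2 = b at *
      generalize 25/12 * (193/1000 + 532/1000 * l)^3 = c at *
      have hu : 0 < 55/10 + 3 * l - 15/8 := by linarith
      generalize 55/10 + 3 * l = u at *
      have e1 := mul_nonneg q1 (sub_nonneg.2 h4)
      have e2 := mul_nonneg q2 (sub_nonneg.2 hd)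
      have e3 := mul_nonneg (mul_nonneg ha0 hu.le) (mul_nonneg (sub_nonneg.2 h4) (sub_nonneg.2 hd))
      refine nonneg_of_mul_nonneg_left ?_ hu
      nlinarith
  · have hR := hcp (by linarith)
    suffices h : 0 ≤ (1535/10000 + 875/10000 * l) * d ^ 2 - 2 * l * d + 2 * l ^ 2 - 193/1000 - 35525/100000 * l by
      linarith
    have q1 : 0 ≤ (1535/10000 + 875/10000 * l) * (55/10 + 3 * l) ^ 2 - 2 * l * (55/10 + 3 * l) + 2 * l ^ 2 - 193/1000 - 35525/100000 * l := by
      nlinarith [mul_nonneg hl (sub_nonneg.2 h2), mul_nonneg (mul_nonneg hl (sub_nonneg.2 h2)) hl, sq_nonneg (l - 1.1), mul_nonneg (sq_nonneg (l - 1.1)) hl]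
    have q2 : 0 ≤ (1535/10000 + 875/10000 * l) * (2 * (55/10 + 3 * l)) - 2 * l := by nlinarith
    have e1 := mul_nonneg q2 (sub_nonneg.2 h4)
    have e2 := mul_nonneg (by linarith : 0 ≤ (1535/10000 + 875/10000 * l)) (sq_nonneg (d - (55/10 + 3 * l)))
    nlinarith

lemma ax_mono (φ φ' : ℝ → ℝ) (h : ∀ t, HasDerivAt φ (φ' t) t) (a x : ℝ) (hx : a ≤ x)
    (h' : ∀ t, a ≤ t → φ' t ≤ 0) : φ x ≤ φ a := by
  have := antitoneOn_of_deriv_nonpos (D := Set.Ici a) (f := φ) (convex_Ici a)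
    (fun t _ => (h t).continuousAt.continuousWithinAt)
    (fun t _ => (h t).differentiableAt.differentiableWithinAt)
    (fun t ht => by
      rw [interior_Ici] at ht
      rw [(h t).deriv]; exact h' t (le_of_lt ht))
  exact this (Set.mem_Ici.2 le_rfl) (Set.mem_Ici.2 hx) hx

lemma ax_mono2 (φ φ' φ'' : ℝ → ℝ) (h : ∀ t, HasDerivAt φ (φ' t) t) (h1 : ∀ t, HasDerivAt φ' (φ'' t) t)
    (a x : ℝ) (hx : a ≤ x)
    (h0 : φ a ≤ 0) (h0' : φ' a ≤ 0) (h' : ∀ t, a ≤ t → φ'' t ≤ 0) : φ x ≤ 0 :=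
  (ax_mono φ φ' h a x hx fun t ht => (ax_mono φ' φ'' h1 a t ht h').trans h0').trans h0

lemma ax_lipd (φ φ' : ℝ → ℝ) (h : ∀ t, HasDerivAt φ (φ' t) t) (L : ℝ) (hL : ∀ t, |φ' t| ≤ L) (x : ℝ) (hx : 0 ≤ x) :
    |φ x - φ 0| ≤ L * x := by
  have := convex_univ.norm_image_sub_le_of_norm_hasDerivWithin_le (f := φ) (f' := φ') (C := L)
    (fun z _ => (h z).hasDerivWithinAt) (fun z _ => hL z) (Set.mem_univ 0) (Set.mem_univ x)
  simpa [Real.norm_eq_abs, abs_of_nonneg hx] using this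

lemma ax_logs (s y : ℝ) (hs : 0 < s) (hy : 0 < y) (h1 : 2 ≤ y ^ 2) (h2 : 2 * s ≤ y ^ 2) :
    (s - 1) ^ 2 / y ^ 2 ≤ s - 1 - Real.log s := by
  rcases le_total 1 s with h | h
  · have e1 : (s - 1) ^ 2 / y ^ 2 ≤ (s - 1) ^ 2 / (2 * s) := by gcongr
    refine e1.trans ?_
    have e2 := Real.self_le_sinh_iff.2 (Real.log_nonneg h)
    rw [Real.sinh_eq, Real.exp_neg, Real.exp_log hs] at e2
    have : (s - 1) ^ 2 / (2 * s) = s - 1 - (s - s⁻¹) / 2 := by field_simp; ring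
    linarith
  · have e1 : (s - 1) ^ 2 / y ^ 2 ≤ (s - 1) ^ 2 / 2 := by gcongr
    refine e1.trans ?_
    have hd : ∀ t ∈ Set.Ioo (0:ℝ) 1, deriv (fun t => t - 1 - Real.log t - (t - 1) ^ 2 / 2) t ≤ 0 := by
      intro t ht
      have h3 : HasDerivAt (fun t => t - 1 - Real.log t - (t - 1) ^ 2 / 2) (1 - t⁻¹ - (2 * (t - 1)) / 2) t := by
        have a := ((hasDerivAt_id' t).sub_const 1)
        have b := (a.pow 2).div_const 2
        refine ((a.sub (Real.hasDerivAt_log ht.1.ne')).sub b).congr_deriv ?_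
        norm_num
      rw [h3.deriv]
      have : 1 - t⁻¹ - (2 * (t - 1)) / 2 = -((1 - t) ^ 2 / t) := by
        have := ht.1.ne'
        field_simp; ring
      rw [this]
      have := ht.1
      exact neg_nonpos.2 (by positivity)
    have hc : ContinuousOn (fun t : ℝ => t - 1 - Real.log t - (t - 1) ^ 2 / 2) (Set.Ioc 0 1) := by
      intro t ht
      have := ht.1.ne'
      exact ContinuousAt.continuousWithinAt (by fun_prop (disch := assumption))
    have ha := antitoneOn_of_deriv_nonpos (D := Set.Ioc (0:ℝ) 1) (convex_Ioc 0 1) hc (by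
        rw [interior_Ioc]
        intro t ht
        have := ht.1.ne'
        exact DifferentiableAt.differentiableWithinAt (by fun_prop (disch := assumption)))
      (by rw [interior_Ioc]; exact hd)
    have := ha (Set.mem_Ioc.2 ⟨hs, h⟩) (Set.mem_Ioc.2 ⟨one_pos, le_rfl⟩) h
    norm_num at this
    linarith

lemma ax_numN2 (l d s D R H : ℝ) (hl : 0 ≤ l) (hd : 0 ≤ d) (hs : 0 < s) (hD1 : 1 ≤ D) (hDs : s ≤ D)
    (hRa : R ≤ 2/15 * d ^ 3) (H8 : |H| ≤ 4/5 * d) (Hl : |H| ≤ l * d) (H2 : |H| ≤ 2)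
    (H2p : |H| ≤ 2 * (193/1000 + 532/1000 * l))
    (key : ∀ X, 15/8 ≤ d → X ≤ l * (1/2 * d - 17675/100000) → X ≤ 193/1000 + 35525/100000 * l → X ≤ 1 →
      R + X ≤ 1/4 * d ^ 2 + 3535/10000 * l * d ^ 2) :
    R + 1/2 * (s - 1) * H ≤
      D / 4 * d ^ 2 + √(2 * D) / 4 * l * (s - 1 - Real.log s + d ^ 2) := by
  set k := s - 1 - Real.log s with hk
  have hyD : 0 < √(2 * D) := by positivity
  have hyD2 : √(2 * D) ^ 2 = 2 * D := Real.sq_sqrt (by positivity)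
  have hy1 : 1414/1000 ≤ √(2 * D) := Real.le_sqrt_of_sq_le (by nlinarith)
  have hkl := ax_logs s (√(2 * D)) hs hyD (by linarith) (by linarith)
  rw [← hk] at hkl
  have hk0 : 0 ≤ k := le_trans (by positivity) hkl
  have hdd : 0 ≤ l * d ^ 2 := by positivity
  have hlk : 0 ≤ l * k := by positivity
  rcases le_total d (15/8) with h | h
  · have r1 : R ≤ D / 4 * d ^ 2 := by nlinarith [mul_nonneg (mul_nonneg hd hd) (sub_nonneg.2 h), mul_nonneg hd hd]
    have r2 : 1/2 * (s - 1) * H ≤ 1/2 * |s - 1| * (l * d) := by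
      calc 1/2 * (s - 1) * H ≤ |1/2 * (s - 1) * H| := le_abs_self _
        _ = 1/2 * |s - 1| * |H| := by rw [abs_mul, abs_mul]; norm_num
        _ ≤ _ := by gcongr
    have r3 : 1/2 * |s - 1| * d ≤ √(2 * D) / 4 * (k + d ^ 2) := by
      have : √(2 * D) / 4 * ((s - 1) ^ 2 / √(2 * D) ^ 2 + d ^ 2) - 1/2 * |s - 1| * d = √(2 * D) / 4 * (|s - 1| / √(2 * D) - d) ^ 2 := by
        rw [← sq_abs (s - 1)]
        field_simp; ring
      have q : 0 ≤ √(2 * D) / 4 * (|s - 1| / √(2 * D) - d) ^ 2 := by positivity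
      have q2 : √(2 * D) / 4 * ((s - 1) ^ 2 / √(2 * D) ^ 2 + d ^ 2) ≤ √(2 * D) / 4 * (k + d ^ 2) := by gcongr
      linarith
    have r4 := mul_le_mul_of_nonneg_left r3 hl
    linarith
  have hmain : 3535/10000 * l * (k + d ^ 2) ≤ √(2 * D) / 4 * l * (k + d ^ 2) := by
    have : 0 ≤ l * (k + d ^ 2) := by positivity
    have := mul_le_mul_of_nonneg_right (by linarith : 3535/10000 ≤ √(2 * D) / 4) this
    linarith
  have hHd := abs_le.1 H8
  rcases le_total 1 s with h1 | h1
  · have r := key 0 h (by nlinarith) (by linarith) (by norm_num)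
    have c : 1/2 * (s - 1) * H ≤ 1/4 * (s - 1) * d ^ 2 := by
      have c1 : (s - 1) * H ≤ (s - 1) * (4/5 * d) := mul_le_mul_of_nonneg_left hHd.2 (by linarith)
      have c2 : (s - 1) * (4/5 * d) ≤ (s - 1) * (1/2 * d ^ 2) := mul_le_mul_of_nonneg_left (by nlinarith) (by linarith)
      linarith
    have c3 : s / 4 * d ^ 2 ≤ D / 4 * d ^ 2 := by gcongr
    linarith
  · have hk2 : (1 - s) ^ 2 / 2 ≤ k := by
      have := ax_logs s (√2) hs (by positivity) (by norm_num) (by norm_num; linarith)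
      norm_num at this
      rw [hk]; linarith [sq_nonneg (s - 1), (by ring : (1 - s) ^ 2 = (s - 1) ^ 2)]
    have hn0 : 0 ≤ 1 - s := by linarith
    have hn1 : 1 - s ≤ 1 := by linarith
    have hXe : 1/2 * (s - 1) * H = 1/2 * (1 - s) * (-H) := by ring
    generalize 1 - s = n at *
    have hl' := (abs_le.1 Hl).1
    have hH2 : -H ≤ 2 := by linarith [(abs_le.1 H2).1]
    have hH2p : -H ≤ 2 * (193/1000 + 532/1000 * l) := by linarith [(abs_le.1 H2p).1]
    have r := key (1/2 * n * (-H) - 3535/10000 * l * (n ^ 2 / 2)) h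
      (by
        have : 1/2 * n * (-H) ≤ 1/2 * n * (l * d) := by gcongr; linarith
        have : 0 ≤ (1 - n) * (1/2 * d - 17675/100000 * (1 + n)) := mul_nonneg (by linarith) (by linarith)
        have := mul_nonneg hl this
        linarith)
      (by
        have : 1/2 * n * (-H) ≤ 1/2 * n * (2 * (193/1000 + 532/1000 * l)) := by gcongr
        have : 0 ≤ (1 - n) * ((193/1000 + 532/1000 * l) - 17675/100000 * (1 + n) * l) := mul_nonneg (by linarith) (by linarith [mul_le_mul_of_nonneg_left hn1 hl])
        linarith)
      (by
        have : 1/2 * n * (-H) ≤ 1/2 * n * 2 := by gcongr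
        have : 0 ≤ l * n ^ 2 := by positivity
        linarith)
    have c3 : 1 / 4 * d ^ 2 ≤ D / 4 * d ^ 2 := by gcongr
    have c4 := mul_le_mul_of_nonneg_left hk2 hl
    rw [hXe]
    linarith

lemma ax_numN (g g1 g2 g3 : ℝ → ℝ) (e0 : ∀ t, HasDerivAt g (g1 t) t) (e1 : ∀ t, HasDerivAt g1 (g2 t) t)
    (e2 : ∀ t, HasDerivAt g2 (g3 t) t) (l : ℝ) (hg1 : ∀ t, |g1 t| ≤ l) (hg2 : ∀ t, |g2 t| ≤ 1)
    (hg2p : ∀ t, |g2 t| ≤ 193/1000 + 532/1000 * l) (hg3 : ∀ t, |g3 t| ≤ 4/5) (hg3l : ∀ t, |g3 t| ≤ l)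
    (d s D : ℝ) (hd : 0 ≤ d) (hs : 0 < s) (hD1 : 1 ≤ D) (hDs : s ≤ D) :
    g d - g 0 - g1 0 * d - 1/2 * g2 0 * d ^ 2 + 1/2 * (s - 1) * (g2 d - g2 0) ≤
      D / 4 * d ^ 2 + √(2 * D) / 4 * l * (s - 1 - Real.log s + d ^ 2) := by
  have hl : 0 ≤ l := (abs_nonneg _).trans (hg1 0)
  have H8 := ax_lipd g2 g3 e2 (4/5) hg3
  have Hl := ax_lipd g2 g3 e2 l hg3l d hd
  have ta1 : ∀ x, 0 ≤ x → g1 x - g1 0 - g2 0 * x - 2/5 * x ^ 2 ≤ 0 := by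
    intro x hx
    have hder : ∀ t, HasDerivAt (fun t => g1 t - g1 0 - g2 0 * t - 2/5 * t ^ 2) (g2 t - g2 0 - 4/5 * t) t := by
      intro t
      refine ((((e1 t).sub_const (g1 0)).sub ((hasDerivAt_id' t).const_mul (g2 0))).sub
        ((hasDerivAt_pow 2 t).const_mul (2/5))).congr_deriv ?_
      norm_num; ring
    have := ax_mono _ _ hder 0 x hx (fun t ht => by have := (abs_le.1 (H8 t ht)).2; linarith)
    norm_num at this ⊢
    linarith
  have ta : ∀ x, 0 ≤ x → g x - g 0 - g1 0 * x - 1/2 * g2 0 * x ^ 2 - 2/15 * x ^ 3 ≤ 0 := by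
    intro x hx
    have hder : ∀ t, HasDerivAt (fun t => g t - g 0 - g1 0 * t - 1/2 * g2 0 * t ^ 2 - 2/15 * t ^ 3)
        (g1 t - g1 0 - g2 0 * t - 2/5 * t ^ 2) t := by
      intro t
      refine (((((e0 t).sub_const (g 0)).sub ((hasDerivAt_id' t).const_mul (g1 0))).sub
        ((hasDerivAt_pow 2 t).const_mul (1/2 * g2 0))).sub ((hasDerivAt_pow 3 t).const_mul (2/15))).congr_deriv ?_
      norm_num; ring
    have := ax_mono _ _ hder 0 x hx (fun t ht => ta1 t ht)
    norm_num at this ⊢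
    linarith
  have tb : ∀ P, 0 ≤ P → (∀ t, |g2 t| ≤ P) → ∀ x, 5/2 * P ≤ x →
      g x - g 0 - g1 0 * x - 1/2 * g2 0 * x ^ 2 ≤ P * x ^ 2 - 5/2 * P ^ 2 * x + 25/12 * P ^ 3 := by
    intro P hP hgP x hx
    have hder1 : ∀ t, HasDerivAt (fun t => g1 t - g1 0 - g2 0 * t - (2 * P * t - 5/2 * P ^ 2))
        (g2 t - g2 0 - 2 * P) t := by
      intro t
      refine ((((e1 t).sub_const (g1 0)).sub ((hasDerivAt_id' t).const_mul (g2 0))).sub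
        (((hasDerivAt_id' t).const_mul (2 * P)).sub_const (5/2 * P ^ 2))).congr_deriv ?_
      norm_num
    have hder : ∀ t, HasDerivAt (fun t => g t - g 0 - g1 0 * t - 1/2 * g2 0 * t ^ 2 - (P * t ^ 2 - 5/2 * P ^ 2 * t + 25/12 * P ^ 3))
        (g1 t - g1 0 - g2 0 * t - (2 * P * t - 5/2 * P ^ 2)) t := by
      intro t
      refine (((((e0 t).sub_const (g 0)).sub ((hasDerivAt_id' t).const_mul (g1 0))).sub
        ((hasDerivAt_pow 2 t).const_mul (1/2 * g2 0))).sub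
        ((((hasDerivAt_pow 2 t).const_mul P).sub ((hasDerivAt_id' t).const_mul (5/2 * P ^ 2))).add_const (25/12 * P ^ 3))).congr_deriv ?_
      norm_num; ring
    have := ax_mono2 _ _ _ hder hder1 (5/2 * P) x hx
      (by have := ta (5/2 * P) (by positivity); nlinarith)
      (by have := ta1 (5/2 * P) (by positivity); nlinarith)
      (fun t ht => by
        have a := (abs_le.1 (hgP t)).2
        have b := (abs_le.1 (hgP 0)).1
        linarith)
    linarith
  have tc : ∀ x, 2 * l ≤ x → g x - g 0 - g1 0 * x ≤ 2 * l * x - 2 * l ^ 2 := by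
    intro x hx
    have hq1 : ∀ t, HasDerivAt (fun t => g1 t - g1 0 - t) (g2 t - 1) t := fun t =>
      ((e1 t).sub_const (g1 0)).sub (hasDerivAt_id' t)
    have hq0 : ∀ t, HasDerivAt (fun t => g t - g 0 - g1 0 * t - 1/2 * t ^ 2) (g1 t - g1 0 - t) t := by
      intro t
      refine ((((e0 t).sub_const (g 0)).sub ((hasDerivAt_id' t).const_mul (g1 0))).sub
        ((hasDerivAt_pow 2 t).const_mul (1/2))).congr_deriv ?_
      norm_num; ring
    have a1 := ax_mono2 _ _ _ hq0 hq1 0 (2 * l) (by positivity) (by simp) (by simp)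
      (fun t _ => by have := (abs_le.1 (hg2 t)).2; linarith)
    have hder : ∀ t, HasDerivAt (fun t => g t - g 0 - g1 0 * t - 2 * l * t) (g1 t - g1 0 - 2 * l) t := by
      intro t
      refine ((((e0 t).sub_const (g 0)).sub ((hasDerivAt_id' t).const_mul (g1 0))).sub
        ((hasDerivAt_id' t).const_mul (2 * l))).congr_deriv ?_
      norm_num
    have := ax_mono _ _ hder (2 * l) x hx (fun t _ => by
        have a := (abs_le.1 (hg1 t)).2
        have b := (abs_le.1 (hg1 0)).1
        linarith)
    nlinarith
  have hp0 : 0 ≤ 193/1000 + 532/1000 * l := by linarith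
  have hab : ∀ P, (∀ t, |g2 t| ≤ P) → |g2 d - g2 0| ≤ 2 * P := fun P h => by
    have := abs_sub (g2 d) (g2 0)
    linarith [h d, h 0]
  have hRa : g d - g 0 - g1 0 * d - 1/2 * g2 0 * d ^ 2 ≤ 2/15 * d ^ 3 := by have := ta d hd; linarith
  refine ax_numN2 l d s D _ _ hl hd hs hD1 hDs hRa (H8 d hd) Hl (by simpa using hab 1 hg2) (hab _ hg2p) ?_
  intro X hd' x1 x2 x3
  refine ax_key d l _ X hd' hl hRa ?_ ?_ ?_ ?_ x1 x2 x3
  · intro h; have := tb 1 (by norm_num) hg2 d (by linarith); linarith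
  · intro h; exact tb _ hp0 hg2p d h
  · intro h; have := tc d h; nlinarith [abs_le.1 (hg2 0), sq_nonneg d]
  · intro h; have := tc d h; nlinarith [abs_le.1 (hg2p 0), sq_nonneg d]

/-- Bundle of the hypotheses on `f` used for the second part. -/
structure AxF (f0 f1 f2 : ℝ → ℝ) (L₁ L₂ : ℝ) : Prop where
  h0 : ∀ z, HasDerivAt f0 (f1 z) z
  h1 : ∀ z, HasDerivAt f1 (f2 z) z
  hc : Continuous f2
  b1 : ∀ z, |f1 z| ≤ L₁
  b2 : ∀ z, |f2 z| ≤ L₂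

def axW (k : ℝ → ℝ) (m r : ℝ) : ℝ := ∫ z, k (m + r * z) ∂axG
def axV (k : ℝ → ℝ) (m r : ℝ) : ℝ := ∫ z, k (m + r * z) * z ∂axG
def axQ (k : ℝ → ℝ) (m r : ℝ) : ℝ := ∫ z, k (m + r * z) * (z ^ 2 - 1) ∂axG

lemma AxF.c1 {f0 f1 f2 : ℝ → ℝ} {L₁ L₂ : ℝ} (h : AxF f0 f1 f2 L₁ L₂) : Continuous f1 :=
  continuous_iff_continuousAt.2 fun z => (h.h1 z).continuousAt

lemma axWV (k : ℝ → ℝ) (m r : ℝ) : axW k m r = ∫ z, k (m + r * z) * (fun _ => (1:ℝ)) z ∂axG := by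
  simp [axW]

lemma AxF.neg {f0 f1 f2 : ℝ → ℝ} {L₁ L₂ : ℝ} (h : AxF f0 f1 f2 L₁ L₂) :
    AxF (fun z => -f0 z) (fun z => -f1 z) (fun z => -f2 z) L₁ L₂ :=
  ⟨fun z => (h.h0 z).neg, fun z => (h.h1 z).neg, h.hc.neg, fun z => by rw [abs_neg]; exact h.b1 z,
    fun z => by rw [abs_neg]; exact h.b2 z⟩

lemma axW_neg (k : ℝ → ℝ) (m r : ℝ) : axW (fun z => -k z) m r = -axW k m r := by
  simp [axW, integral_neg]

lemma AxF.W0m {f0 f1 f2 : ℝ → ℝ} {L₁ L₂ : ℝ} (h : AxF f0 f1 f2 L₁ L₂) (m r : ℝ) :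
    HasDerivAt (fun m => axW f0 m r) (axW f1 m r) m := by
  simp only [axWV]
  exact ax_fdm f0 f1 _ h.h0 h.c1 L₁ h.b1 continuous_const ax_one (by simpa using ax_z) m r

lemma AxF.W1m {f0 f1 f2 : ℝ → ℝ} {L₁ L₂ : ℝ} (h : AxF f0 f1 f2 L₁ L₂) (m r : ℝ) :
    HasDerivAt (fun m => axW f1 m r) (axW f2 m r) m := by
  simp only [axWV]
  exact ax_fdm f1 f2 _ h.h1 h.hc L₂ h.b2 continuous_const ax_one (by simpa using ax_z) m r

lemma AxF.V1m {f0 f1 f2 : ℝ → ℝ} {L₁ L₂ : ℝ} (h : AxF f0 f1 f2 L₁ L₂) (m r : ℝ) :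
    HasDerivAt (fun m => axV f1 m r) (axV f2 m r) m := by
  exact ax_fdm f1 f2 (fun z => z) h.h1 h.hc L₂ h.b2 continuous_id ax_z ax_z2 m r

lemma AxF.V1 {f0 f1 f2 : ℝ → ℝ} {L₁ L₂ : ℝ} (h : AxF f0 f1 f2 L₁ L₂) (m r : ℝ) :
    axV f1 m r = r * axW f2 m r := by
  refine ax_st1 f1 f2 h.h1 m r ?_ ?_ (ax_bdd f1 _ h.c1 L₁ h.b1 ax_z m r)
  · simpa using ax_bdd f1 _ h.c1 L₁ h.b1 ax_one m r
  · simpa using ax_bdd f2 _ h.hc L₂ h.b2 ax_one m r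

lemma AxF.V2 {f0 f1 f2 : ℝ → ℝ} {L₁ L₂ : ℝ} (h : AxF f0 f1 f2 L₁ L₂) (m r : ℝ) :
    r * axV f2 m r = axQ f1 m r :=
  ax_st2 f1 f2 h.h1 L₁ h.b1 m r (ax_bdd f2 _ h.hc L₂ h.b2 ax_z m r)

lemma AxF.W2m {f0 f1 f2 : ℝ → ℝ} {L₁ L₂ : ℝ} (h : AxF f0 f1 f2 L₁ L₂) (m r : ℝ) (hr : 0 < r) :
    HasDerivAt (fun m => axW f2 m r) (axV f2 m r / r) m := by
  have e : (fun m => axW f2 m r) = fun m => axV f1 m r / r := by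
    ext x; rw [h.V1]; field_simp
  rw [e]; exact (h.V1m m r).div_const r

lemma AxF.L1 {f0 f1 f2 : ℝ → ℝ} {L₁ L₂ : ℝ} (h : AxF f0 f1 f2 L₁ L₂) : 0 ≤ L₁ := (abs_nonneg _).trans (h.b1 0)
lemma AxF.L2 {f0 f1 f2 : ℝ → ℝ} {L₁ L₂ : ℝ} (h : AxF f0 f1 f2 L₁ L₂) : 0 ≤ L₂ := (abs_nonneg _).trans (h.b2 0)

lemma axW_le (k : ℝ → ℝ) (L : ℝ) (hL : ∀ z, |k z| ≤ L) (m r : ℝ) : |axW k m r| ≤ L := by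
  rw [axWV]
  simpa using ax_bddle k _ L hL ax_one m r

lemma axQ_le (k : ℝ → ℝ) (L : ℝ) (hL : ∀ z, |k z| ≤ L) (m r : ℝ) : |axQ k m r| ≤ L :=
  (ax_bddle k _ L hL ax_z21 m r).trans (mul_le_of_le_one_right ((abs_nonneg _).trans (hL 0)) ax_EZ2)

lemma axV_le (k : ℝ → ℝ) (L : ℝ) (hL : ∀ z, |k z| ≤ L) (m r : ℝ) : |axV k m r| ≤ L * (4/5) :=
  (ax_bddle k _ L hL ax_z m r).trans (mul_le_mul_of_nonneg_left ax_EZ ((abs_nonneg _).trans (hL 0)))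

lemma AxF.W2mix {f0 f1 f2 : ℝ → ℝ} {L₁ L₂ : ℝ} (h : AxF f0 f1 f2 L₁ L₂) (m r : ℝ) (hr : 0 < r) :
    |axW f2 m r| ≤ 193/1000 * L₂ + 532/1000 * (L₁ / r) := by
  have hc := h.hc
  have := ax_mix (fun z => f1 (m + r * z)) (fun z => r * f2 (m + r * z)) (ax_inner f1 f2 h.h1 m r)
    (by fun_prop) L₁ (r * L₂) (fun z => h.b1 _) (fun z => by
      rw [abs_mul, abs_of_pos hr]; exact mul_le_mul_of_nonneg_left (h.b2 _) hr.le)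
  rw [integral_const_mul, abs_mul, abs_of_pos hr] at this
  have e : 193/1000 * L₂ + 532/1000 * (L₁ / r) = (193/1000 * (r * L₂) + 532/1000 * L₁) / r := by
    field_simp
  rw [e, le_div_iff₀ hr, mul_comm]
  exact this

lemma AxF.remain {f0 f1 f2 : ℝ → ℝ} {L₁ L₂ : ℝ} (h : AxF f0 f1 f2 L₁ L₂) (hL2 : 0 < L₂)
    (m r δ s D : ℝ) (hr : 0 < r) (hs : 0 < s) (hD1 : r ^ 2 ≤ D) (hDs : s ≤ D) :
    axW f0 (m + δ) r - axW f0 m r - axW f1 m r * δ - 1/2 * axW f2 m r * δ ^ 2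
      + 1/2 * (s - r ^ 2) * (axW f2 (m + δ) r - axW f2 m r)
    ≤ D / 4 * L₂ * (δ ^ 2 / r ^ 2) + √(2 * D) / 4 * L₁ * (s / r ^ 2 - 1 - Real.log (s / r ^ 2) + δ ^ 2 / r ^ 2) := by
  have hL1 := h.L1
  obtain ⟨e, he2, heδ⟩ : ∃ e : ℝ, e ^ 2 = 1 ∧ e * |δ| = δ := by
    rcases le_total 0 δ with hd | hd
    · exact ⟨1, by norm_num, by rw [abs_of_nonneg hd]; ring⟩
    · exact ⟨-1, by norm_num, by rw [abs_of_nonpos hd]; ring⟩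
  have hea : |e| = 1 := by
    have := sq_abs e; rw [he2] at this
    nlinarith [abs_nonneg e]
  have hin : ∀ t : ℝ, HasDerivAt (fun t => m + e * r * t) (e * r) t := fun t => by
    simpa using ((hasDerivAt_id' t).const_mul (e * r)).const_add m
  have hre : r ≠ 0 := hr.ne'
  have hLe : L₂ ≠ 0 := hL2.ne'
  have key := ax_numN (fun t => axW f0 (m + e * r * t) r / (L₂ * r ^ 2))
    (fun t => e * axW f1 (m + e * r * t) r / (L₂ * r))
    (fun t => axW f2 (m + e * r * t) r / L₂)
    (fun t => e * axV f2 (m + e * r * t) r / L₂)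
    (fun t => by
      refine (((h.W0m _ r).comp t (hin t)).div_const (L₂ * r ^ 2)).congr_deriv ?_
      field_simp)
    (fun t => by
      refine ((((h.W1m _ r).comp t (hin t)).const_mul e).div_const (L₂ * r)).congr_deriv ?_
      field_simp; rw [he2]; ring)
    (fun t => by
      refine (((h.W2m _ r hr).comp t (hin t)).div_const (L₂)).congr_deriv ?_
      field_simp)
    (L₁ / (L₂ * r))
    (fun t => by
      rw [abs_div, abs_mul, hea, one_mul, abs_of_pos (by positivity : 0 < L₂ * r)]
      exact div_le_div_of_nonneg_right (axW_le f1 L₁ h.b1 _ _) (by positivity))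
    (fun t => by
      rw [abs_div, abs_of_pos hL2, div_le_one hL2]
      exact axW_le f2 L₂ h.b2 _ _)
    (fun t => by
      rw [abs_div, abs_of_pos hL2, div_le_iff₀ hL2]
      refine (h.W2mix _ r hr).trans_eq ?_
      field_simp)
    (fun t => by
      rw [abs_div, abs_mul, hea, one_mul, abs_of_pos hL2, div_le_iff₀ hL2]
      exact (axV_le f2 L₂ h.b2 _ _).trans_eq (mul_comm _ _))
    (fun t => by
      rw [abs_div, abs_mul, hea, one_mul, abs_of_pos hL2, div_le_div_iff₀ hL2 (by positivity)]
      have : |r * axV f2 (m + e * r * t) r| ≤ L₁ := by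
        rw [h.V2]; exact axQ_le f1 L₁ h.b1 _ _
      rw [abs_mul, abs_of_pos hr] at this
      nlinarith)
    (|δ| / r) (s / r ^ 2) (D / r ^ 2) (by positivity) (by positivity)
    ((one_le_div (by positivity)).2 hD1) (by gcongr)
  have hx : m + e * r * (|δ| / r) = m + δ := by
    rw [← heδ, abs_mul, hea]; field_simp; simp
  have hsq : √(2 * (D / r ^ 2)) = √(2 * D) / r := by
    rw [← mul_div_assoc, Real.sqrt_div' _ (by positivity), Real.sqrt_sq hr.le]
  simp only [hx, hsq, mul_zero, add_zero, div_pow, sq_abs] at key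
  have k2 := mul_le_mul_of_nonneg_left key (by positivity : 0 ≤ L₂ * r ^ 2)
  generalize Real.log (s / r ^ 2) = lg at *
  have hδ1 : axW f1 m r * δ = e * axW f1 m r * |δ| := by
    conv_lhs => rw [← heδ]
    ring
  rw [hδ1]
  clear key
  generalize axW f0 (m + δ) r = a1 at *
  generalize axW f2 (m + δ) r = a2 at *
  generalize axW f0 m r = a3 at *
  generalize axW f1 m r = a4 at *
  generalize axW f2 m r = a5 at *
  generalize √(2 * D) = q at *
  refine (le_of_eq ?_).trans (k2.trans (le_of_eq ?_))
  · clear k2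
    field_simp
  · clear k2
    field_simp

lemma ax_tangent (h h' : ℝ → ℝ) (D : ℝ) (hd : ∀ s, 0 < s → HasDerivAt h (h' s) s)
    (hm : MonotoneOn h' (Set.Ioc 0 D)) (a b : ℝ) (ha : 0 < a) (haD : a ≤ D) (hb : 0 < b) (hbD : b ≤ D) :
    h a + h' a * (b - a) ≤ h b := by
  rcases lt_trichotomy a b with hab | hab | hab
  · obtain ⟨c, hc, hc'⟩ := exists_hasDerivAt_eq_slope h h' hab
      (fun x hx => (hd x (ha.trans_le hx.1)).continuousAt.continuousWithinAt)
      (fun x hx => hd x (ha.trans hx.1))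
    have := hm ⟨ha, haD⟩ ⟨ha.trans hc.1, hc.2.le.trans hbD⟩ hc.1.le
    rw [hc', le_div_iff₀ (by linarith)] at this
    linarith
  · subst hab; simp
  · obtain ⟨c, hc, hc'⟩ := exists_hasDerivAt_eq_slope h h' hab
      (fun x hx => (hd x (hb.trans_le hx.1)).continuousAt.continuousWithinAt)
      (fun x hx => hd x (hb.trans hx.1))
    have := hm ⟨hb.trans hc.1, hc.2.le.trans haD⟩ ⟨ha, haD⟩ hc.2.le
    rw [hc', div_le_iff₀ (by linarith)] at this
    linarith

lemma AxF.W0r {f0 f1 f2 : ℝ → ℝ} {L₁ L₂ : ℝ} (h : AxF f0 f1 f2 L₁ L₂) (m r : ℝ) :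
    HasDerivAt (fun r => axW f0 m r) (axV f1 m r) r := by
  simp only [axWV]
  refine (ax_fdr f0 f1 _ h.h0 h.c1 L₁ h.b1 continuous_const ax_one (by simpa using ax_z) m r).congr_deriv ?_
  simp [axV]

lemma AxF.W2r {f0 f1 f2 : ℝ → ℝ} {L₁ L₂ : ℝ} (h : AxF f0 f1 f2 L₁ L₂) (m r : ℝ) (hr : 0 < r) :
    HasDerivAt (fun r => axW f2 m r) (axQ f2 m r / r) r := by
  have e : (fun r => axW f2 m r) =ᶠ[nhds r] fun r => axV f1 m r / r := by
    filter_upwards [lt_mem_nhds hr] with x hx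
    rw [h.V1]; field_simp
  have hv : HasDerivAt (fun r => axV f1 m r) (∫ z, f2 (m + r * z) * (z * z) ∂axG) r :=
    ax_fdr f1 f2 (fun z => z) h.h1 h.hc L₂ h.b2 continuous_id ax_z ax_z2 m r
  refine HasDerivAt.congr_of_eventuallyEq ?_ e
  refine (hv.div (hasDerivAt_id' r) hr.ne').congr_deriv ?_
  have hq : axQ f2 m r = (∫ z, f2 (m + r * z) * (z * z) ∂axG) - axW f2 m r := by
    rw [axWV, ← integral_sub (ax_bdd f2 _ h.hc L₂ h.b2 ax_z2 m r) (ax_bdd f2 _ h.hc L₂ h.b2 ax_one m r)]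
    unfold axQ
    congr 1; ext z; ring
  rw [hq, h.V1]
  field_simp

lemma AxF.var {f0 f1 f2 : ℝ → ℝ} {L₁ L₂ : ℝ} (h : AxF f0 f1 f2 L₁ L₂) (m D a b : ℝ)
    (ha : 0 < a) (haD : a ≤ D) (hb : 0 < b) (hbD : b ≤ D) :
    axW f0 m √b - axW f0 m √a - 1/2 * axW f2 m √a * (b - a) ≤
      D / 4 * L₂ * (b / a - 1 - Real.log (b / a)) := by
  have hL2 := h.L2
  have hsq : ∀ s, 0 < s → HasDerivAt (fun s => √s) (1 / (2 * √s)) s := fun s hs => Real.hasDerivAt_sqrt hs.ne'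
  have d1 : ∀ s, 0 < s → HasDerivAt (fun s => -(D / 4 * L₂) * Real.log s - axW f0 m √s)
      (-(D / 4 * L₂) * s⁻¹ - 1/2 * axW f2 m √s) s := by
    intro s hs
    have hr : 0 < √s := Real.sqrt_pos.2 hs
    refine (((Real.hasDerivAt_log hs.ne').const_mul (-(D / 4 * L₂))).sub ((h.W0r m (√s)).comp s (hsq s hs))).congr_deriv ?_
    rw [h.V1]; field_simp
  have d2 : ∀ s, 0 < s → HasDerivAt (fun s => -(D / 4 * L₂) * s⁻¹ - 1/2 * axW f2 m √s)
      ((D / 4 * L₂) / s ^ 2 - 1/4 * axQ f2 m √s / s) s := by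
    intro s hs
    have hr : 0 < √s := Real.sqrt_pos.2 hs
    have hrr : √s * √s = s := Real.mul_self_sqrt hs.le
    refine (((hasDerivAt_inv hs.ne').const_mul (-(D / 4 * L₂))).sub (((h.W2r m (√s) hr).comp s (hsq s hs)).const_mul (1/2))).congr_deriv ?_
    have : axQ f2 m √s / √s * (1 / (2 * √s)) = axQ f2 m √s / (2 * s) := by
      rw [div_mul_div_comm, mul_one]; congr 1; linear_combination 2 * hrr
    rw [this]; field_simp; ring
  have hm : MonotoneOn (fun s => -(D / 4 * L₂) * s⁻¹ - 1/2 * axW f2 m √s) (Set.Ioc 0 D) := by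
    refine monotoneOn_of_deriv_nonneg (convex_Ioc 0 D)
      (fun s hs => (d2 s hs.1).continuousAt.continuousWithinAt) ?_ ?_
    · rw [interior_Ioc]
      exact fun s hs => (d2 s hs.1).differentiableAt.differentiableWithinAt
    · rw [interior_Ioc]
      intro s hs
      rw [(d2 s hs.1).deriv]
      have hs0 := hs.1
      have q := (abs_le.1 (axQ_le f2 L₂ h.b2 m √s)).2
      have : (D / 4 * L₂) / s ^ 2 - 1/4 * axQ f2 m √s / s = (D * L₂ - s * axQ f2 m √s) / (4 * s ^ 2) := by
        field_simp
      rw [this]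
      apply div_nonneg _ (by positivity)
      nlinarith [hs.2]
  have := ax_tangent _ _ D d1 hm a b ha haD hb hbD
  rw [Real.log_div hb.ne' ha.ne']
  have e : D / 4 * L₂ * (b / a - 1 - (Real.log b - Real.log a)) =
    (D / 4 * L₂ * a⁻¹) * (b - a) - D / 4 * L₂ * (Real.log b - Real.log a) := by
    field_simp
  rw [e]
  linarith

lemma AxF.up {f0 f1 f2 : ℝ → ℝ} {L₁ L₂ : ℝ} (h : AxF f0 f1 f2 L₁ L₂) (m δ D a b : ℝ)
    (ha : 0 < a) (haD : a ≤ D) (hb : 0 < b) (hbD : b ≤ D) :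
    axW f0 (m + δ) √b - axW f0 m √a - (axW f1 m √a * δ + 1/2 * axW f2 m √a * (b - a + δ ^ 2)) ≤
      (D / 2 * L₂ + √(2 * D) / 2 * L₁) * (1/2 * (b / a - 1 - Real.log (b / a) + δ ^ 2 / a)) := by
  have pos : ∀ L, 0 < L → AxF f0 f1 f2 L₁ L → axW f0 (m + δ) √b - axW f0 m √a - (axW f1 m √a * δ + 1/2 * axW f2 m √a * (b - a + δ ^ 2)) ≤
      (D / 2 * L + √(2 * D) / 2 * L₁) * (1/2 * (b / a - 1 - Real.log (b / a) + δ ^ 2 / a)) := by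
    intro L hL h
    have r2 : √a ^ 2 = a := Real.sq_sqrt ha.le
    have k1 := h.remain hL m (√a) δ b D (Real.sqrt_pos.2 ha) hb (by rw [r2]; exact haD) hbD
    rw [r2] at k1
    have k2 := h.var (m + δ) D a b ha haD hb hbD
    linarith
  apply le_of_forall_pos_le_add
  intro ε hε
  set K := D / 2 * (1/2 * (b / a - 1 - Real.log (b / a) + δ ^ 2 / a)) with hK
  have hη : 0 < ε / (|K| + 1) := by positivity
  have hL2 := h.L2
  have := pos (L₂ + ε / (|K| + 1)) (by linarith) ⟨h.h0, h.h1, h.hc, h.b1, fun z => (h.b2 z).trans (by linarith)⟩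
  have e2 : K * (ε / (|K| + 1)) ≤ ε := by
    rw [← mul_div_assoc, div_le_iff₀ (by positivity)]
    nlinarith [le_abs_self K]
  have e3 : (D / 2 * (L₂ + ε / (|K| + 1)) + √(2 * D) / 2 * L₁) * (1/2 * (b / a - 1 - Real.log (b / a) + δ ^ 2 / a))
    = (D / 2 * L₂ + √(2 * D) / 2 * L₁) * (1/2 * (b / a - 1 - Real.log (b / a) + δ ^ 2 / a)) + K * (ε / (|K| + 1)) := by
    rw [hK]; ring
  linarith

lemma AxF.low {f0 f1 f2 : ℝ → ℝ} {L₁ L₂ : ℝ} (h : AxF f0 f1 f2 L₁ L₂) (m δ D a b : ℝ)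
    (ha : 0 < a) (haD : a ≤ D) (hb : 0 < b) (hbD : b ≤ D) :
    -((D / 2 * L₂ + √(2 * D) / 2 * L₁) * (1/2 * (b / a - 1 - Real.log (b / a) + δ ^ 2 / a))) ≤ 
    axW f0 (m + δ) √b - axW f0 m √a - (axW f1 m √a * δ + 1/2 * axW f2 m √a * (b - a + δ ^ 2)) := by
  have := h.neg.up m δ D a b ha haD hb hbD
  simp only [axW_neg] at this
  linarith

lemma ax_proj (i : Fin 2) (u : UParam) : HasFDerivAt (fun ω : UParam => ω i) (EuclideanSpace.proj i : UParam →L[ℝ] ℝ) u :=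
  (EuclideanSpace.proj i : UParam →L[ℝ] ℝ).hasFDerivAt

lemma ax_projs (u : UParam) : HasFDerivAt (fun ω : UParam => ω 1 - (ω 0) ^ 2)
    ((EuclideanSpace.proj 1 : UParam →L[ℝ] ℝ) - (2 * u 0) • (EuclideanSpace.proj 0 : UParam →L[ℝ] ℝ)) u := by
  refine ((ax_proj 1 u).sub ((ax_proj 0 u).pow 2)).congr_fderiv ?_
  norm_num

lemma ax_grad (F : UParam → ℝ) (F' : UParam →L[ℝ] ℝ) (u w : UParam) (h : HasFDerivAt F F' u) :
    ⟪gradient F u, w⟫ = F' w := by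
  unfold gradient
  rw [InnerProductSpace.toDual_symm_apply, h.fderiv]

lemma ax_breg (u v : UParam) (hu : 0 < u 1 - (u 0) ^ 2) (hv : 0 < v 1 - (v 0) ^ 2) :
    bregAstar1 v u = 1/2 * ((v 1 - (v 0) ^ 2) / (u 1 - (u 0) ^ 2) - 1 - Real.log ((v 1 - (v 0) ^ 2) / (u 1 - (u 0) ^ 2))
      + (v 0 - u 0) ^ 2 / (u 1 - (u 0) ^ 2)) := by
  have hd := ((ax_projs u).log hu.ne').const_mul (-(1/2))
  have hg := ax_grad Astar1 _ u (v - u) hd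
  unfold bregAstar1
  rw [hg, Real.log_div hv.ne' hu.ne']
  simp [Astar1]
  field_simp
  ring

lemma AxF.expVal_grad {f0 f1 f2 : ℝ → ℝ} {L₁ L₂ : ℝ} (h : AxF f0 f1 f2 L₁ L₂)
    (u w : UParam) (hu : 0 < u 1 - (u 0) ^ 2) :
    ⟪gradient (expVal f0) u, w⟫ = axW f1 (u 0) √(u 1 - (u 0) ^ 2) * w 0
      + 1/2 * axW f2 (u 0) √(u 1 - (u 0) ^ 2) * (w 1 - 2 * u 0 * w 0) := by
  have hc0 : Continuous f0 := continuous_iff_continuousAt.2 fun z => (h.h0 z).continuousAt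
  have hr : 0 < √(u 1 - (u 0) ^ 2) := Real.sqrt_pos.2 hu
  have e : expVal f0 =ᶠ[nhds u] fun ω => axW f0 (ω 0) √(ω 1 - (ω 0) ^ 2) := by
    filter_upwards [(ax_projs u).continuousAt.eventually (lt_mem_nhds hu)] with ω hω
    exact ax_mapint f0 hc0 _ _ (le_of_lt hω)
  have hj : HasFDerivAt (fun p : ℝ × ℝ => axW f0 p.1 p.2)
      (axW f1 (u 0) √(u 1 - (u 0) ^ 2) • ContinuousLinearMap.fst ℝ ℝ ℝ + axV f1 (u 0) √(u 1 - (u 0) ^ 2) • ContinuousLinearMap.snd ℝ ℝ ℝ)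
      (u 0, √(u 1 - (u 0) ^ 2)) := by
    have := ax_fd f0 f1 (fun _ => 1) h.h0 h.c1 L₁ h.b1 continuous_const ax_one (by simpa using ax_z) (u 0) √(u 1 - (u 0) ^ 2)
    simpa [axW, axV] using this
  have hp := (ax_proj 0 u).prodMk ((ax_projs u).sqrt hu.ne')
  have hd := (HasFDerivAt.comp (g := fun p : ℝ × ℝ => axW f0 p.1 p.2) u hj hp).congr_of_eventuallyEq e
  rw [ax_grad _ _ u w hd]
  simp [h.V1]
  field_simp

/-- Corollary E.1, sufficient conditions for relative smoothness,
univariate case: if `|f'| ≤ L₁` and `|f''| ≤ L₂` everywhere, then with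
`β = (D/2)L₂ + (√(2D)/2)L₁` both `M(β)` and `N(−β)` are positive semidefinite on
`{0 < σ² ≤ D}`; consequently `ω ↦ E_{q(·;ω)}[f]` is `β`-smooth relative to `A*`
on `{(ξ,Ξ) : 0 < Ξ − ξ² ≤ D}`. -/
theorem sufficient_conditions_relative_smoothness_univariate
    (f : ℝ → ℝ) (hf : ContDiff ℝ 4 f)
    (L₁ L₂ : ℝ) (hL₁ : 0 ≤ L₁) (hL₂ : 0 ≤ L₂)
    (hd1 : ∀ z : ℝ, |deriv f z| ≤ L₁)
    (hd2 : ∀ z : ℝ, |iteratedDeriv 2 f z| ≤ L₂)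
    (hint3 : ∀ (μ σ2 : ℝ), 0 < σ2 →
      Integrable (iteratedDeriv 3 f) (gaussianReal μ σ2.toNNReal))
    (hint4 : ∀ (μ σ2 : ℝ), 0 < σ2 →
      Integrable (iteratedDeriv 4 f) (gaussianReal μ σ2.toNNReal))
    (D : ℝ) (hD : 0 < D) :
    (∀ (μ σ2 : ℝ), 0 < σ2 → σ2 ≤ D →
      (Mmat (D / 2 * L₂ + Real.sqrt (2 * D) / 2 * L₁) μ σ2
          (Bexp f μ σ2) (Cexp f μ σ2)).PosSemidef ∧
      (Nmat (-(D / 2 * L₂ + Real.sqrt (2 * D) / 2 * L₁)) μ σ2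
          (Bexp f μ σ2) (Cexp f μ σ2)).PosSemidef) ∧
    (∀ u : UParam, 0 < u 1 - (u 0) ^ 2 → u 1 - (u 0) ^ 2 ≤ D →
      ∀ v : UParam, 0 < v 1 - (v 0) ^ 2 → v 1 - (v 0) ^ 2 ≤ D →
        (-((D / 2 * L₂ + Real.sqrt (2 * D) / 2 * L₁) * bregAstar1 v u)
            ≤ expVal f v - expVal f u - ⟪gradient (expVal f) u, v - u⟫) ∧
        (expVal f v - expVal f u - ⟪gradient (expVal f) u, v - u⟫
            ≤ (D / 2 * L₂ + Real.sqrt (2 * D) / 2 * L₁) * bregAstar1 v u)) := by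
  refine ⟨fun μ σ2 hs hsD => ax_part1 f hf L₁ L₂ hL₁ hL₂ hd1 hd2 hint3 hint4 D μ σ2 hs hsD, ?_⟩
  intro u hu huD v hv hvD
  have hder : ∀ n : ℕ, n < 4 → ∀ z, HasDerivAt (iteratedDeriv n f) (iteratedDeriv (n+1) f z) z := by
    intro n hn z
    rw [iteratedDeriv_succ]
    exact ((hf.differentiable_iteratedDeriv n (by exact_mod_cast hn)) z).hasDerivAt
  have h : AxF f (deriv f) (iteratedDeriv 2 f) L₁ L₂ :=
    ⟨fun z => by simpa using hder 0 (by norm_num) z, fun z => by simpa using hder 1 (by norm_num) z,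
      hf.continuous_iteratedDeriv 2 (by norm_num), hd1, hd2⟩
  have hfc : Continuous f := hf.continuous
  have e1 : expVal f v = axW f (u 0 + (v 0 - u 0)) √(v 1 - (v 0) ^ 2) := by
    rw [add_sub_cancel]; exact ax_mapint f hfc _ _ hv.le
  have e2 : expVal f u = axW f (u 0) √(u 1 - (u 0) ^ 2) := ax_mapint f hfc _ _ hu.le
  have e3 := h.expVal_grad u (v - u) hu
  have e4 : (v - u) 1 - 2 * u 0 * (v - u) 0 = (v 1 - (v 0) ^ 2) - (u 1 - (u 0) ^ 2) + (v 0 - u 0) ^ 2 := by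
    simp; ring
  have e5 : (v - u) 0 = v 0 - u 0 := by simp
  rw [e4, e5] at e3
  rw [ax_breg u v hu hv, e1, e2, e3]
  exact ⟨h.low _ _ D _ _ hu huD hv hvD, h.up _ _ D _ _ hu huD hv hvD⟩

end
end

section
/- Let d ≥ 1, μ ∈ ℝ^d, σ_i > 0 for 1 ≤ i ≤ d, and let Q = ⨂_{i=1}^d N(μ_i, σ_i²) be the corresponding product Gaussian measure on ℝ^d. Let f : ℝ^d → ℝ be twice continuously differentiable and bounded, with all partial derivatives of f up to order two of at most polynomial growth. Then for all i, j ∈ {1,…,d}: |∫ ∂²_{ij} f dQ| ≤ σ_i⁻¹ · σ_j⁻¹ · sup_{z∈ℝ^d} |f(z)|. -/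
open MeasureTheory ProbabilityTheory

noncomputable section

open scoped NNReal ENNReal

lemma pi_gaussian_density {d : ℕ} (μ : Fin d → ℝ) (v : Fin d → ℝ≥0) (hv : ∀ k, v k ≠ 0) :
    (Measure.pi fun k => gaussianReal (μ k) (v k)) =
      (volume : Measure (Fin d → ℝ)).withDensity
        (fun z => ENNReal.ofReal (∏ k, gaussianPDFReal (μ k) (v k) (z k))) := by
  apply Measure.pi_eq
  intro s hs
  rw [withDensity_apply _ (MeasurableSet.univ_pi hs), volume_pi, Measure.restrict_pi_pi,
    ← ofReal_integral_eq_lintegral_ofReal]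
  · rw [integral_fintype_prod_eq_prod (𝕜 := ℝ) (fun k x => gaussianPDFReal (μ k) (v k) x),
      ENNReal.ofReal_prod_of_nonneg]
    · exact Finset.prod_congr rfl fun k _ => (gaussianReal_apply_eq_integral _ (hv k) _).symm
    · exact fun k _ => integral_nonneg fun x => gaussianPDFReal_nonneg _ _ _
  · exact Integrable.fintype_prod (f := fun k x => gaussianPDFReal (μ k) (v k) x)
      fun k => (integrable_gaussianPDFReal _ _).restrict
  · exact Filter.Eventually.of_forall fun z =>
      Finset.prod_nonneg fun k _ => gaussianPDFReal_nonneg _ _ _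

lemma dens_hasFDerivAt {d : ℕ} (μ : Fin d → ℝ) (v : Fin d → ℝ≥0) (hv : ∀ k, v k ≠ 0)
    (z : Fin d → ℝ) (i : Fin d) :
    DifferentiableAt ℝ (fun z : Fin d → ℝ => ∏ k, gaussianPDFReal (μ k) (v k) (z k)) z ∧
    fderiv ℝ (fun z : Fin d → ℝ => ∏ k, gaussianPDFReal (μ k) (v k) (z k)) z (Pi.single i 1)
      = -((z i - μ i) / v i) * ∏ k, gaussianPDFReal (μ k) (v k) (z k) := by
  have e : (fun z : Fin d → ℝ => ∏ k, gaussianPDFReal (μ k) (v k) (z k)) =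
      fun z => (∏ k, (√(2 * Real.pi * v k))⁻¹) * Real.exp (∑ k, -(z k - μ k)^2 / (2 * v k)) := by
    ext z
    simp only [gaussianPDFReal, Finset.prod_mul_distrib, Real.exp_sum]
  have h1 : ∀ k, HasFDerivAt (fun z : Fin d → ℝ => -(z k - μ k)^2 / (2 * v k))
      ((-((z k - μ k) / v k)) • (ContinuousLinearMap.proj (R := ℝ) (φ := fun _ : Fin d => ℝ) k)) z := by
    intro k
    have hk : (v k : ℝ) ≠ 0 := by exact_mod_cast hv k
    have h0 : HasDerivAt (fun x : ℝ => -(x - μ k)^2 / (2 * v k)) (-((z k - μ k) / v k)) (z k) := by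
      have := ((((hasDerivAt_id (z k)).sub_const (μ k)).pow 2).neg).div_const (2 * (v k : ℝ))
      convert! this using 1
      simp
      field_simp
    exact h0.comp_hasFDerivAt z
      (ContinuousLinearMap.proj (R := ℝ) (φ := fun _ : Fin d => ℝ) k).hasFDerivAt
  have h2 := ((HasFDerivAt.fun_sum (u := Finset.univ) fun k _ => h1 k).exp).const_mul
    (∏ k, (√(2 * Real.pi * v k))⁻¹)
  refine ⟨by rw [e]; exact h2.differentiableAt, ?_⟩
  have e' := congrFun e z
  rw [e', e, h2.fderiv]
  simp [Pi.single_apply]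
  ring

lemma stein_pi {d : ℕ} (μ : Fin d → ℝ) (v : Fin d → ℝ≥0) (hv : ∀ k, v k ≠ 0)
    (g : (Fin d → ℝ) → ℝ) (hg : Differentiable ℝ g) (i : Fin d)
    (h0 : Integrable g (Measure.pi fun k => gaussianReal (μ k) (v k)))
    (h1 : Integrable (fun z => fderiv ℝ g z (Pi.single i 1))
      (Measure.pi fun k => gaussianReal (μ k) (v k)))
    (h2 : Integrable (fun z => (z i - μ i) / v i * g z)
      (Measure.pi fun k => gaussianReal (μ k) (v k))) :
    ∫ z, fderiv ℝ g z (Pi.single i 1) ∂(Measure.pi fun k => gaussianReal (μ k) (v k)) =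
      ∫ z, (z i - μ i) / v i * g z ∂(Measure.pi fun k => gaussianReal (μ k) (v k)) := by
  have hm : Measurable (fun z : Fin d → ℝ =>
      ENNReal.ofReal (∏ k, gaussianPDFReal (μ k) (v k) (z k))) := by
    apply Measurable.ennreal_ofReal
    exact Finset.measurable_prod _ fun k _ =>
      (measurable_gaussianPDFReal _ _).comp (measurable_pi_apply k)
  have hlt : ∀ᵐ z : Fin d → ℝ ∂volume,
      ENNReal.ofReal (∏ k, gaussianPDFReal (μ k) (v k) (z k)) < ∞ :=
    Filter.Eventually.of_forall fun z => ENNReal.ofReal_lt_top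
  have hnn : ∀ z : Fin d → ℝ, 0 ≤ ∏ k, gaussianPDFReal (μ k) (v k) (z k) :=
    fun z => Finset.prod_nonneg fun k _ => gaussianPDFReal_nonneg _ _ _
  rw [pi_gaussian_density μ v hv] at *
  rw [integrable_withDensity_iff_integrable_smul' hm hlt] at h0 h1 h2
  rw [integral_withDensity_eq_integral_toReal_smul hm hlt,
    integral_withDensity_eq_integral_toReal_smul hm hlt]
  simp only [ENNReal.toReal_ofReal (hnn _), smul_eq_mul] at h0 h1 h2 ⊢
  have hd := fun z => dens_hasFDerivAt μ v hv z i
  rw [integral_mul_fderiv_eq_neg_fderiv_mul_of_integrable _ h1 h0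
    (fun z _ => (hd z).1) (fun z _ => hg z)]
  · rw [← integral_neg]
    congr 1; ext z
    rw [(hd z).2]; ring
  · refine h2.neg.congr (Filter.Eventually.of_forall fun z => ?_)
    simp only [Pi.neg_apply]
    rw [(hd z).2]; ring

lemma integrable_poly {d : ℕ} (μ : Fin d → ℝ) (v : Fin d → ℝ≥0) (n : ℕ) :
    Integrable (fun z : Fin d → ℝ => (1 + ‖z‖) ^ n)
      (Measure.pi fun k => gaussianReal (μ k) (v k)) := by
  have h : MemLp (fun z : Fin d → ℝ => z) n (Measure.pi fun k => gaussianReal (μ k) (v k)) := by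
    refine MemLp.of_eval fun k => ?_
    exact (memLp_id_gaussianReal' (μ := μ k) (v := v k) n (by simp)).comp_measurePreserving
      (measurePreserving_eval (fun k => gaussianReal (μ k) (v k)) k)
  have h' := ((memLp_const (1:ℝ)).add h.norm).integrable_norm_pow'
  refine h'.congr (Filter.Eventually.of_forall fun z => ?_)
  simp only [Pi.add_apply]
  rw [Real.norm_of_nonneg (by positivity)]

lemma gauss_abs : ∫ x, |x ^ 2 - 1| ∂(gaussianReal 0 1) ≤ 1 := by
  have hm : MemLp (fun x : ℝ => x) 2 (gaussianReal 0 1) := memLp_id_gaussianReal' 2 (by simp)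
  have hi2 : Integrable (fun x : ℝ => x ^ 2) (gaussianReal 0 1) := hm.integrable_sq
  have hv : ∫ x, x ^ 2 ∂(gaussianReal 0 1) = 1 := by
    have := variance_fun_id_gaussianReal (μ := 0) (v := 1)
    rw [variance_of_integral_eq_zero (by fun_prop) (by simp)] at this
    simpa using this
  have e : ∀ x : ℝ, |x ^ 2 - 1| = (x ^ 2 - 1) + 2 * (Set.Ioc (-1:ℝ) 1).indicator (fun x => 1 - x ^ 2) x := by
    intro x
    by_cases hx : x ∈ Set.Ioc (-1:ℝ) 1
    · rw [Set.indicator_of_mem hx, abs_of_nonpos (by nlinarith [hx.1, hx.2])]; ring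
    · rw [Set.indicator_of_notMem hx, abs_of_nonneg]
      · ring
      · simp only [Set.mem_Ioc, not_and_or, not_lt, not_le] at hx
        rcases hx with h | h <;> nlinarith
  have hi1 : Integrable (fun x : ℝ => x ^ 2 - 1) (gaussianReal 0 1) := hi2.sub (integrable_const _)
  have hi1' : Integrable (fun x : ℝ => 1 - x ^ 2) (gaussianReal 0 1) := (integrable_const _).sub hi2
  simp_rw [e]
  rw [integral_add hi1 ((hi1'.indicator measurableSet_Ioc).const_mul 2),
    integral_sub hi2 (integrable_const _), hv, integral_const_mul, integral_const,
    integral_gaussianReal_eq_integral_smul (by simp)]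
  have e2 : ∀ x : ℝ, gaussianPDFReal 0 1 x • (Set.Ioc (-1:ℝ) 1).indicator (fun x => 1 - x ^ 2) x
      = (Set.Ioc (-1:ℝ) 1).indicator (fun x => gaussianPDFReal 0 1 x * (1 - x ^ 2)) x := by
    intro x
    by_cases hx : x ∈ Set.Ioc (-1:ℝ) 1 <;> simp [hx]
  rw [integral_congr_ae (Filter.Eventually.of_forall e2)]
  rw [integral_indicator measurableSet_Ioc, ← intervalIntegral.integral_of_le (by norm_num)]
  have hd : ∀ x : ℝ, HasDerivAt (fun x => (√(2 * Real.pi))⁻¹ * (x * Real.exp (- x ^ 2 / 2)))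
      (gaussianPDFReal 0 1 x * (1 - x ^ 2)) x := by
    intro x
    have h := (((hasDerivAt_id x).mul
      ((((hasDerivAt_id x).pow 2).neg.div_const 2).exp)).const_mul ((√(2 * Real.pi))⁻¹))
    convert! h using 1
    simp [gaussianPDFReal]
    ring
  have hc : Continuous (fun x => gaussianPDFReal 0 1 x * (1 - x ^ 2)) := by
    unfold gaussianPDFReal; fun_prop
  rw [intervalIntegral.integral_eq_sub_of_hasDerivAt (fun x _ => hd x) (hc.intervalIntegrable _ _)]
  simp only [probReal_univ, smul_eq_mul]
  have key : 4 * ((√(2 * Real.pi))⁻¹ * Real.exp (-1 / 2)) ≤ 1 := by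
    rw [← sq_le_one_iff₀ (by positivity), mul_pow, mul_pow, inv_pow, Real.sq_sqrt (by positivity),
      ← Real.exp_nat_mul]
    norm_num
    rw [Real.exp_neg]
    have := Real.pi_gt_d2
    have := Real.exp_one_gt_d9
    have h3 : (16:ℝ) * (Real.pi⁻¹ * (1 / 2) * (Real.exp 1)⁻¹) = 8 / (Real.pi * Real.exp 1) := by
      field_simp
      norm_num
    rw [h3, div_le_one (by positivity)]
    nlinarith
  norm_num at key ⊢
  linarith


/-- Continuous functions of polynomial growth. -/
def PG {d : ℕ} (h : (Fin d → ℝ) → ℝ) : Prop :=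
  Continuous h ∧ ∃ (K : ℝ) (m : ℕ), 0 ≤ K ∧ ∀ z, |h z| ≤ K * (1 + ‖z‖) ^ m

lemma PG.mul {d : ℕ} {g h : (Fin d → ℝ) → ℝ} (hg : PG g) (hh : PG h) :
    PG (fun z => g z * h z) := by
  obtain ⟨cg, K, m, hK, hg⟩ := hg
  obtain ⟨ch, L, n, hL, hh⟩ := hh
  refine ⟨cg.mul ch, K * L, m + n, by positivity, fun z => ?_⟩
  rw [abs_mul, pow_add]
  calc |g z| * |h z| ≤ (K * (1 + ‖z‖) ^ m) * (L * (1 + ‖z‖) ^ n) :=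
        mul_le_mul (hg z) (hh z) (abs_nonneg _) (by positivity)
    _ = _ := by ring

lemma PG.const {d : ℕ} (c : ℝ) : PG (fun _ : Fin d → ℝ => c) :=
  ⟨continuous_const, |c|, 0, abs_nonneg _, fun z => by simp⟩

lemma PG.coord {d : ℕ} (k : Fin d) (a b : ℝ) : PG (fun z : Fin d → ℝ => (z k - a) / b) := by
  refine ⟨by fun_prop, (1 + |a|) / |b|, 1, by positivity, fun z => ?_⟩
  have h1 : |z k| ≤ ‖z‖ := norm_le_pi_norm z k
  have h2 := abs_sub (z k) a
  rw [abs_div, div_mul_eq_mul_div]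
  gcongr
  nlinarith [norm_nonneg z, abs_nonneg a, mul_nonneg (norm_nonneg z) (abs_nonneg a)]

lemma PG.integrable {d : ℕ} {g : (Fin d → ℝ) → ℝ} (hg : PG g) (μ : Fin d → ℝ)
    (v : Fin d → ℝ≥0) : Integrable g (Measure.pi fun k => gaussianReal (μ k) (v k)) := by
  obtain ⟨cg, K, m, hK, hg⟩ := hg
  exact ((integrable_poly μ v m).const_mul K).mono' cg.aestronglyMeasurable
    (Filter.Eventually.of_forall hg)

lemma mp_std {d : ℕ} (μ σ : Fin d → ℝ) (hσ : ∀ i, 0 < σ i) (k : Fin d) :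
    MeasurePreserving (fun z : Fin d → ℝ => (z k - μ k) / σ k)
      (Measure.pi fun k => gaussianReal (μ k) ((σ k ^ 2).toNNReal)) (gaussianReal 0 1) := by
  have h1 := measurePreserving_eval (fun k => gaussianReal (μ k) ((σ k ^ 2).toNNReal)) k
  have h2 : MeasurePreserving (fun x : ℝ => (x - μ k) / σ k)
      (gaussianReal (μ k) ((σ k ^ 2).toNNReal)) (gaussianReal 0 1) := by
    refine ⟨by fun_prop, ?_⟩
    have : (fun x : ℝ => (x - μ k) / σ k) = (fun x => x / σ k) ∘ (fun x => x - μ k) := rfl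
    rw [this, ← Measure.map_map (by fun_prop) (by fun_prop), gaussianReal_map_sub_const,
      gaussianReal_map_div_const]
    congr 1
    · simp
    · ext
      have := (hσ k).ne'
      simp only [NNReal.coe_div, NNReal.coe_one, Real.coe_toNNReal _ (sq_nonneg (σ k))]
      exact div_self (by positivity)
  exact h2.comp h1

lemma integral_std_s12 {d : ℕ} (μ σ : Fin d → ℝ) (hσ : ∀ i, 0 < σ i) (k : Fin d) (h : ℝ → ℝ)
    (hh : Continuous h) :
    ∫ z, h ((z k - μ k) / σ k) ∂(Measure.pi fun k => gaussianReal (μ k) ((σ k ^ 2).toNNReal))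
      = ∫ x, h x ∂(gaussianReal 0 1) := by
  rw [← (mp_std μ σ hσ k).map_eq, integral_map (mp_std μ σ hσ k).measurable.aemeasurable
    hh.aestronglyMeasurable]

lemma gauss_sq : ∫ x, x ^ 2 ∂(gaussianReal 0 1) = 1 := by
  have := variance_fun_id_gaussianReal (μ := 0) (v := 1)
  rw [variance_of_integral_eq_zero (by fun_prop) (by simp)] at this
  simpa using this

/-- The `L¹` bound for the iterated Stein weight. -/
lemma weight_bound {d : ℕ} (μ σ : Fin d → ℝ) (hσ : ∀ i, 0 < σ i) (i j : Fin d) :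
    ∫ z, |(z j - μ j) / σ j ^ 2 * ((z i - μ i) / σ i ^ 2) - (if i = j then 1 / σ i ^ 2 else 0)|
      ∂(Measure.pi fun k => gaussianReal (μ k) ((σ k ^ 2).toNNReal)) ≤ (σ i)⁻¹ * (σ j)⁻¹ := by
  have hi := hσ i
  have hj := hσ j
  by_cases hij : i = j
  · subst hij
    have e : ∀ z : Fin d → ℝ, |(z i - μ i) / σ i ^ 2 * ((z i - μ i) / σ i ^ 2)
        - (if i = i then 1 / σ i ^ 2 else 0)| =
        ((σ i)⁻¹ * (σ i)⁻¹) * |((z i - μ i) / σ i) ^ 2 - 1| := by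
      intro z
      rw [← abs_of_pos (show 0 < (σ i)⁻¹ * (σ i)⁻¹ by positivity), ← abs_mul]
      congr 1
      simp only [if_true]
      field_simp
    rw [integral_congr_ae (Filter.Eventually.of_forall e)]
    rw [integral_const_mul, integral_std_s12 μ σ hσ i (fun x => |x ^ 2 - 1|) (by fun_prop)]
    exact mul_le_of_le_one_right (by positivity) gauss_abs
  · simp only [hij, if_false, sub_zero]
    have hint : ∀ k : Fin d, Integrable (fun z : Fin d → ℝ => ((z k - μ k) / σ k) ^ 2)
        (Measure.pi fun k => gaussianReal (μ k) ((σ k ^ 2).toNNReal)) := by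
      intro k
      simpa only [pow_two] using ((PG.coord k (μ k) (σ k)).mul (PG.coord k (μ k) (σ k))).integrable μ _
    have hb : ∀ z : Fin d → ℝ, |(z j - μ j) / σ j ^ 2 * ((z i - μ i) / σ i ^ 2)| ≤
        ((σ i)⁻¹ * (σ j)⁻¹) * (1 / 2) * (((z i - μ i) / σ i) ^ 2 + ((z j - μ j) / σ j) ^ 2) := by
      intro z
      have e : (z j - μ j) / σ j ^ 2 * ((z i - μ i) / σ i ^ 2) =
          ((σ i)⁻¹ * (σ j)⁻¹) * (((z i - μ i) / σ i) * ((z j - μ j) / σ j)) := by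
        field_simp
      rw [e, abs_mul, abs_of_pos (show 0 < (σ i)⁻¹ * (σ j)⁻¹ by positivity), mul_assoc (_ * _)]
      refine mul_le_mul_of_nonneg_left ?_ (by positivity)
      generalize (z i - μ i) / σ i = a
      generalize (z j - μ j) / σ j = b
      rw [abs_le]
      constructor <;> nlinarith [sq_nonneg (a + b), sq_nonneg (a - b)]
    refine (integral_mono_of_nonneg (Filter.Eventually.of_forall fun z => abs_nonneg _)
      (((hint i).add (hint j)).const_mul _) (Filter.Eventually.of_forall hb)).trans ?_
    simp only [Pi.add_apply]
    rw [integral_const_mul, integral_add (hint i) (hint j),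
      integral_std_s12 μ σ hσ i (fun x => x ^ 2) (by fun_prop),
      integral_std_s12 μ σ hσ j (fun x => x ^ 2) (by fun_prop), gauss_sq]
    apply le_of_eq; ring

lemma norm_single_one_le {d : ℕ} (i : Fin d) : ‖(Pi.single i 1 : Fin d → ℝ)‖ ≤ 1 := by
  rw [pi_norm_le_iff_of_nonneg zero_le_one]
  intro k
  by_cases h : k = i
  · subst h; simp
  · simp [h]

/-- Lemma F.4, iterated Stein bound: for a product Gaussian measure
`Q = ⨂_i N(μ_i, σ_i²)` and `f : ℝ^d → ℝ` twice continuously differentiable, bounded,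
with derivatives up to order two of polynomial growth,
`|∫ ∂²_{ij} f dQ| ≤ σ_i⁻¹ σ_j⁻¹ sup_z |f(z)|`. -/
theorem iterated_stein_bound
    {d : ℕ} (hd : 1 ≤ d) (μ σ : Fin d → ℝ) (hσ : ∀ i, 0 < σ i)
    (f : (Fin d → ℝ) → ℝ) (hf : ContDiff ℝ 2 f)
    (hbdd : ∃ M : ℝ, ∀ z, |f z| ≤ M)
    (hgrowth : ∃ C n : ℝ, ∀ z : Fin d → ℝ,
      ‖f z‖ + ‖fderiv ℝ f z‖ + ‖fderiv ℝ (fderiv ℝ f) z‖ ≤ C * (1 + ‖z‖) ^ n)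
    (i j : Fin d) :
    |∫ z, fderiv ℝ (fun w => fderiv ℝ f w (Pi.single j 1)) z (Pi.single i 1)
        ∂(Measure.pi fun k => gaussianReal (μ k) ((σ k ^ 2).toNNReal))|
      ≤ (σ i)⁻¹ * (σ j)⁻¹ * ⨆ z : Fin d → ℝ, |f z| := by
  obtain ⟨M, hM⟩ := hbdd
  obtain ⟨C, n, hg⟩ := hgrowth
  set v : Fin d → ℝ≥0 := fun k => (σ k ^ 2).toNNReal with hvdef
  have hvc : ∀ k, (v k : ℝ) = σ k ^ 2 := fun k => Real.coe_toNNReal _ (sq_nonneg _)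
  have hv : ∀ k, v k ≠ 0 := by
    intro k h
    have h1 := hvc k
    rw [h] at h1
    have := pow_pos (hσ k) 2
    simp only [NNReal.coe_zero] at h1
    linarith
  have hg' : ∀ z : Fin d → ℝ, ‖f z‖ + ‖fderiv ℝ f z‖ + ‖fderiv ℝ (fderiv ℝ f) z‖
      ≤ |C| * (1 + ‖z‖) ^ ⌈|n|⌉₊ := by
    intro z
    refine (hg z).trans ?_
    have h1 : (1:ℝ) ≤ 1 + ‖z‖ := by linarith [norm_nonneg z]
    calc C * (1 + ‖z‖) ^ n ≤ |C| * (1 + ‖z‖) ^ n := by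
          gcongr; exact le_abs_self C
      _ ≤ |C| * (1 + ‖z‖) ^ ((⌈|n|⌉₊ : ℕ) : ℝ) := by
          gcongr
          · exact (le_abs_self n).trans (Nat.le_ceil _)
      _ = _ := by rw [Real.rpow_natCast]
  have hfd : Differentiable ℝ f := hf.differentiable (by norm_num)
  have hf1 : ContDiff ℝ 1 (fderiv ℝ f) := hf.fderiv_right (by norm_num)
  have hf1d : Differentiable ℝ (fderiv ℝ f) := hf1.differentiable (by norm_num)
  have hf2 : Continuous (fderiv ℝ (fderiv ℝ f)) := hf1.continuous_fderiv (by norm_num)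
  have pf : PG f := ⟨hf.continuous, |C|, _, abs_nonneg _, fun z => by
    have := hg' z
    rw [← Real.norm_eq_abs (f z)]
    linarith [norm_nonneg (fderiv ℝ f z), norm_nonneg (fderiv ℝ (fderiv ℝ f) z)]⟩
  have pf1 : ∀ k : Fin d, PG (fun z => fderiv ℝ f z (Pi.single k 1)) := fun k =>
    ⟨hf1.continuous.clm_apply continuous_const, |C|, _, abs_nonneg _, fun z => by
      have := hg' z
      have h2 := (fderiv ℝ f z).le_of_opNorm_le_of_le le_rfl (norm_single_one_le k)
      rw [Real.norm_eq_abs] at h2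
      linarith [norm_nonneg (f z), norm_nonneg (fderiv ℝ (fderiv ℝ f) z)]⟩
  have e2 : ∀ z, fderiv ℝ (fun w => fderiv ℝ f w (Pi.single j 1)) z (Pi.single i 1) =
      fderiv ℝ (fderiv ℝ f) z (Pi.single i 1) (Pi.single j 1) := by
    intro z
    rw [((hf1d z).hasFDerivAt.clm_apply (hasFDerivAt_const (Pi.single j 1) z)).fderiv]
    simp
  have pf2 : PG (fun z => fderiv ℝ (fun w => fderiv ℝ f w (Pi.single j 1)) z (Pi.single i 1)) := by
    simp_rw [e2]
    refine ⟨(hf2.clm_apply continuous_const).clm_apply continuous_const, |C|, ⌈|n|⌉₊, abs_nonneg _,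
      fun z => ?_⟩
    have := hg' z
    have h2 := (fderiv ℝ (fderiv ℝ f) z).le_of_opNorm_le_of_le le_rfl (norm_single_one_le i)
    have h3 := (fderiv ℝ (fderiv ℝ f) z (Pi.single i 1)).le_of_opNorm_le_of_le h2
      (norm_single_one_le j)
    rw [Real.norm_eq_abs] at h3
    linarith [norm_nonneg (f z), norm_nonneg (fderiv ℝ f z)]
  have s1 := stein_pi μ v hv (fun w => fderiv ℝ f w (Pi.single j 1))
    (fun z => (hf1d z).clm_apply (differentiableAt_const _)) i ((pf1 j).integrable μ v)
    (pf2.integrable μ v) (((PG.coord i (μ i) (v i)).mul (pf1 j)).integrable μ v)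
  have hcoord : ∀ z : Fin d → ℝ, HasFDerivAt (fun z : Fin d → ℝ => (z i - μ i) / (v i : ℝ))
      ((v i : ℝ)⁻¹ • ContinuousLinearMap.proj (R := ℝ) (φ := fun _ : Fin d => ℝ) i) z := by
    intro z
    have h0 : HasDerivAt (fun x : ℝ => (x - μ i) / (v i : ℝ)) ((v i : ℝ)⁻¹) (z i) := by
      have := ((hasDerivAt_id (z i)).sub_const (μ i)).div_const (v i : ℝ)
      convert! this using 1
      simp
    exact h0.comp_hasFDerivAt z
      (ContinuousLinearMap.proj (R := ℝ) (φ := fun _ : Fin d => ℝ) i).hasFDerivAt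
  have hprod : ∀ z : Fin d → ℝ,
      fderiv ℝ (fun z : Fin d → ℝ => (z i - μ i) / (v i : ℝ) * f z) z (Pi.single j 1)
      = (z i - μ i) / (v i : ℝ) * fderiv ℝ f z (Pi.single j 1)
        + (if i = j then 1 / σ i ^ 2 else 0) * f z := by
    intro z
    rw [((hcoord z).fun_mul (hfd z).hasFDerivAt).fderiv]
    by_cases hij : i = j
    · subst hij
      simp [hvc]
      ring
    · simp [hij, hvc]
  have pδ := (PG.const (d := d) (if i = j then 1 / σ i ^ 2 else 0)).mul pf
  have pa := (PG.coord i (μ i) (v i)).mul (pf1 j)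
  have pb := (PG.coord j (μ j) (v j)).mul ((PG.coord i (μ i) (v i)).mul pf)
  have s2 := stein_pi μ v hv (fun z : Fin d → ℝ => (z i - μ i) / (v i : ℝ) * f z)
    (fun z => ((hcoord z).fun_mul (hfd z).hasFDerivAt).differentiableAt) j
    (((PG.coord i (μ i) (v i)).mul pf).integrable μ v)
    (by simp_rw [hprod]; exact (pa.integrable μ v).add (pδ.integrable μ v))
    (pb.integrable μ v)
  simp_rw [hprod] at s2
  rw [integral_add (pa.integrable μ v) (pδ.integrable μ v)] at s2
  have s3 := eq_sub_of_add_eq s2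
  rw [← integral_sub (pb.integrable μ v) (pδ.integrable μ v)] at s3
  rw [s1, s3]
  set S := ⨆ z : Fin d → ℝ, |f z| with hS
  have hfS : ∀ z, |f z| ≤ S := fun z => le_ciSup (f := fun z => |f z|) ⟨M, by
    rintro _ ⟨z, rfl⟩; exact hM z⟩ z
  have hS0 : 0 ≤ S := (abs_nonneg _).trans (hfS 0)
  have hw := weight_bound μ σ hσ i j
  have hwi : Integrable (fun z : Fin d → ℝ =>
      |(z j - μ j) / σ j ^ 2 * ((z i - μ i) / σ i ^ 2) - (if i = j then 1 / σ i ^ 2 else 0)|)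
      (Measure.pi fun k => gaussianReal (μ k) (v k)) :=
    ((((PG.coord j (μ j) (σ j ^ 2)).mul (PG.coord i (μ i) (σ i ^ 2))).integrable μ v).sub
      (integrable_const _)).abs
  calc _ ≤ ∫ z, |(z j - μ j) / σ j ^ 2 * ((z i - μ i) / σ i ^ 2)
          - (if i = j then 1 / σ i ^ 2 else 0)| * S
          ∂(Measure.pi fun k => gaussianReal (μ k) (v k)) := by
        rw [← Real.norm_eq_abs]
        refine norm_integral_le_of_norm_le (hwi.mul_const S) (Filter.Eventually.of_forall fun z => ?_)
        rw [Real.norm_eq_abs, hvc, hvc, ← mul_assoc, ← sub_mul, abs_mul]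
        gcongr
        exact hfS z
    _ ≤ _ := by
        rw [integral_mul_const]
        gcongr

end
end
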